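/- Fix an algebraically closed field K (of arbitrary characteristic) and positive integers n and m. The ring of matrix semi-invariants R(n,m) = K[Mat_{n,n}^m]^{SL_n × SL_n} is generated by its homogeneous elements of degree at most m·n^4. -/

import Mathlib

open MvPolynomial Matrix

/-- Coordinate functions of an `m`-tuple of `n × n` matrices. -/
def matCoords {K : Type} [Field K] {n m : ℕ} (X : Fin m → Matrix (Fin n) (Fin n) K) :
    Fin m × Fin n × Fin n → K :=
  fun p => X p.1 p.2.1 p.2.2

/-- The ring of matrix semi-invariants `R(n,m) = K[Mat_{n,n}^m]^{SL_n × SL_n}`, where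
`(A,B)` acts by `(X_1, …, X_m) ↦ (A X_1 B⁻¹, …, A X_m B⁻¹)`. -/
noncomputable def matrixSemiInvariants (K : Type) [Field K] (n m : ℕ) :
    Subalgebra K (MvPolynomial (Fin m × Fin n × Fin n) K) :=
  ⨅ (A : SpecialLinearGroup (Fin n) K) (B : SpecialLinearGroup (Fin n) K)
    (X : Fin m → Matrix (Fin n) (Fin n) K),
      AlgHom.equalizer
        (aeval (matCoords fun i => A.val * X i * (B⁻¹).val))
        (aeval (matCoords X))

/-- The ring of matrix invariants `S(n,m) = K[Mat_{n,n}^m]^{GL_n}`, where `A` acts by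
simultaneous conjugation. -/
noncomputable def matrixInvariants (K : Type) [Field K] (n m : ℕ) :
    Subalgebra K (MvPolynomial (Fin m × Fin n × Fin n) K) :=
  ⨅ (A : GeneralLinearGroup (Fin n) K) (X : Fin m → Matrix (Fin n) (Fin n) K),
      AlgHom.equalizer
        (aeval (matCoords fun i => A.val * X i * (A⁻¹).val))
        (aeval (matCoords X))


set_option linter.all false

theorem SL_induction_all {n : ℕ} {F : Type*} [Field F] (P : Matrix (Fin n) (Fin n) F → Prop)
    (h1 : P 1) (hmul : ∀ A B, P A → P B → P (A * B))
    (htr : ∀ i j : Fin n, i ≠ j → ∀ c, P (transvection i j c))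
    (A : Matrix (Fin n) (Fin n) F) (hA : A.det = 1) : P A := by
  rcases subsingleton_or_nontrivial (Fin n) with hs | hs
  · have : A = 1 := by
      ext i j
      obtain rfl := Subsingleton.elim i j
      have := Matrix.det_eq_elem_of_subsingleton A i
      rw [hA] at this
      simp [this]
    rw [this]; exact h1
  · refine SpecialLinearGroup.diagonal_transvection_induction'
      (fun A : SpecialLinearGroup (Fin n) F => P A.1) ⟨A, hA⟩ ?_ ?_ ?_
    · intro i j hij c hc
      have key : (SpecialLinearGroup.diag2n hij c hc).1 =
        transvection i j c * transvection j i (-c⁻¹) * transvection i j c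
          * transvection i j (-1) * transvection j i 1 * transvection i j (-1) := by
        rw [SpecialLinearGroup.diag2n_coe]
        simp only [transvection]
        simp only [mul_add, add_mul, mul_one, one_mul, Matrix.single_mul_single_same,
          Matrix.single_mul_single_of_ne, hij, hij.symm, ne_eq, not_false_eq_true, zero_mul, mul_zero,
          add_zero, zero_add]
        ext a b
        simp only [Matrix.diagonal_apply, Matrix.add_apply, Matrix.single_apply, Matrix.one_apply]
        by_cases h1 : a = b
        · subst h1
          by_cases h2 : a = i
          · subst h2
            simp [hij, hij.symm, hc]
          · by_cases h3 : a = j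
            · subst h3
              simp [hij, hij.symm, hc]
            · have := Ne.symm h2
              have := Ne.symm h3
              simp [*]
        · by_cases h2 : i = a
          · subst h2
            by_cases h3 : j = b
            · subst h3; simp [hij, hij.symm, hc]
            · simp [hij, hij.symm, h1, h3, hc]
          · by_cases h3 : j = a
            · subst h3
              by_cases h4 : i = b
              · subst h4; simp [hij, hij.symm, hc]
              · simp [hij, hij.symm, h1, h4, hc]
            · simp [*]
      show P (SpecialLinearGroup.diag2n hij c hc).1
      rw [key]
      exact hmul _ _ (hmul _ _ (hmul _ _ (hmul _ _ (hmul _ _ (htr _ _ hij _) (htr _ _ hij.symm _))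
        (htr _ _ hij _)) (htr _ _ hij _)) (htr _ _ hij.symm _)) (htr _ _ hij _)
    · intro i j hij a
      exact htr i j hij a
    · intro A B hA hB
      exact hmul _ _ hA hB

theorem transvection_comm {n : ℕ} {F : Type*} [Field F] (i k j : Fin n) (hik : i ≠ k) (hkj : k ≠ j)
    (hij : i ≠ j) (c : F) : transvection i j c =
      transvection i k c * transvection k j 1 * transvection i k (-c) * transvection k j (-1) := by
  simp only [transvection]
  simp only [mul_add, add_mul, mul_one, one_mul, Matrix.single_mul_single_same,
          Matrix.single_mul_single_of_ne, hij, hik, hkj, hij.symm, hik.symm, hkj.symm, ne_eq, not_false_eq_true, zero_mul, mul_zero,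
          add_zero, zero_add]
  have e1 : ∀ (a b : Fin n) (c : F), single a b (-c) = - single a b c := fun a b c => by
    ext; simp [Matrix.single_apply]; split_ifs <;> simp
  simp only [e1]
  abel_nf
  simp [e1]

theorem transvections_of_simple {n : ℕ} {F : Type*} [Field F] (P : Matrix (Fin n) (Fin n) F → Prop)
    (hmul : ∀ A B, P A → P B → P (A * B))
    (htr : ∀ i j : Fin n, (i.val + 1 = j.val ∨ j.val + 1 = i.val) → ∀ c, P (transvection i j c)) :
    ∀ i j : Fin n, i ≠ j → ∀ c, P (transvection i j c) := by
  have H : ∀ d : ℕ, ∀ i j : Fin n, (i.val + (d + 1) = j.val ∨ j.val + (d + 1) = i.val) →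
      ∀ c, P (transvection i j c) := by
    intro d
    induction d with
    | zero => exact fun i j h c => htr i j h c
    | succ d ih =>
      intro i j h c
      obtain ⟨k, hk1, hk2⟩ : ∃ k : Fin n, (i.val + 1 = k.val ∨ k.val + 1 = i.val) ∧
          (k.val + (d + 1) = j.val ∨ j.val + (d + 1) = k.val) := by
        rcases h with h | h
        · exact ⟨⟨i.val + 1, by omega⟩, Or.inl rfl, Or.inl (by simp; omega)⟩
        · exact ⟨⟨i.val - 1, by omega⟩, Or.inr (by simp; omega), Or.inr (by simp; omega)⟩
      have hik : i ≠ k := fun h => by subst h; omega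
      have hkj : k ≠ j := fun h => by subst h; omega
      have hij : i ≠ j := fun h => by subst h; omega
      rw [transvection_comm i k j hik hkj hij c]
      exact hmul _ _ (hmul _ _ (hmul _ _ (htr _ _ hk1 _) (ih _ _ hk2 _)) (htr _ _ hk1 _)) (ih _ _ hk2 _)
  intro i j hij c
  have : i.val ≠ j.val := fun h => hij (Fin.ext h)
  rcases lt_or_gt_of_ne this with h | h
  · exact H (j.val - i.val - 1) i j (Or.inl (by omega)) c
  · exact H (i.val - j.val - 1) i j (Or.inr (by omega)) c

abbrev Idx (n m : ℕ) := Fin m × Fin n × Fin n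

def coo {A : Type*} {n m : ℕ} (X : Fin m → Matrix (Fin n) (Fin n) A) : Idx n m → A :=
  fun p => X p.1 p.2.1 p.2.2

def rowPt {A : Type*} [CommRing A] {n m : ℕ} (a b : Fin n) (t : A) (x : Idx n m → A) : Idx n m → A :=
  fun p => x p + if p.2.1 = a then t * x (p.1, b, p.2.2) else 0

def colPt {A : Type*} [CommRing A] {n m : ℕ} (a b : Fin n) (t : A) (x : Idx n m → A) : Idx n m → A :=
  fun p => x p + if p.2.2 = a then t * x (p.1, p.2.1, b) else 0

theorem coo_row {A : Type*} [CommRing A] {n m : ℕ} (a b : Fin n) (t : A)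
    (X : Fin m → Matrix (Fin n) (Fin n) A) :
    coo (fun i => transvection a b t * X i) = rowPt a b t (coo X) := by
  funext ⟨i, r, c⟩
  simp only [coo, rowPt, transvection, add_mul, one_mul, Matrix.add_apply]
  by_cases h : r = a
  · subst h; simp
  · simp [h]

theorem coo_col {A : Type*} [CommRing A] {n m : ℕ} (a b : Fin n) (t : A)
    (X : Fin m → Matrix (Fin n) (Fin n) A) :
    coo (fun i => X i * transvection b a t) = colPt a b t (coo X) := by
  funext ⟨i, r, c⟩
  simp only [coo, colPt, transvection, mul_add, mul_one, Matrix.add_apply]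
  by_cases h : c = a
  · subst h; simp [mul_comm]
  · simp [h]

/-- Formal invariance under all transvections. -/
def SInv {k : Type*} [CommRing k] {n m : ℕ} (f : MvPolynomial (Idx n m) k) : Prop :=
  ∀ a b : Fin n, a ≠ b →
    aeval (rowPt a b Polynomial.X (fun p => Polynomial.C (X p : MvPolynomial (Idx n m) k))) f
      = Polynomial.C f ∧
    aeval (colPt a b Polynomial.X (fun p => Polynomial.C (X p : MvPolynomial (Idx n m) k))) f
      = Polynomial.C f

theorem SInv.row {k : Type*} [CommRing k] {n m : ℕ} {f : MvPolynomial (Idx n m) k} (hf : SInv f)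
    {A : Type*} [CommRing A] [Algebra k A] {a b : Fin n} (hab : a ≠ b) (t : A) (x : Idx n m → A) :
    aeval (rowPt a b t x) f = aeval x f := by
  have := congrArg (Polynomial.eval₂ (aeval x : MvPolynomial (Idx n m) k →ₐ[k] A).toRingHom t) (hf a b hab).1
  simp only [Polynomial.eval₂_C] at this
  refine Eq.trans ?_ this
  let ψ : Polynomial (MvPolynomial (Idx n m) k) →ₐ[k] A :=
    { Polynomial.eval₂RingHom (aeval x : MvPolynomial (Idx n m) k →ₐ[k] A).toRingHom t with
      commutes' := fun r => by
        simp [Polynomial.algebraMap_apply, MvPolynomial.algebraMap_eq] }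
  change _ = ψ _
  rw [← AlgHom.comp_apply, MvPolynomial.comp_aeval]
  congr 2
  funext p
  change _ = Polynomial.eval₂ _ _ _
  simp [rowPt, Polynomial.eval₂_add]
  split_ifs <;> simp [Polynomial.eval₂_mul] <;> exact mul_comm _ _

theorem SInv.col {k : Type*} [CommRing k] {n m : ℕ} {f : MvPolynomial (Idx n m) k} (hf : SInv f)
    {A : Type*} [CommRing A] [Algebra k A] {a b : Fin n} (hab : a ≠ b) (t : A) (x : Idx n m → A) :
    aeval (colPt a b t x) f = aeval x f := by
  have := congrArg (Polynomial.eval₂ (aeval x : MvPolynomial (Idx n m) k →ₐ[k] A).toRingHom t) (hf a b hab).2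
  simp only [Polynomial.eval₂_C] at this
  refine Eq.trans ?_ this
  let ψ : Polynomial (MvPolynomial (Idx n m) k) →ₐ[k] A :=
    { Polynomial.eval₂RingHom (aeval x : MvPolynomial (Idx n m) k →ₐ[k] A).toRingHom t with
      commutes' := fun r => by
        simp [Polynomial.algebraMap_apply, MvPolynomial.algebraMap_eq] }
  change _ = ψ _
  rw [← AlgHom.comp_apply, MvPolynomial.comp_aeval]
  congr 2
  funext p
  change _ = Polynomial.eval₂ _ _ _
  simp [colPt, Polynomial.eval₂_add]
  split_ifs <;> simp [Polynomial.eval₂_mul] <;> exact mul_comm _ _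

theorem SInv.left {k : Type*} [CommRing k] {n m : ℕ} {f : MvPolynomial (Idx n m) k} (hf : SInv f)
    {L : Type*} [Field L] [Algebra k L] (A : Matrix (Fin n) (Fin n) L) (hA : A.det = 1) :
    ∀ (X : Fin m → Matrix (Fin n) (Fin n) L),
    aeval (coo fun i => A * X i) f = aeval (coo X) f := by
  refine SL_induction_all (fun A => ∀ (X : Fin m → Matrix (Fin n) (Fin n) L),
    aeval (coo fun i => A * X i) f = aeval (coo X) f) ?_ ?_ ?_ A hA
  · simp
  · intro A B hA hB X
    simp only [mul_assoc]
    rw [hA (fun i => B * X i), hB]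
  · intro i j hij c X
    rw [coo_row, hf.row hij]

theorem SInv.right {k : Type*} [CommRing k] {n m : ℕ} {f : MvPolynomial (Idx n m) k} (hf : SInv f)
    {L : Type*} [Field L] [Algebra k L] (A : Matrix (Fin n) (Fin n) L) (hA : A.det = 1) :
    ∀ (X : Fin m → Matrix (Fin n) (Fin n) L),
    aeval (coo fun i => X i * A) f = aeval (coo X) f := by
  refine SL_induction_all (fun A => ∀ (X : Fin m → Matrix (Fin n) (Fin n) L),
    aeval (coo fun i => X i * A) f = aeval (coo X) f) ?_ ?_ ?_ A hA
  · simp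
  · intro A B hA hB X
    simp only [← mul_assoc]
    rw [hB (fun i => X i * A), hA]
  · intro i j hij c X
    rw [coo_col, hf.col hij.symm]

theorem SInv_of_points {k : Type*} [Field k] [Infinite k] {n m : ℕ} {f : MvPolynomial (Idx n m) k}
    (h : ∀ a b : Fin n, a ≠ b → ∀ t : k, ∀ x : Idx n m → k,
      aeval (rowPt a b t x) f = aeval x f ∧ aeval (colPt a b t x) f = aeval x f) : SInv f := by
  have key : ∀ D : Polynomial (MvPolynomial (Idx n m) k),
      (∀ (t : k) (x : Idx n m → k), aeval x (Polynomial.eval (C t) D) = 0) → D = 0 := by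
    intro D hD
    refine Polynomial.eq_zero_of_infinite_isRoot D ?_
    refine Set.Infinite.mono (s := Set.range (C : k → MvPolynomial (Idx n m) k)) ?_
      (Set.infinite_range_of_injective (C_injective _ _))
    rintro _ ⟨t, rfl⟩
    show Polynomial.eval (C t) D = 0
    refine MvPolynomial.funext fun x => ?_
    rw [map_zero]; exact hD t x
  have e : ∀ (t : k) (x : Idx n m → k) (y : Idx n m → Polynomial (MvPolynomial (Idx n m) k)),
      aeval x (Polynomial.eval (C t) (aeval y f)) =
        aeval (fun p => aeval x (Polynomial.eval (C t) (y p))) f := by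
    intro t x y
    let ψ : Polynomial (MvPolynomial (Idx n m) k) →ₐ[k] k :=
      (aeval x).comp
        { Polynomial.evalRingHom (C t : MvPolynomial (Idx n m) k) with
          commutes' := fun r => by simp [Polynomial.algebraMap_apply, MvPolynomial.algebraMap_eq] }
    change ψ _ = aeval (fun p => ψ _) f
    rw [← AlgHom.comp_apply, MvPolynomial.comp_aeval]
  intro a b hab
  constructor
  · rw [← sub_eq_zero]
    refine key _ fun t x => ?_
    rw [Polynomial.eval_sub, map_sub, e, Polynomial.eval_C, sub_eq_zero, ← (h a b hab t x).1]
    congr 2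
    funext p
    simp [rowPt]; split_ifs <;> simp <;> exact mul_comm _ _
  · rw [← sub_eq_zero]
    refine key _ fun t x => ?_
    rw [Polynomial.eval_sub, map_sub, e, Polynomial.eval_C, sub_eq_zero, ← (h a b hab t x).2]
    congr 2
    funext p
    simp [colPt]; split_ifs <;> simp <;> exact mul_comm _ _

theorem SInv_of_simple {k : Type*} [Field k] [Infinite k] {n m : ℕ} {f : MvPolynomial (Idx n m) k}
    (h : ∀ a b : Fin n, (a.val + 1 = b.val ∨ b.val + 1 = a.val) → ∀ t : k, 
      aeval (rowPt a b (C t) (X : Idx n m → MvPolynomial (Idx n m) k)) f = f ∧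
      aeval (colPt a b (C t) (X : Idx n m → MvPolynomial (Idx n m) k)) f = f) : SInv f := by
  have tocoo : ∀ x : Idx n m → k, ∃ Y : Fin m → Matrix (Fin n) (Fin n) k, x = coo Y := fun x =>
    ⟨fun i => Matrix.of fun r c => x (i, r, c), rfl⟩
  have e : ∀ (x : Idx n m → k) (y : Idx n m → MvPolynomial (Idx n m) k),
      aeval x (aeval y f) = aeval (fun p => aeval x (y p)) f := by
    intro x y
    rw [← AlgHom.comp_apply, MvPolynomial.comp_aeval]
  have h1 := transvections_of_simple (fun A => ∀ (X : Fin m → Matrix (Fin n) (Fin n) k),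
    aeval (coo fun i => A * X i) f = aeval (coo X) f) 
    (by intro A B hA hB X
        simp only [mul_assoc]
        rw [hA (fun i => B * X i), hB]) 
    (by 
      intro a b hab t X
      conv_rhs => rw [← (h a b hab t).1]
      rw [e, coo_row]
      congr 2
      funext p
      simp [rowPt]; split_ifs <;> simp)
  have h2 := transvections_of_simple (fun A => ∀ (X : Fin m → Matrix (Fin n) (Fin n) k),
    aeval (coo fun i => X i * A) f = aeval (coo X) f) 
    (by intro A B hA hB X
        simp only [← mul_assoc]
        rw [hB (fun i => X i * A), hA]) 
    (by 
      intro a b hab t X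
      conv_rhs => rw [← (h b a hab.symm t).2]
      rw [e, coo_col]
      congr 2
      funext p
      simp [colPt]; split_ifs <;> simp)
  refine SInv_of_points fun a b hab t x => ?_
  obtain ⟨Y, rfl⟩ := tocoo x
  rw [← coo_row, ← coo_col]
  exact ⟨h1 a b hab t Y, h2 b a hab.symm t Y⟩

theorem exists_indep_cols {ι κ k : Type*} [Field k] [Fintype ι] [Fintype κ] (A : Matrix ι κ k) :
    ∃ J : Fin A.rank → κ, LinearIndependent k (fun s => A.col (J s)) ∧
      ∀ c, A.col c ∈ Submodule.span k (Set.range fun s => A.col (J s)) := by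
  obtain ⟨f, hf1, hf2, hf3⟩ := Submodule.exists_fun_fin_finrank_span_eq k (Set.range A.col)
  rw [rank_eq_finrank_span_cols]
  choose J hJ using hf1
  have : (fun s => A.col (J s)) = f := funext hJ
  refine ⟨J, this ▸ hf3, fun c => ?_⟩
  rw [this, hf2]
  exact Submodule.subset_span ⟨c, rfl⟩

theorem exists_minor {ι κ k : Type*} [Field k] [Fintype ι] [Fintype κ] (A : Matrix ι κ k) :
    ∃ (I : Fin A.rank → ι) (J : Fin A.rank → κ), (A.submatrix I J).det ≠ 0 := by
  obtain ⟨J, hJ, -⟩ := exists_indep_cols A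
  have h1 : (A.submatrix id J)ᵀ.rank = A.rank := by
    have : LinearIndependent k (A.submatrix id J)ᵀ.row := hJ
    rw [LinearIndependent.rank_matrix this, Fintype.card_fin]
  obtain ⟨I, hI, -⟩ := exists_indep_cols (A.submatrix id J)ᵀ
  rw [h1] at I
  revert hI
  intro hI
  obtain ⟨I, hI, -⟩ := exists_indep_cols (A.submatrix id J)ᵀ
  refine ⟨fun s => I (Fin.cast h1.symm s), J, ?_⟩
  have h2 : LinearIndependent k (A.submatrix (fun s => I (Fin.cast h1.symm s)) J).row :=
    hI.comp (Fin.cast h1.symm) (Fin.cast_injective _)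
  have := (Matrix.linearIndependent_rows_iff_isUnit).1 h2
  exact ((Matrix.isUnit_iff_isUnit_det _).1 this).ne_zero

theorem exists_factor {ι κ k : Type*} [Field k] [Fintype ι] [Fintype κ] (A : Matrix ι κ k) :
    ∃ (P : Matrix ι (Fin A.rank) k) (Q : Matrix (Fin A.rank) κ k), A = P * Q := by
  obtain ⟨J, hJ, hs⟩ := exists_indep_cols A
  have : ∀ c, ∃ q : Fin A.rank → k, ∑ s, q s • A.col (J s) = A.col c := fun c =>
    (Submodule.mem_span_range_iff_exists_fun k).1 (hs c)
  choose q hq using this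
  refine ⟨A.submatrix id J, Matrix.of fun s c => q c s, ?_⟩
  ext r c
  have := congrFun (hq c) r
  simp only [Finset.sum_apply, Pi.smul_apply, Matrix.col_apply, smul_eq_mul] at this
  rw [Matrix.mul_apply, ← this]
  simp [mul_comm]

theorem minor_identity {ι κ k : Type*} [Field k] [Fintype ι] [Fintype κ] (A : Matrix ι κ k)
    {ρ : ℕ} (h : A.rank ≤ ρ) (I I' : Fin ρ → ι) (J J' : Fin ρ → κ) :
    (A.submatrix I J).det * (A.submatrix I' J').det =
      (A.submatrix I J').det * (A.submatrix I' J).det := by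
  rcases h.lt_or_eq with h | h
  · have : ∀ (I : Fin ρ → ι) (J : Fin ρ → κ), (A.submatrix I J).det = 0 := by
      intro I J
      by_contra h0
      have := rank_of_det_ne_zero h0
      rw [Fintype.card_fin] at this
      have := rank_submatrix_le A I J
      omega
    simp [this]
  · subst h
    obtain ⟨P, Q, h⟩ := exists_factor A
    have : ∀ (I : Fin A.rank → ι) (J : Fin A.rank → κ), (A.submatrix I J).det =
       (P.submatrix I id).det * (Q.submatrix id J).det := by
      intro I J
      rw [← det_mul]
      congr 1
      ext r c
      exact congrFun (congrFun h (I r)) (J c)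
    rw [this, this, this, this]; ring

section wh
variable {k σ : Type*} [Field k]

noncomputable def wPhi (w : σ → ℕ) : MvPolynomial σ k →ₐ[k] Polynomial (MvPolynomial σ k) :=
  aeval fun v => Polynomial.C (X v) * Polynomial.X ^ (w v)

theorem wPhi_monomial (w : σ → ℕ) (s : σ →₀ ℕ) (c : k) :
    wPhi w (monomial s c) = Polynomial.monomial (Finsupp.weight w s) (monomial s c) := by
  rw [wPhi, aeval_monomial, Finsupp.weight_apply, Finsupp.prod, Finsupp.sum,
   ← Polynomial.C_mul_X_pow_eq_monomial, MvPolynomial.monomial_eq]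
  simp only [mul_pow, Finset.prod_mul_distrib, ← pow_mul, Finset.prod_pow_eq_pow_sum]
  rw [← mul_assoc]
  congr 1
  · rw [Polynomial.algebraMap_apply, MvPolynomial.algebraMap_eq, Polynomial.C_mul, Finsupp.prod]
    congr 1
    rw [map_prod]
    simp only [Polynomial.C_pow]
  · congr 1
    refine Finset.sum_congr rfl fun x _ => ?_
    simp [mul_comm]

theorem coeff_wPhi (w : σ → ℕ) (f : MvPolynomial σ k) (e : ℕ) :
    (wPhi w f).coeff e = weightedHomogeneousComponent w e f := by
  induction f using MvPolynomial.induction_on' with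
  | monomial s c =>
    rw [wPhi_monomial, Polynomial.coeff_monomial]
    split_ifs with h
    · exact (weightedHomogeneousComponent_eq_self (isWeightedHomogeneous_monomial w s c h)).symm
    · exact ((isWeightedHomogeneous_monomial w s c rfl).weightedHomogeneousComponent_ne e (Ne.symm h)).symm
  | add p q hp hq => simp [hp, hq]

theorem wPhi_inj (w : σ → ℕ) (f : MvPolynomial σ k) (h : wPhi w f = 0) : f = 0 := by
  rw [← finsum_weightedHomogeneousComponent w f]
  simp [← coeff_wPhi, h]

theorem wh_iff (w : σ → ℕ) (f : MvPolynomial σ k) (e : ℕ) :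
    IsWeightedHomogeneous w f e ↔ wPhi w f = Polynomial.monomial e f := by
  constructor
  · intro h
    ext1 d
    rw [coeff_wPhi, Polynomial.coeff_monomial]
    split_ifs with hd
    · subst hd; exact weightedHomogeneousComponent_eq_self h
    · exact h.weightedHomogeneousComponent_ne d (Ne.symm hd)
  · intro h
    have := congrArg (fun q => Polynomial.coeff q e) h
    simp only [coeff_wPhi, Polynomial.coeff_monomial, if_true] at this
    rw [← this]
    exact weightedHomogeneousComponent_isWeightedHomogeneous _ _

theorem wh_of_mul (w : σ → ℕ) {f g : MvPolynomial σ k} {e : ℕ} (hfg : f * g ≠ 0)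
    (h : IsWeightedHomogeneous w (f * g) e) : ∃ e', IsWeightedHomogeneous w f e' := by
  have h0 := (wh_iff w _ _).1 h
  rw [map_mul] at h0
  have hf : wPhi w f ≠ 0 := fun h => left_ne_zero_of_mul hfg (wPhi_inj w f h)
  have hg : wPhi w g ≠ 0 := fun h => right_ne_zero_of_mul hfg (wPhi_inj w g h)
  have h1 := Polynomial.natDegree_mul hf hg
  have h2 := Polynomial.natTrailingDegree_mul hf hg
  rw [h0, Polynomial.natDegree_monomial_eq _ hfg] at h1
  rw [h0, Polynomial.natTrailingDegree_monomial hfg] at h2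
  have h3 := Polynomial.natTrailingDegree_le_natDegree (wPhi w f)
  have h4 := Polynomial.natTrailingDegree_le_natDegree (wPhi w g)
  refine ⟨(wPhi w f).natDegree, ?_⟩
  have key : ∀ d, d ≠ (wPhi w f).natDegree → weightedHomogeneousComponent w d f = 0 := by
    intro d hd
    rw [← coeff_wPhi]
    rcases lt_or_gt_of_ne hd with h | h
    · exact Polynomial.coeff_eq_zero_of_lt_natTrailingDegree (by omega)
    · exact Polynomial.coeff_eq_zero_of_natDegree_lt h
  have : weightedHomogeneousComponent w (wPhi w f).natDegree f = f := by
    conv_rhs => rw [← finsum_weightedHomogeneousComponent w f]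
    rw [finsum_eq_single (fun d => weightedHomogeneousComponent w d f) _ key]
  have h5 := weightedHomogeneousComponent_isWeightedHomogeneous (R := k) (w := w) (wPhi w f).natDegree f
  rwa [this] at h5

theorem const_deg {δ : Type*} (τ : Equiv.Perm δ → Equiv.Perm σ) (w : δ → σ → ℕ)
    (hw : ∀ π a v, w (π a) (τ π v) = w a v) {G : MvPolynomial σ k} (hG : G ≠ 0)
    (hh : ∀ a, ∃ e, IsWeightedHomogeneous (w a) G e)
    (hdvd : ∀ π, G ∣ rename (τ π) G) : ∃ c, ∀ a, IsWeightedHomogeneous (w a) G c := by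
  classical
  choose D hD using hh
  have key : ∀ (π : Equiv.Perm δ) a, D (π a) ≤ D a := by
    intro π a
    have h1 : IsWeightedHomogeneous (w (π a)) (rename (τ π) G) (D a) := by
      intro s hs
      obtain ⟨u, hu, hu'⟩ := coeff_rename_ne_zero _ _ _ hs
      rw [← hD a hu', ← hu]
      simp only [Finsupp.weight_apply]
      rw [Finsupp.sum_mapDomain_index (by simp) (by intros; simp [add_mul])]
      refine Finsupp.sum_congr fun x _ => ?_
      rw [hw]
    obtain ⟨H, hH⟩ := hdvd π
    have hne : rename (τ π) G ≠ 0 := by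
      intro h
      exact hG (rename_injective _ (τ π).injective (by rw [h, map_zero]))
    rw [hH] at h1 hne
    obtain ⟨e, he⟩ := wh_of_mul (w (π a)) (f := H) (g := G) (by rwa [mul_comm]) (by rwa [mul_comm])
    have := (hD (π a)).mul he
    have := this.inj_right hne h1
    omega
  rcases isEmpty_or_nonempty δ with h | ⟨⟨a⟩⟩
  · exact ⟨0, fun a => h.elim a⟩
  · refine ⟨D a, fun b => ?_⟩
    have e1 := key (Equiv.swap a b) a
    have e2 := key (Equiv.swap a b) b
    simp at e1 e2
    rw [le_antisymm e2 e1]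
    exact hD b
end wh

section reg
variable {k : Type*} [Field k] {n m : ℕ} {δ : Type*} [Fintype δ] [DecidableEq δ]

/-- the blow-up matrix `∑ Y_i ⊗ T_i` over any commutative ring -/
def bl {A : Type*} [CommRing A] (Y : Fin m → Matrix (Fin n) (Fin n) A) (T : Fin m → Matrix δ δ A) :
    Matrix (Fin n × δ) (Fin n × δ) A :=
  Matrix.of fun p q => ∑ i, Y i p.1 q.1 * T i p.2 q.2

noncomputable def genM (Y : Fin m → Matrix (Fin n) (Fin n) k) :
    Matrix (Fin n × δ) (Fin n × δ) (MvPolynomial (Fin m × δ × δ) k) :=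
  Matrix.of fun p q => ∑ i, C (Y i p.1 q.1) * X (i, p.2, q.2)

noncomputable def gMin (Y : Fin m → Matrix (Fin n) (Fin n) k) {ρ : ℕ} (I J : Fin ρ → Fin n × δ) :
    MvPolynomial (Fin m × δ × δ) k := ((genM Y).submatrix I J).det

theorem eval_gMin (Y : Fin m → Matrix (Fin n) (Fin n) k) {ρ : ℕ} (I J : Fin ρ → Fin n × δ)
    (x : Fin m × δ × δ → k) :
    eval x (gMin Y I J) = ((bl Y fun i => Matrix.of fun a b => x (i, a, b)).submatrix I J).det := by
  rw [gMin, RingHom.map_det]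
  congr 1
  ext r c
  simp [genM, bl]

theorem gMin_identity [Infinite k] (Y : Fin m → Matrix (Fin n) (Fin n) k) {ρ : ℕ}
    (h : ∀ T : Fin m → Matrix δ δ k, (bl Y T).rank ≤ ρ) (I I' J J' : Fin ρ → Fin n × δ) :
    gMin Y I J * gMin Y I' J' = gMin Y I J' * gMin Y I' J := by
  refine MvPolynomial.funext fun x => ?_
  simp only [map_mul, eval_gMin]
  exact minor_identity _ (h _) _ _ _ _

theorem gMin_wh (Y : Fin m → Matrix (Fin n) (Fin n) k) {ρ : ℕ} (I J : Fin ρ → Fin n × δ)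
    (w : Fin m × δ × δ → ℕ) (u v : δ → ℕ) (hw : ∀ i a b, w (i, a, b) = u a + v b) :
    IsWeightedHomogeneous w (gMin Y I J) (∑ s, u (I s).2 + ∑ s, v (J s).2) := by
  rw [gMin, Matrix.det_apply]
  refine IsWeightedHomogeneous.sum _ _ _ fun σ _ => ?_
  have : IsWeightedHomogeneous w (∏ i, (genM Y).submatrix I J (σ i) i)
      (∑ s, u (I s).2 + ∑ s, v (J s).2) := by
    have e : (∑ s, u (I s).2 + ∑ s, v (J s).2) = ∑ s, (u (I (σ s)).2 + v (J s).2) := by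
      rw [Finset.sum_add_distrib, Equiv.sum_comp σ fun s => u (I s).2]
    rw [e]
    refine IsWeightedHomogeneous.prod _ _ _ fun s _ => ?_
    simp only [genM, submatrix_apply, of_apply]
    refine IsWeightedHomogeneous.sum _ _ _ fun i _ => ?_
    refine IsWeightedHomogeneous.C_mul ?_ _
    rw [← hw i]
    exact isWeightedHomogeneous_X _ _ _
  rcases Int.units_eq_one_or (Equiv.Perm.sign σ) with h | h
  · rw [h, one_smul]; exact this
  · rw [h, Units.neg_smul, one_smul]; exact this.neg

theorem rename_gMin_row (Y : Fin m → Matrix (Fin n) (Fin n) k) {ρ : ℕ} (I J : Fin ρ → Fin n × δ)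
    (π : Equiv.Perm δ) :
    rename (Equiv.prodCongr (Equiv.refl (Fin m)) (Equiv.prodCongr π (Equiv.refl δ))) (gMin Y I J)
      = gMin Y (fun s => ((I s).1, π (I s).2)) J := by
  rw [gMin, AlgHom.map_det, gMin]
  congr 1
  ext1 r c
  simp [genM]

theorem rename_gMin_col (Y : Fin m → Matrix (Fin n) (Fin n) k) {ρ : ℕ} (I J : Fin ρ → Fin n × δ)
    (π : Equiv.Perm δ) :
    rename (Equiv.prodCongr (Equiv.refl (Fin m)) (Equiv.prodCongr (Equiv.refl δ) π)) (gMin Y I J)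
      = gMin Y I (fun s => ((J s).1, π (J s).2)) := by
  rw [gMin, AlgHom.map_det, gMin]
  congr 1
  ext1 r c
  simp [genM]

theorem regularity [Infinite k] (Y : Fin m → Matrix (Fin n) (Fin n) k) (ρ : ℕ)
    (h : ∀ T : Fin m → Matrix δ δ k, (bl Y T).rank ≤ ρ)
    (h' : ∃ T : Fin m → Matrix δ δ k, (bl Y T).rank = ρ) : Fintype.card δ ∣ ρ := by
  classical
  obtain ⟨I₀, J₀, hIJ⟩ : ∃ I J : Fin ρ → Fin n × δ, gMin Y I J ≠ 0 := by
    obtain ⟨T, rfl⟩ := h'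
    obtain ⟨I, J, hIJ⟩ := exists_minor (bl Y T)
    refine ⟨I, J, fun h0 => hIJ ?_⟩
    have := eval_gMin Y I J (fun p => T p.1 p.2.1 p.2.2)
    rw [h0, map_zero] at this
    exact this.symm
  letI : NormalizedGCDMonoid (MvPolynomial (Fin m × δ × δ) k) :=
    Classical.choice (inferInstance : Nonempty (NormalizedGCDMonoid _))
  obtain ⟨ω, hω1, hω2⟩ := Finset.extract_gcd (s := Finset.univ) (fun I => gMin Y I J₀) ⟨I₀, Finset.mem_univ _⟩
  set G := Finset.univ.gcd (fun I => gMin Y I J₀) with hGdef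
  have hG0 : G * ω I₀ ≠ 0 := by rw [← hω1 I₀ (Finset.mem_univ _)]; exact hIJ
  have hG : G ≠ 0 := left_ne_zero_of_mul hG0
  have hω0 : ω I₀ ≠ 0 := right_ne_zero_of_mul hG0
  have hprod : gMin Y I₀ J₀ = G * ω I₀ := hω1 I₀ (Finset.mem_univ _)
  have inj : ∀ τ : Equiv.Perm (Fin m × δ × δ), Function.Injective (rename τ : MvPolynomial (Fin m × δ × δ) k → _) :=
    fun τ => rename_injective _ τ.injective
  have renren : ∀ (τ τ' : Equiv.Perm (Fin m × δ × δ)) (_ : τ * τ' = 1) (f : MvPolynomial (Fin m × δ × δ) k),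
      rename τ (rename τ' f) = f := by
    intro τ τ' h f
    rw [rename_rename]
    have : (τ : _ → _) ∘ τ' = id := by
      funext x; exact congrArg (fun e : Equiv.Perm _ => e x) h
    rw [this, rename_id]; rfl
  -- row constancy of G
  obtain ⟨c, hc⟩ : ∃ c, ∀ a : δ, IsWeightedHomogeneous (fun v : Fin m × δ × δ => if v.2.1 = a then 1 else 0) G c := by
    refine const_deg (fun π => Equiv.prodCongr (Equiv.refl (Fin m)) (Equiv.prodCongr π (Equiv.refl δ)))
      (fun a v => if v.2.1 = a then 1 else 0) ?_ hG ?_ ?_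
    · intro π a v; simp
    · intro a
      exact wh_of_mul _ hG0 (hprod ▸ gMin_wh Y I₀ J₀ _ (fun b => if b = a then 1 else 0) (fun _ => 0) (by simp))
    · intro π
      have key : ∀ π : Equiv.Perm δ, rename (Equiv.prodCongr (Equiv.refl (Fin m)) (Equiv.prodCongr π (Equiv.refl δ))) G ∣ G := by
        intro π
        refine Finset.dvd_gcd fun I _ => ?_
        have : gMin Y I J₀ = rename (Equiv.prodCongr (Equiv.refl (Fin m)) (Equiv.prodCongr π (Equiv.refl δ)))
          (gMin Y (fun s => ((I s).1, π.symm (I s).2)) J₀) := by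
          rw [rename_gMin_row]; simp
        rw [this]
        exact map_dvd _ (Finset.gcd_dvd (Finset.mem_univ _))
      have := map_dvd (rename (Equiv.prodCongr (Equiv.refl (Fin m)) (Equiv.prodCongr π (Equiv.refl δ)))) (key π⁻¹)
      rwa [renren] at this
      ext x <;> simp
  obtain ⟨β, hβ⟩ : ∃ c, ∀ a : δ, IsWeightedHomogeneous (fun v : Fin m × δ × δ => if v.2.2 = a then 1 else 0) (ω I₀) c := by
    refine const_deg (fun π => Equiv.prodCongr (Equiv.refl (Fin m)) (Equiv.prodCongr (Equiv.refl δ) π))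
      (fun a v => if v.2.2 = a then 1 else 0) ?_ hω0 ?_ ?_
    · intro π a v; simp
    · intro a
      refine wh_of_mul _ (g := G) (by rwa [mul_comm]) (by rw [mul_comm]; exact hprod ▸ gMin_wh Y I₀ J₀ _ (fun _ => 0) (fun b => if b = a then 1 else 0)  (by simp))
    · intro π
      set α : MvPolynomial (Fin m × δ × δ) k →ₐ[k] _ := rename (Equiv.prodCongr (Equiv.refl (Fin m)) (Equiv.prodCongr (Equiv.refl δ) π)) with hα
      have hv : ∀ I, α (gMin Y I J₀) = gMin Y I (fun s => ((J₀ s).1, π (J₀ s).2)) := fun I => rename_gMin_col _ _ _ _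
      have h1 : ∀ I, ω I₀ ∣ α (ω I₀) * ω I := by
        intro I
        refine ⟨α (ω I), ?_⟩
        have e := gMin_identity Y h I I₀ J₀ (fun s => ((J₀ s).1, π (J₀ s).2))
        rw [← hv, ← hv, hω1 I (Finset.mem_univ _), hω1 I₀ (Finset.mem_univ _), map_mul, map_mul] at e
        have hα0 : α G ≠ 0 := fun h => hG (inj _ (by rw [map_zero]; exact h))
        refine mul_left_cancel₀ (mul_ne_zero hG hα0) ?_
        linear_combination e
      have h2 := Finset.dvd_gcd (s := Finset.univ) (fun I _ => h1 I)
      have h3 := (Finset.gcd_mul_left' (s := Finset.univ) (f := ω) (α (ω I₀)))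
      rw [hω2, mul_one] at h3
      exact h3.dvd_iff_dvd_right.1 h2
  obtain ⟨s, hs⟩ := MvPolynomial.ne_zero_iff.1 hG
  obtain ⟨t, ht⟩ := MvPolynomial.ne_zero_iff.1 hω0
  have hgh : IsWeightedHomogeneous (fun _ : Fin m × δ × δ => 1) (G * ω I₀) ρ := by
    have := gMin_wh Y I₀ J₀ (fun _ => 1) (fun _ => 1) (fun _ => 0) (by simp)
    simpa [hprod] using this
  obtain ⟨e1, he1⟩ := wh_of_mul _ hG0 hgh
  obtain ⟨e2, he2⟩ := wh_of_mul _ (f := ω I₀) (g := G) (by rwa [mul_comm]) (by rwa [mul_comm])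
  have hsum := (he1.mul he2).inj_right hG0 hgh
  have q1 : e1 = Fintype.card δ * c := by
    rw [← he1 hs]
    have : ∑ a : δ, Finsupp.weight (fun v : Fin m × δ × δ => if v.2.1 = a then 1 else 0) s = ∑ a : δ, c :=
      Finset.sum_congr rfl fun a _ => hc a hs
    simp only [Finset.sum_const, Finset.card_univ, smul_eq_mul] at this
    rw [← this]
    simp only [Finsupp.weight_apply, Finsupp.sum]
    rw [Finset.sum_comm]
    simp
  have q2 : e2 = Fintype.card δ * β := by
    rw [← he2 ht]
    have : ∑ a : δ, Finsupp.weight (fun v : Fin m × δ × δ => if v.2.2 = a then 1 else 0) t = ∑ a : δ, β :=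
      Finset.sum_congr rfl fun a _ => hβ a ht
    simp only [Finset.sum_const, Finset.card_univ, smul_eq_mul] at this
    rw [← this]
    simp only [Finsupp.weight_apply, Finsupp.sum]
    rw [Finset.sum_comm]
    simp
  exact ⟨c + β, by rw [← hsum, q1, q2]; ring⟩
end reg

section nc
variable {k : Type*} [Field k] {n m : ℕ}

theorem bl_rank_reindex {δ ε : Type*} [Fintype δ] [DecidableEq δ] [Fintype ε] [DecidableEq ε] (e : δ ≃ ε)
    (Y : Fin m → Matrix (Fin n) (Fin n) k) (T : Fin m → Matrix ε ε k) :
    (bl Y fun i => (T i).submatrix e e).rank = (bl Y T).rank := by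
  rw [← rank_submatrix (bl Y T) (Equiv.prodCongr (Equiv.refl _) e) (Equiv.prodCongr (Equiv.refl _) e)]
  congr 1

theorem bl_rank_le {δ : Type*} [Fintype δ] [DecidableEq δ] (Y : Fin m → Matrix (Fin n) (Fin n) k)
    (T : Fin m → Matrix δ δ k) : (bl Y T).rank ≤ n * Fintype.card δ := by
  refine (rank_le_card_width _).trans ?_
  simp

open Classical in
noncomputable def maxRk (Y : Fin m → Matrix (Fin n) (Fin n) k) (d : ℕ) : ℕ :=
  Nat.findGreatest (fun r => ∃ T : Fin m → Matrix (Fin d) (Fin d) k, (bl Y T).rank = r) (n * d)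

theorem le_maxRk (Y : Fin m → Matrix (Fin n) (Fin n) k) {δ : Type*} [Fintype δ] [DecidableEq δ]
    (T : Fin m → Matrix δ δ k) : (bl Y T).rank ≤ maxRk Y (Fintype.card δ) := by
  classical
  refine Nat.le_findGreatest (bl_rank_le Y T) ?_
  exact ⟨fun i => (T i).submatrix (Fintype.equivFin δ).symm (Fintype.equivFin δ).symm, bl_rank_reindex _ Y T⟩

theorem exists_maxRk (Y : Fin m → Matrix (Fin n) (Fin n) k) (d : ℕ) :
    ∃ T : Fin m → Matrix (Fin d) (Fin d) k, (bl Y T).rank = maxRk Y d := by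
  classical
  have := Nat.findGreatest_spec (P := fun r => ∃ T : Fin m → Matrix (Fin d) (Fin d) k, (bl Y T).rank = r)
    (n := n * d) (m := (bl Y (0 : Fin m → Matrix (Fin d) (Fin d) k)).rank)
    (by simpa using bl_rank_le Y (0 : Fin m → Matrix (Fin d) (Fin d) k)) ⟨_, rfl⟩
  exact this

theorem maxRk_le (Y : Fin m → Matrix (Fin n) (Fin n) k) (d : ℕ) : maxRk Y d ≤ n * d := by
  obtain ⟨T, hT⟩ := exists_maxRk Y d
  rw [← hT]
  simpa using bl_rank_le Y T

theorem dvd_maxRk [Infinite k] (Y : Fin m → Matrix (Fin n) (Fin n) k) (d : ℕ) : d ∣ maxRk Y d := by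
  have := regularity (δ := Fin d) Y (maxRk Y d) (fun T => by simpa using le_maxRk Y T) (exists_maxRk Y d)
  simpa using this

theorem full_down [Infinite k] (Y : Fin m → Matrix (Fin n) (Fin n) k) (d : ℕ) (hd : n ≤ d)
    (hf : maxRk Y (d + 1) = n * (d + 1)) : maxRk Y d = n * d := by
  classical
  by_contra hne
  have hlt : maxRk Y d < n * d := lt_of_le_of_ne (maxRk_le Y d) hne
  have hlt2 : maxRk Y d + d ≤ n * d := by
    obtain ⟨q, hq⟩ := dvd_maxRk Y d
    rw [hq] at hlt ⊢
    have : q < n := by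
      rw [mul_comm] at hlt
      exact lt_of_mul_lt_mul_right hlt (Nat.zero_le _)
    nlinarith
  have hn : 0 < n := Nat.pos_of_ne_zero (by rintro rfl; simp at hlt)
  obtain ⟨T, hT⟩ := exists_maxRk Y (d + 1)
  rw [hf] at hT
  have hli : LinearIndependent k (bl Y T).row := by
    rw [linearIndependent_iff_card_eq_finrank_span, Fintype.card_prod, Fintype.card_fin, Fintype.card_fin,
     Set.finrank, ← rank_eq_finrank_span_row, hT]
  set N := (bl Y T).submatrix (fun p : Fin n × Fin d => (p.1, p.2.castSucc)) id with hN
  have hNr : N.rank = n * d := by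
    have : LinearIndependent k N.row := hli.comp (fun p : Fin n × Fin d => (p.1, p.2.castSucc)) (by
      rintro ⟨a, b⟩ ⟨a', b'⟩ h; simpa using h)
    rw [this.rank_matrix]; simp
  have hJ0 := exists_indep_cols N
  rw [hNr] at hJ0
  obtain ⟨J, hJ, -⟩ := hJ0
  obtain ⟨j, hj⟩ : ∃ j : Fin (d + 1), (Finset.univ.filter fun s => (J s).2 = j).card < n := by
    by_contra hcon
    push Not at hcon
    have h1 : ∑ j : Fin (d + 1), (Finset.univ.filter fun s => (J s).2 = j).card = n * d := by
      rw [← Finset.card_eq_sum_card_fiberwise (f := fun s => (J s).2) (t := Finset.univ) (by simp)]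
      simp
    have h2 : ∑ j : Fin (d + 1), n ≤ n * d := h1 ▸ Finset.sum_le_sum fun j _ => hcon j
    simp at h2
    nlinarith
  have hcard : n * d - d < Fintype.card {s // (J s).2 ≠ j} := by
    rw [Fintype.card_subtype_compl, Fintype.card_fin, Fintype.card_subtype]
    have := Nat.le_mul_of_pos_left d hn
    omega
  let T' : Fin m → Matrix (Fin d) (Fin d) k := fun i => (T i).submatrix Fin.castSucc j.succAbove
  have hsub : ∀ s : {s // (J s).2 ≠ j}, ∃ b : Fin d, j.succAbove b = (J s).2 := fun s =>
    Fin.exists_succAbove_eq s.2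
  choose b hb using hsub
  have hli2 : LinearIndependent k (fun s : {s // (J s).2 ≠ j} => (bl Y T').col ((J s).1, b s)) := by
    have := hJ.comp (Subtype.val : {s // (J s).2 ≠ j} → _) Subtype.val_injective
    convert this using 1
    funext s
    ext ⟨r, a⟩
    simp [N, bl, T', hb, Function.comp_def]
  have hle : Fintype.card {s // (J s).2 ≠ j} ≤ (bl Y T').rank := by
    rw [rank_eq_finrank_span_cols]
    have h3 := finrank_span_eq_card hli2
    rw [← h3]
    apply Submodule.finrank_mono
    apply Submodule.span_mono
    rintro _ ⟨s, rfl⟩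
    exact ⟨_, rfl⟩
  have h4 := le_maxRk Y T'
  rw [Fintype.card_fin] at h4
  omega

theorem full_iff {δ : Type*} [Fintype δ] [DecidableEq δ] (Y : Fin m → Matrix (Fin n) (Fin n) k)
    (T : Fin m → Matrix δ δ k) : (bl Y T).rank = n * Fintype.card δ ↔ (bl Y T).det ≠ 0 := by
  constructor
  · intro h
    have : LinearIndependent k (bl Y T).row := by
      rw [linearIndependent_iff_card_eq_finrank_span, Fintype.card_prod, Fintype.card_fin,
       Set.finrank, ← rank_eq_finrank_span_row, h]
    have := (Matrix.linearIndependent_rows_iff_isUnit).1 this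
    exact ((Matrix.isUnit_iff_isUnit_det _).1 this).ne_zero
  · intro h
    rw [rank_of_det_ne_zero h]; simp

theorem full_mul (Y : Fin m → Matrix (Fin n) (Fin n) k) (d N : ℕ) (h : maxRk Y d = n * d) :
    maxRk Y (d * N) = n * (d * N) := by
  obtain ⟨T, hT⟩ := exists_maxRk Y d
  have h1 : (bl Y T).det ≠ 0 := (full_iff Y T).1 (by rw [hT, h]; simp)
  let T' : Fin m → Matrix (Fin d × Fin N) (Fin d × Fin N) k := fun i => kronecker (T i) 1
  have h2 : (bl Y T').det ≠ 0 := by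
    have : bl Y T' = (kronecker (bl Y T) (1 : Matrix (Fin N) (Fin N) k)).submatrix
        (Equiv.prodAssoc _ _ _).symm (Equiv.prodAssoc _ _ _).symm := by
      ext ⟨r, a, x⟩ ⟨c, b, y⟩
      simp [bl, T', Finset.sum_mul, mul_assoc]
    rw [this, det_submatrix_equiv_self, kronecker, det_kronecker]
    simp [h1]
  have h3 := (full_iff Y T').2 h2
  have h4 := le_maxRk Y T'
  have h5 := maxRk_le Y (d * N)
  simp at h3 h4
  omega

theorem not_full [Infinite k] (Y : Fin m → Matrix (Fin n) (Fin n) k)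
    (h : ∀ T : Fin m → Matrix (Fin n) (Fin n) k, (bl Y T).det = 0) (d : ℕ) (hd : 0 < d) :
    maxRk Y d < n * d := by
  refine lt_of_le_of_ne (maxRk_le Y d) fun hfull => ?_
  have hn : maxRk Y n ≠ n * n := by
    intro h0
    obtain ⟨T, hT⟩ := exists_maxRk Y n
    exact (full_iff Y T).1 (by rw [hT, h0]; simp) (h T)
  have h1 := full_mul Y d n hfull
  have h2 : n ≤ d * n := Nat.le_mul_of_pos_left n hd
  have h3 : ∀ e, maxRk Y (n + e) = n * (n + e) → maxRk Y n = n * n := by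
    intro e
    induction e with
    | zero => exact id
    | succ e ih => intro h; exact ih (full_down Y (n + e) (by omega) h)
  exact hn (h3 (d * n - n) (by rw [Nat.add_sub_cancel' h2]; exact h1))

end nc

section wong
variable {k : Type*} [Field k] {V : Type*} [AddCommGroup V] [Module k V]

def wWord (a g : V →ₗ[k] V) (Bs : Set (V →ₗ[k] V)) (r : ℕ) : Set V :=
  {w | ∃ (b : ℕ → (V →ₗ[k] V)) (u : ℕ → V), (∀ j, b j ∈ Bs) ∧ a (u r) = 0 ∧
    (∀ j < r, u j = g (b j (u (j + 1)))) ∧ u 0 = w}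

theorem wong_abs (a : V →ₗ[k] V) (Bs : Set (V →ₗ[k] V)) (hne : Bs.Nonempty)
    (hchain : ∀ (l : ℕ) (b : ℕ → (V →ₗ[k] V)), (∀ j, b j ∈ Bs) → ∀ z, a z = 0 →
      ∃ x : ℕ → V, x l = z ∧ ∀ j < l, a (x j) = b j (x (j + 1))) :
    ∃ U : Submodule k V, LinearMap.ker a ≤ U ∧ ∀ b ∈ Bs, ∀ u ∈ U, b u ∈ U.map a := by
  obtain ⟨g, hg⟩ : ∃ g : V →ₗ[k] V, ∀ y, a (g (a y)) = a y := by
    obtain ⟨h, hh⟩ := LinearMap.exists_rightInverse_of_surjective a.rangeRestrict a.range_rangeRestrict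
    obtain ⟨g, hg⟩ := LinearMap.exists_extend h
    refine ⟨g, fun y => ?_⟩
    have h1 : g (a y) = h (a.rangeRestrict y) := by rw [← hg]; rfl
    rw [h1]
    have := congrArg (fun f => ((f (a.rangeRestrict y) : LinearMap.range a) : V)) hh
    simpa using this
  have hW0 : ∀ z, a z = 0 → z ∈ wWord a g Bs 0 := by
    intro z hz
    obtain ⟨b, hb⟩ := hne
    exact ⟨fun _ => b, fun _ => z, fun _ => hb, hz, fun j hj => absurd hj (Nat.not_lt_zero j), rfl⟩
  have hWs : ∀ r, ∀ w ∈ wWord a g Bs r, ∀ b ∈ Bs, g (b w) ∈ wWord a g Bs (r + 1) := by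
    rintro r _ ⟨b', u, h1, h2, h3, rfl⟩ b hb
    refine ⟨fun j => Nat.casesOn j b b', fun j => Nat.casesOn j (g (b (u 0))) u, ?_, h2, ?_, rfl⟩
    · rintro (_ | j)
      · exact hb
      · exact h1 j
    · rintro (_ | j) hj
      · rfl
      · exact h3 j (by omega)
  let Us : ℕ → Submodule k V := fun t => Submodule.span k {w | ∃ j < t, w ∈ wWord a g Bs j}
  have hUg : ∀ t, ∀ u ∈ Us t, ∀ b ∈ Bs, g (b u) ∈ Us (t + 1) := by
    intro t u hu b hb
    have : Us t ≤ (Us (t + 1)).comap (g ∘ₗ b) := by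
      refine Submodule.span_le.2 ?_
      rintro w ⟨j, hj, hw⟩
      exact Submodule.subset_span ⟨j + 1, by omega, hWs j w hw b hb⟩
    exact this hu
  have hU0 : ∀ t, ∀ z, a z = 0 → z ∈ Us (t + 1) := fun t z hz =>
    Submodule.subset_span ⟨0, by omega, hW0 z hz⟩
  have P : ∀ r, ∀ w ∈ wWord a g Bs r, ∀ b ∈ Bs, b w ∈ LinearMap.range a := by
    intro r
    induction r using Nat.strong_induction_on with
    | _ r ih =>
      rintro w ⟨b', u, h1, h2, h3, rfl⟩ b hb
      obtain ⟨x, hx1, hx2⟩ := hchain (r + 1) (fun j => Nat.casesOn j b b')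
        (by rintro (_ | j); exacts [hb, h1 j]) (u r) h2
      have claim : ∀ t ≤ r, x (r - t + 1) - u (r - t) ∈ Us t := by
        intro t
        induction t with
        | zero => intro _; simp [hx1]
        | succ t iht =>
          intro ht
          obtain ⟨i, rfl⟩ : ∃ i, r = i + t + 1 := ⟨r - t - 1, by omega⟩
          have e1 : i + t + 1 - t = i + 1 := by omega
          have e2 : i + t + 1 - (t + 1) = i := by omega
          have h4 := iht (by omega)
          rw [e1] at h4
          rw [e2]
          have h5 : a (x (i + 1)) = b' i (x (i + 2)) := hx2 (i + 1) (by omega)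
          have h6 := h3 i (by omega)
          have h7 : x (i + 1) - g (b' i (x (i + 2))) ∈ Us (t + 1) := by
            apply hU0
            rw [← h5, map_sub, hg, sub_self]
          have h8 := hUg t _ h4 (b' i) (h1 i)
          rw [h6]
          have := (Us (t + 1)).add_mem h7 h8
          convert this using 1
          simp only [map_sub]; abel
      have hc := claim r le_rfl
      simp only [Nat.sub_self, zero_add] at hc
      have h9 : a (x 0) = b (x 1) := hx2 0 (by omega)
      have h10 : b (x 1 - u 0) ∈ LinearMap.range a := by
        have : Us r ≤ (LinearMap.range a).comap b := by
          refine Submodule.span_le.2 ?_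
          rintro w ⟨j, hj, hw⟩
          exact ih j hj w hw b hb
        exact this hc
      have : b (u 0) = a (x 0) - b (x 1 - u 0) := by rw [h9, map_sub]; abel
      rw [this]
      exact Submodule.sub_mem _ ⟨_, rfl⟩ h10
  refine ⟨Submodule.span k {w | ∃ j, w ∈ wWord a g Bs j}, ?_, ?_⟩
  · intro z hz
    exact Submodule.subset_span ⟨0, hW0 z hz⟩
  · intro b hb u hu
    have : Submodule.span k {w | ∃ j, w ∈ wWord a g Bs j} ≤
        (Submodule.map a (Submodule.span k {w | ∃ j, w ∈ wWord a g Bs j})).comap b := by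
      refine Submodule.span_le.2 ?_
      rintro w ⟨j, hw⟩
      obtain ⟨y, hy⟩ := P j w hw b hb
      refine ⟨g (b w), Submodule.subset_span ⟨j + 1, hWs j w hw b hb⟩, ?_⟩
      rw [← hy, hg]
    exact this hu

theorem chain_abs [FiniteDimensional k V] (a : V →ₗ[k] V) (b : ℕ → (V →ₗ[k] V)) (l : ℕ)
    (N : (Fin (l + 1) → V) →ₗ[k] (Fin (l + 1) → V))
    (hN1 : ∀ v (j : ℕ) (hj : j < l), N v ⟨j, by omega⟩ = a (v ⟨j, by omega⟩) - b j (v ⟨j + 1, by omega⟩))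
    (hN2 : ∀ v, N v (Fin.last l) = a (v (Fin.last l)))
    (hdim : (l + 1) * Module.finrank k (LinearMap.ker a) ≤ Module.finrank k (LinearMap.ker N))
    (z : V) (hz : a z = 0) : ∃ x : ℕ → V, x l = z ∧ ∀ j < l, a (x j) = b j (x (j + 1)) := by
  let F : ℕ → Submodule k (Fin (l + 1) → V) := fun j =>
    LinearMap.ker N ⊓ ⨅ i : {i : Fin (l + 1) // j ≤ i.val}, LinearMap.ker (LinearMap.proj (R := k) (φ := fun _ => V) i.1)
  have hF : ∀ j v, v ∈ F j ↔ N v = 0 ∧ ∀ i : Fin (l + 1), j ≤ i.val → v i = 0 := by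
    intro j v
    simp [F]
  let G : ∀ j, j < l + 1 → (F (j + 1) →ₗ[k] V) := fun j hj =>
    (LinearMap.proj (R := k) (φ := fun _ => V) (⟨j, hj⟩ : Fin (l + 1))).domRestrict (F (j + 1))
  have hG1 : ∀ j hj, LinearMap.range (G j hj) ≤ LinearMap.ker a := by
    rintro j hj _ ⟨⟨v, hv⟩, rfl⟩
    rw [hF] at hv
    show a (v ⟨j, hj⟩) = 0
    rcases Nat.lt_succ_iff_lt_or_eq.1 hj with h | h
    · have h1 := hN1 v j h
      rw [hv.1, hv.2 ⟨j + 1, by omega⟩ le_rfl] at h1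
      simpa using h1.symm
    · subst h
      have := hN2 v
      rw [hv.1] at this
      exact this.symm
  have hG2 : ∀ j hj, Module.finrank k (LinearMap.ker (G j hj)) ≤ Module.finrank k (F j) := by
    intro j hj
    rw [← Submodule.finrank_map_subtype_eq]
    apply Submodule.finrank_mono
    rintro _ ⟨⟨v, hv⟩, hv2, rfl⟩
    rw [hF] at hv
    have hv3 : v ⟨j, hj⟩ = 0 := hv2
    show v ∈ F j
    rw [hF]
    refine ⟨hv.1, fun i hi => ?_⟩
    rcases hi.lt_or_eq with h | h
    · exact hv.2 i h
    · have : i = ⟨j, hj⟩ := Fin.ext h.symm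
      rw [this]; exact hv3
  have hdimF : ∀ j, j ≤ l + 1 → Module.finrank k (F j) ≤ j * Module.finrank k (LinearMap.ker a) := by
    intro j
    induction j with
    | zero =>
      intro _
      have : F 0 = ⊥ := by
        rw [eq_bot_iff]
        intro v hv
        rw [hF] at hv
        exact funext fun i => hv.2 i (Nat.zero_le _)
      rw [this]; simp
    | succ j ih =>
      intro hj
      have h1 := LinearMap.finrank_range_add_finrank_ker (G j hj)
      have h2 := hG2 j hj
      have h3 := Submodule.finrank_mono (hG1 j hj)
      have h4 := ih (by omega)
      rw [add_mul, one_mul]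
      omega
  have hlast : F (l + 1) = LinearMap.ker N := by
    ext v
    rw [hF]
    simp only [LinearMap.mem_ker, and_iff_left_iff_imp]
    intro _ i hi
    omega
  have hsurj : LinearMap.range (G l (by omega)) = LinearMap.ker a := by
    refine Submodule.eq_of_le_of_finrank_le (hG1 _ _) ?_
    have h1 := LinearMap.finrank_range_add_finrank_ker (G l (by omega))
    have h2 := hG2 l (by omega)
    have h4 := hdimF l (by omega)
    have h5 : Module.finrank k (F (l + 1)) = Module.finrank k (LinearMap.ker N) := by rw [hlast]
    rw [add_mul, one_mul] at hdim
    omega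
  have hz' : z ∈ LinearMap.range (G l (by omega)) := by rw [hsurj]; exact hz
  obtain ⟨⟨v, hv⟩, hvz⟩ := hz'
  rw [hF] at hv
  refine ⟨fun j => if h : j < l + 1 then v ⟨j, h⟩ else 0, ?_, ?_⟩
  · simp; exact hvz
  · intro j hj
    have h1 := hN1 v j hj
    rw [hv.1] at h1
    dsimp only
    rw [dif_pos (by omega), dif_pos (by omega)]
    exact sub_eq_zero.1 h1.symm

end wong

section nc2
variable {k : Type*} [Field k] {n m : ℕ}

theorem adapted (U : Submodule k (Fin n → k)) : ∃ P P' : Matrix (Fin n) (Fin n) k, P * P' = 1 ∧ P' * P = 1 ∧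
    (∀ c : Fin n, c.val < Module.finrank k U → P.col c ∈ U) ∧
    (∀ u ∈ U, ∀ r : Fin n, Module.finrank k U ≤ r.val → (P' *ᵥ u) r = 0) := by
  obtain ⟨U', hU'⟩ := Submodule.exists_isCompl U
  have hc : Module.finrank k U + Module.finrank k U' = n := by
    rw [Submodule.finrank_add_eq_of_isCompl hU']; simp
  let B0 := ((Module.finBasis k U).prod (Module.finBasis k U')).map (Submodule.prodEquivOfIsCompl U U' hU')
  let B := B0.reindex (finSumFinEquiv.trans (finCongr hc))
  have hB1 : ∀ i : Fin (Module.finrank k U), B (finCongr hc (Fin.castAdd _ i)) = (Module.finBasis k U i : Fin n → k) := by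
    intro i
    simp [B, B0]
  have hmem : ∀ c : Fin n, c.val < Module.finrank k U → B c ∈ U := by
    intro c h
    have : c = finCongr hc (Fin.castAdd _ ⟨c.val, h⟩) := Fin.ext rfl
    rw [this, hB1]
    exact Subtype.property _
  refine ⟨(Pi.basisFun k (Fin n)).toMatrix B, B.toMatrix (Pi.basisFun k (Fin n)), ?_, ?_, ?_, ?_⟩
  · exact Module.Basis.toMatrix_mul_toMatrix_flip _ _
  · exact Module.Basis.toMatrix_mul_toMatrix_flip _ _
  · intro c h
    convert hmem c h using 1
    funext r
    simp [Module.Basis.toMatrix_apply]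
  · intro u hu r hr
    have h1 : B.toMatrix (Pi.basisFun k (Fin n)) *ᵥ u = B.repr u :=
      Module.Basis.toMatrix_mulVec_repr (Pi.basisFun k (Fin n)) B u
    rw [h1]
    have h2 : U ≤ LinearMap.ker (B.coord r) := by
      have : U = Submodule.span k (Set.range fun i : Fin (Module.finrank k U) => (Module.finBasis k U i : Fin n → k)) := by
        have h3 := congrArg (Submodule.map U.subtype) (Module.finBasis k U).span_eq
        rw [Submodule.map_span, Submodule.map_top, Submodule.range_subtype, ← Set.range_comp] at h3
        exact h3.symm
      rw [this, Submodule.span_le]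
      rintro _ ⟨i, rfl⟩
      have : (finCongr hc (Fin.castAdd _ i)) ≠ r := by
        intro h
        have := congrArg Fin.val h
        simp at this
        omega
      simp only [← hB1]
      show B.repr _ r = 0
      rw [Module.Basis.repr_self, Finsupp.single_eq_of_ne this.symm]
    exact h2 hu

def blkE (k : Type*) [Field k] (n l d : ℕ) :
    (Fin (l + 1) → (Fin n × Fin d → k)) ≃ₗ[k] (Fin n × Fin (l + 1) × Fin d → k) where
  toFun v := fun p => v p.2.1 (p.1, p.2.2)
  invFun w := fun j q => w (q.1, j, q.2)
  map_add' _ _ := rfl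
  map_smul' _ _ := rfl
  left_inv _ := rfl
  right_inv _ := rfl

def blkT {d : ℕ} (l : ℕ) (T : Fin m → Matrix (Fin d) (Fin d) k) (S : ℕ → Fin m → Matrix (Fin d) (Fin d) k) :
    Fin m → Matrix (Fin (l + 1) × Fin d) (Fin (l + 1) × Fin d) k := fun i => Matrix.of fun p q =>
  (if q.1 = p.1 then T i p.2 q.2 else 0) - (if q.1.val = p.1.val + 1 then S p.1.val i p.2 q.2 else 0)

theorem blk_apply {d : ℕ} (l : ℕ) (Y : Fin m → Matrix (Fin n) (Fin n) k) 
    (T : Fin m → Matrix (Fin d) (Fin d) k) (S : ℕ → Fin m → Matrix (Fin d) (Fin d) k)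
    (v : Fin (l + 1) → (Fin n × Fin d → k)) (j : Fin (l + 1)) (r : Fin n) (x : Fin d) :
    ((bl Y (blkT l T S)) *ᵥ (blkE k n l d v)) (r, j, x) =
      (bl Y T *ᵥ v j) (r, x) - ∑ j' : Fin (l + 1), if j'.val = j.val + 1 then (bl Y (S j) *ᵥ v j') (r, x) else 0 := by
  have h1 : ∀ r' j' y, bl Y (blkT l T S) (r, j, x) (r', j', y) = 
     (if j' = j then bl Y T (r, x) (r', y) else 0) - 
       (if j'.val = j.val + 1 then bl Y (S j) (r, x) (r', y) else 0) := by
    intro r' j' y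
    simp only [bl, blkT, Matrix.of_apply, mul_sub, Finset.sum_sub_distrib]
    congr 1 <;> split_ifs <;> simp
  simp only [Matrix.mulVec, dotProduct, Fintype.sum_prod_type, h1, sub_mul, Finset.sum_sub_distrib, ite_mul, zero_mul]
  congr 1
  · refine Finset.sum_congr rfl fun r' _ => ?_
    rw [Finset.sum_comm]
    refine Finset.sum_congr rfl fun y _ => ?_
    simp [blkE]
  · rw [Finset.sum_comm]
    refine Finset.sum_congr rfl fun j' _ => ?_
    split_ifs
    · rfl
    · simp

theorem NC_sub [Infinite k] (Y : Fin m → Matrix (Fin n) (Fin n) k)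
    (h : ∀ T : Fin m → Matrix (Fin n) (Fin n) k, (bl Y T).det = 0) :
    ∃ U W : Submodule k (Fin n → k), Module.finrank k W < Module.finrank k U ∧ ∀ i, ∀ u ∈ U, Y i *ᵥ u ∈ W := by
  classical
  obtain ⟨d, hd, hmax⟩ : ∃ d : ℕ, 0 < d ∧ ∀ d', 0 < d' → maxRk Y d' / d' ≤ maxRk Y d / d := by
    have hex : ∃ v, ∃ d : ℕ, 0 < d ∧ n - maxRk Y d / d = v := ⟨_, 1, one_pos, rfl⟩
    obtain ⟨d, hd, hv⟩ := Nat.find_spec hex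
    refine ⟨d, hd, fun d' hd' => ?_⟩
    have h1 := Nat.find_min' hex ⟨d', hd', rfl⟩
    have h2 : maxRk Y d' / d' ≤ n := Nat.div_le_of_le_mul (by rw [mul_comm]; exact maxRk_le Y d')
    have h3 : maxRk Y d / d ≤ n := Nat.div_le_of_le_mul (by rw [mul_comm]; exact maxRk_le Y d)
    omega
  obtain ⟨c, hc⟩ := dvd_maxRk Y d
  have hcd : maxRk Y d / d = c := by rw [hc]; exact Nat.mul_div_cancel_left c hd
  rw [hcd] at hmax
  have hcn : c < n := by
    have := not_full Y h d hd
    rw [hc, mul_comm] at this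
    exact lt_of_mul_lt_mul_right this (Nat.zero_le _)
  have hle : ∀ d', 0 < d' → maxRk Y d' ≤ c * d' := by
    intro d' hd'
    obtain ⟨q, hq⟩ := dvd_maxRk Y d'
    have := hmax d' hd'
    rw [hq, Nat.mul_div_cancel_left _ hd'] at this
    rw [hq, mul_comm]
    exact Nat.mul_le_mul_right _ this
  obtain ⟨T, hT⟩ := exists_maxRk Y d
  rw [hc] at hT
  let a := (bl Y T).mulVecLin
  let Bs : Set ((Fin n × Fin d → k) →ₗ[k] (Fin n × Fin d → k)) :=
    Set.range fun S : Fin m → Matrix (Fin d) (Fin d) k => (bl Y S).mulVecLin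
  have hka : Module.finrank k (LinearMap.ker a) + c * d = n * d := by
    have := LinearMap.finrank_range_add_finrank_ker a
    have h2 : Module.finrank k (LinearMap.range a) = d * c := hT
    rw [h2] at this
    simp at this
    linarith
  obtain ⟨Us, hU1, hU2⟩ := wong_abs a Bs ⟨_, ⟨0, rfl⟩⟩ (by
    intro l b hb z hz
    choose S hS using hb
    refine chain_abs a b l ((blkE k n l d).symm.toLinearMap ∘ₗ (bl Y (blkT l T S)).mulVecLin ∘ₗ (blkE k n l d).toLinearMap)
      ?_ ?_ ?_ z hz
    · intro v j hj
      funext ⟨r, x⟩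
      have := blk_apply l Y T S v ⟨j, by omega⟩ r x
      refine Eq.trans this ?_
      rw [← hS j]
      simp only [Pi.sub_apply]
      congr 1
      rw [Finset.sum_eq_single ⟨j + 1, by omega⟩]
      · simp
      · intro j' _ hj'
        rw [if_neg]
        intro h
        exact hj' (Fin.ext h)
      · simp
    · intro v
      funext ⟨r, x⟩
      have := blk_apply l Y T S v (Fin.last l) r x
      refine Eq.trans this ?_
      rw [Finset.sum_eq_zero, sub_zero]
      · rfl
      · intro j' _
        rw [if_neg]
        have := j'.isLt
        simp; omega
    · have h1 : Module.finrank k (LinearMap.range (bl Y (blkT l T S)).mulVecLin) ≤ c * ((l + 1) * d) := by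
        refine (le_maxRk Y (blkT l T S)).trans ?_
        simp only [Fintype.card_prod, Fintype.card_fin]
        exact hle _ (by positivity)
      have h2 := LinearMap.finrank_range_add_finrank_ker ((blkE k n l d).symm.toLinearMap ∘ₗ (bl Y (blkT l T S)).mulVecLin ∘ₗ (blkE k n l d).toLinearMap)
      have h3 : Module.finrank k (LinearMap.range ((blkE k n l d).symm.toLinearMap ∘ₗ (bl Y (blkT l T S)).mulVecLin ∘ₗ (blkE k n l d).toLinearMap)) ≤ c * ((l + 1) * d) := by
        refine le_trans ?_ h1
        rw [LinearMap.range_comp, LinearEquiv.finrank_map_eq]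
        exact Submodule.finrank_mono (LinearMap.range_comp_le_range _ _)
      have h4 : Module.finrank k (Fin (l + 1) → (Fin n × Fin d → k)) = (l + 1) * (n * d) := by
        rw [Module.finrank_pi_fintype]; simp
      rw [h4] at h2
      have h5 : (l + 1) * (Module.finrank k (LinearMap.ker a) + c * d) = (l + 1) * (n * d) := by rw [hka]
      nlinarith)
  have hdimZ : Module.finrank k (Us.map a) + Module.finrank k (LinearMap.ker a) ≤ Module.finrank k Us := by
    have := LinearMap.finrank_range_add_finrank_ker (a.domRestrict Us)
    rw [LinearMap.range_domRestrict] at this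
    rw [← this]
    gcongr
    rw [← Submodule.finrank_map_subtype_eq Us (LinearMap.ker (a.domRestrict Us))]
    apply Submodule.finrank_mono
    intro z hz
    exact ⟨⟨z, hU1 hz⟩, hz, rfl⟩
  have hkpos : 0 < Module.finrank k (LinearMap.ker a) := by
    have : c * d < n * d := Nat.mul_lt_mul_of_pos_right hcn hd
    omega
  let U : Submodule k (Fin n → k) := Submodule.span k {w | ∃ u ∈ Us, ∃ x : Fin d, w = fun r => u (r, x)}
  let W : Submodule k (Fin n → k) := Submodule.span k {w | ∃ i, ∃ u ∈ Us, ∃ x : Fin d, w = Y i *ᵥ fun r => u (r, x)}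
  refine ⟨U, W, ?_, ?_⟩
  · have hUU : Module.finrank k Us ≤ d * Module.finrank k U := by
      let f : Us →ₗ[k] (Fin d → U) := LinearMap.pi fun x =>
        { toFun := fun u => ⟨fun r => u.1 (r, x), Submodule.subset_span ⟨u.1, u.2, x, rfl⟩⟩
          map_add' := fun _ _ => rfl
          map_smul' := fun _ _ => rfl }
      have hf : Function.Injective f := by
        intro u v huv
        ext ⟨r, x⟩
        exact congrFun (congrArg Subtype.val (congrFun huv x)) r
      have := LinearMap.finrank_le_finrank_of_injective hf
      rw [Module.finrank_pi_fintype] at this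
      simpa using this
    have hWW : d * Module.finrank k W ≤ Module.finrank k (Us.map a) := by
      let Ψ : Fin d → (Fin n → k) →ₗ[k] (Fin n × Fin d → k) := fun x =>
        { toFun := fun w p => if p.2 = x then w p.1 else 0
          map_add' := fun u v => by funext p; simp; split_ifs <;> simp
          map_smul' := fun u v => by funext p; simp }
      have hΨ : ∀ x, W ≤ (Us.map a).comap (Ψ x) := by
        intro x
        refine Submodule.span_le.2 ?_
        rintro _ ⟨i, u, hu, x', rfl⟩
        let S : Fin m → Matrix (Fin d) (Fin d) k := Pi.single i (Matrix.single x x' 1)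
        have := hU2 _ ⟨S, rfl⟩ u hu
        show Ψ x _ ∈ Us.map a
        convert this using 1
        funext ⟨r, z⟩
        have e : ∀ r' z', bl Y S (r, z) (r', z') = if z = x ∧ z' = x' then Y i r r' else 0 := by
          intro r' z'
          simp only [bl, Matrix.of_apply, S]
          rw [Finset.sum_eq_single i]
          · simp [Matrix.single_apply, eq_comm]
          · intro j _ hj
            simp [Pi.single_eq_of_ne hj]
          · simp
        simp only [Matrix.mulVecLin_apply, Matrix.mulVec, dotProduct, Fintype.sum_prod_type, e]
        show (if z = x then _ else 0) = _
        by_cases hz : z = x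
        · simp [hz, Matrix.mulVec, dotProduct]
        · simp [hz]
      let f : (Fin d → W) →ₗ[k] (Us.map a) := 
        LinearMap.codRestrict _ (∑ x, (Ψ x) ∘ₗ W.subtype ∘ₗ LinearMap.proj x) (by
          intro w
          rw [LinearMap.sum_apply]
          exact Submodule.sum_mem _ fun x _ => hΨ x (w x).2)
      have hf : Function.Injective f := by
        intro u v huv
        have h1 : ∀ (w : Fin d → W) r x, (f w).1 (r, x) = (w x).1 r := by
          intro w r x
          show (∑ x, (Ψ x) ∘ₗ W.subtype ∘ₗ LinearMap.proj x : (Fin d → W) →ₗ[k] _) w (r, x) = _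
          rw [LinearMap.sum_apply, Finset.sum_apply]
          simp [Ψ]
        funext x
        ext r
        rw [← h1, ← h1, huv]
      have := LinearMap.finrank_le_finrank_of_injective hf
      rw [Module.finrank_pi_fintype] at this
      simpa using this
    have : d * Module.finrank k W < d * Module.finrank k U := by omega
    exact lt_of_mul_lt_mul_left this (Nat.zero_le _)
  · intro i u hu
    have : U ≤ W.comap (Y i).mulVecLin := by
      refine Submodule.span_le.2 ?_
      rintro _ ⟨u, hu, x, rfl⟩
      exact Submodule.subset_span ⟨i, u, hu, x, rfl⟩
    exact this hu

theorem NC [Infinite k] (Y : Fin m → Matrix (Fin n) (Fin n) k)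
    (h : ∀ T : Fin m → Matrix (Fin n) (Fin n) k, (bl Y T).det = 0) :
    ∃ (P Q : Matrix (Fin n) (Fin n) k) (a b : ℕ), P.det ≠ 0 ∧ Q.det ≠ 0 ∧ b < a ∧ a ≤ n ∧
      ∀ i r c, b ≤ r.val → c.val < a → (Q * Y i * P) r c = 0 := by
  obtain ⟨U, W, hlt, hUW⟩ := NC_sub Y h
  obtain ⟨P, P', h1, h2, h3, h4⟩ := adapted U
  obtain ⟨R, Q, g1, g2, g3, g4⟩ := adapted W
  have hdet : ∀ A B : Matrix (Fin n) (Fin n) k, A * B = 1 → A.det ≠ 0 := by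
    intro A B hAB h0
    have := congrArg Matrix.det hAB
    rw [Matrix.det_mul, h0] at this
    simp at this
  refine ⟨P, Q, Module.finrank k U, Module.finrank k W, hdet _ _ h1, hdet _ _ g2, hlt, ?_, ?_⟩
  · simpa using Submodule.finrank_le U
  · intro i r c hr hc
    have := g4 _ (hUW i _ (h3 c hc)) r hr
    rw [Matrix.mulVec_mulVec] at this
    exact this

end nc2

theorem hom_aeval_smul {k A σ : Type*} [CommRing k] [CommRing A] [Algebra k A] {f : MvPolynomial σ k} {e : ℕ}
    (hf : f.IsHomogeneous e) (c : A) (x : σ → A) : aeval (fun p => c * x p) f = c ^ e * aeval x f := by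
  rw [aeval_def, aeval_def, eval₂_eq, eval₂_eq, Finset.mul_sum]
  refine Finset.sum_congr rfl fun d hd => ?_
  have h1 := hf (mem_support_iff.1 hd)
  rw [Finsupp.weight_apply, Finsupp.sum] at h1
  simp only [smul_eq_mul, Pi.one_apply, mul_one] at h1
  simp only [mul_pow, Finset.prod_mul_distrib, Finset.prod_pow_eq_pow_sum, h1]
  ring

section glsc
variable {k : Type*} [CommRing k] {n m : ℕ} {f : MvPolynomial (Idx n m) k} {e : ℕ}

theorem gl_scale_ac (hf : SInv f) (he : f.IsHomogeneous e) (hn : 0 < n) {L : Type*} [Field L] [IsAlgClosed L] [Algebra k L]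
    (A B : Matrix (Fin n) (Fin n) L) (hA : A.det ≠ 0) (hB : B.det ≠ 0) (X : Fin m → Matrix (Fin n) (Fin n) L) :
    aeval (coo fun i => A * X i * B) f ^ n = (A.det * B.det) ^ e * aeval (coo X) f ^ n := by
  obtain ⟨α, hα⟩ := IsAlgClosed.exists_pow_nat_eq A.det hn
  obtain ⟨β, hβ⟩ := IsAlgClosed.exists_pow_nat_eq B.det hn
  have hα0 : α ≠ 0 := by rintro rfl; rw [zero_pow hn.ne'] at hα; exact hA hα.symm
  have hβ0 : β ≠ 0 := by rintro rfl; rw [zero_pow hn.ne'] at hβ; exact hB hβ.symm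
  have dA : (α⁻¹ • A).det = 1 := by
    rw [det_smul, Fintype.card_fin, inv_pow, hα, inv_mul_cancel₀ hA]
  have dB : (β⁻¹ • B).det = 1 := by
    rw [det_smul, Fintype.card_fin, inv_pow, hβ, inv_mul_cancel₀ hB]
  have h1 : (coo fun i => A * X i * B) = fun p => (α * β) * coo (fun i => (α⁻¹ • A) * X i * (β⁻¹ • B)) p := by
    funext p
    simp only [coo, Matrix.smul_mul, Matrix.mul_smul, Matrix.smul_apply, smul_eq_mul]
    field_simp
  rw [h1, hom_aeval_smul he, hf.right _ dB (fun i => (α⁻¹ • A) * X i), hf.left _ dA, mul_pow, ← hα, ← hβ]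
  ring

theorem map_aeval_coo {A B : Type*} [CommRing A] [CommRing B] [Algebra k A] [Algebra k B] (φ : A →ₐ[k] B)
    (X : Fin m → Matrix (Fin n) (Fin n) A) (f : MvPolynomial (Idx n m) k) :
    φ (aeval (coo X) f) = aeval (coo fun i => (X i).map φ) f := by
  rw [← AlgHom.comp_apply, comp_aeval]; rfl

theorem gl_scale (hf : SInv f) (he : f.IsHomogeneous e) (hn : 0 < n) {L : Type*} [Field L] [Algebra k L]
    (A B : Matrix (Fin n) (Fin n) L) (hA : A.det ≠ 0) (hB : B.det ≠ 0) (X : Fin m → Matrix (Fin n) (Fin n) L) :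
    aeval (coo fun i => A * X i * B) f ^ n = (A.det * B.det) ^ e * aeval (coo X) f ^ n := by
  let φ : L →ₐ[k] AlgebraicClosure L := IsScalarTower.toAlgHom k L (AlgebraicClosure L)
  have hinj : Function.Injective φ := φ.toRingHom.injective
  apply hinj
  have hd : ∀ M : Matrix (Fin n) (Fin n) L, (M.map φ).det = φ M.det := fun M => (RingHom.map_det φ.toRingHom M).symm
  have hne : ∀ M : Matrix (Fin n) (Fin n) L, M.det ≠ 0 → (M.map φ).det ≠ 0 := fun M hM => by
    rw [hd]; exact fun h => hM (hinj (by rw [h, map_zero]))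
  have := gl_scale_ac hf he hn (A.map φ) (B.map φ) (hne A hA) (hne B hB) (fun i => (X i).map φ)
  rw [hd, hd] at this
  simp only [map_pow, map_mul, map_aeval_coo]
  rw [← this]
  simp only [Matrix.map_mul]
end glsc

theorem bl_mul {A : Type*} [CommRing A] {n m : ℕ} {δ : Type*} [Fintype δ] [DecidableEq δ] (P Q : Matrix (Fin n) (Fin n) A)
    (X : Fin m → Matrix (Fin n) (Fin n) A) (T : Fin m → Matrix δ δ A) :
    (bl (fun i => P * X i * Q) T).det = (P.det * Q.det) ^ Fintype.card δ * (bl X T).det := by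
  have : bl (fun i => P * X i * Q) T = kronecker P (1 : Matrix δ δ A) * bl X T * kronecker Q (1 : Matrix δ δ A) := by
    have h0 : ∀ Y : Fin m → Matrix (Fin n) (Fin n) A, bl Y T = ∑ i, kronecker (Y i) (T i) := by
      intro Y; ext p q; simp [bl, Matrix.sum_apply]
    rw [h0, h0, Finset.mul_sum, Finset.sum_mul]
    refine Finset.sum_congr rfl fun i _ => ?_
    simp only [kronecker]
    rw [← Matrix.mul_kronecker_mul, ← Matrix.mul_kronecker_mul, Matrix.one_mul, Matrix.mul_one]
  rw [this, det_mul, det_mul]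
  simp only [kronecker, det_kronecker]
  simp
  ring

theorem bl_det_zero {K L : Type*} [Field K] [Infinite K] [Field L] [Algebra K L] {n m : ℕ}
    (Y : Fin m → Matrix (Fin n) (Fin n) L)
    (h : ∀ T : Fin m → Matrix (Fin n) (Fin n) K, (bl Y fun i => (T i).map (algebraMap K L)).det = 0)
    (T : Fin m → Matrix (Fin n) (Fin n) L) : (bl Y T).det = 0 := by
  have e : ∀ x : Fin m × Fin n × Fin n → L, eval x (genM (δ := Fin n) Y).det = 
      (bl Y fun i => Matrix.of fun a b => x (i, a, b)).det := by
    intro x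
    rw [RingHom.map_det]
    congr 1
    ext r c
    simp [genM, bl]
  have h0 : (genM (δ := Fin n) Y).det = 0 := by
    have hs : (Set.range (algebraMap K L)).Infinite := Set.infinite_range_of_injective (algebraMap K L).injective
    refine MvPolynomial.funext_set (fun _ => Set.range (algebraMap K L)) (fun _ => hs) ?_
    intro x hx
    have hx' : ∀ p, ∃ y : K, algebraMap K L y = x p := fun p => hx p trivial
    choose y hy using hx'
    rw [e, map_zero, ← h fun i => Matrix.of fun a b => y (i, a, b)]
    congr 2
    funext i
    ext a b
    simp [hy]
  have := e fun p => T p.1 p.2.1 p.2.2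
  rw [h0, map_zero] at this
  exact this.symm

theorem prod_lt_pow {L : Type*} [CommRing L] (n b : ℕ) (hb : b ≤ n) (t : L) :
    ∏ r : Fin n, (if r.val < b then t else 1) = t ^ b := by
  rw [Fin.prod_univ_eq_prod_range (fun r => if r < b then t else 1) n, ← Finset.prod_filter]
  have : (Finset.range n).filter (fun r => r < b) = Finset.range b := by ext; simp; omega
  rw [this]; simp

theorem aeval_mem_of {K Q σ : Type*} [Field K] [Field Q] [Algebra K Q] (O : ValuationSubring Q)
    (hK : ∀ c : K, algebraMap K Q c ∈ O) (h : MvPolynomial σ K) (x : σ → Q) (hx : ∀ p, x p ∈ O) : aeval x h ∈ O := by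
  induction h using MvPolynomial.induction_on with
  | C a => simpa using hK a
  | add p q hp hq => rw [map_add]; exact O.add_mem _ _ hp hq
  | mul_X p i hp => rw [map_mul, aeval_X]; exact O.mul_mem _ _ hp (hx i)

section ssr
variable {K Q : Type*} [Field K] [Infinite K] [Field Q] [Algebra K Q] (O : ValuationSubring Q)
  {n m : ℕ}

theorem ssr_step (hK : ∀ c : K, algebraMap K Q c ∈ O) (π : Q) (hπ : O.valuation π < 1) (hπ0 : π ≠ 0)
    (Y : Fin m → Matrix (Fin n) (Fin n) Q) (hY : ∀ i r c, Y i r c ∈ O)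
    (hall : ∀ T : Fin m → Matrix (Fin n) (Fin n) K, O.valuation (bl Y fun i => (T i).map (algebraMap K Q)).det < 1) :
    ∃ (A B : Matrix (Fin n) (Fin n) Q) (t : Q), A.det ≠ 0 ∧ B.det ≠ 0 ∧ t ≠ 0 ∧ O.valuation t < 1 ∧
      O.valuation (A.det * B.det * t) ≥ 1 ∧ ∀ i r c, (A * Y i * B) r c ∈ O := by
  let κ := IsLocalRing.ResidueField O
  let ι : K →+* O := (algebraMap K Q).codRestrict O.toSubring hK
  letI : Algebra K κ := ((IsLocalRing.residue O).comp ι).toAlgebra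
  have : Infinite κ := Infinite.of_injective _ (algebraMap K κ).injective
  let Y0 : Fin m → Matrix (Fin n) (Fin n) O := fun i => Matrix.of fun r c => ⟨Y i r c, hY i r c⟩
  let Yb : Fin m → Matrix (Fin n) (Fin n) κ := fun i => (Y0 i).map (IsLocalRing.residue O)
  have hres : ∀ x : O, IsLocalRing.residue O x = 0 ↔ O.valuation (x : Q) < 1 := by
    intro x
    rw [IsLocalRing.residue_eq_zero_iff]
    exact ValuationSubring.valuation_lt_one_iff O x
  have hN := NC Yb (bl_det_zero (K := K) Yb (by
    intro T
    have h1 := hall T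
    let M : Matrix (Fin n × Fin n) (Fin n × Fin n) O := bl Y0 fun i => (T i).map ι
    have h2 : (M.map (algebraMap O Q)) = bl Y fun i => (T i).map (algebraMap K Q) := by
      ext p q
      simp only [M, bl, Matrix.map_apply, Matrix.of_apply, map_sum, map_mul]
      rfl
    have h3 : (M.map (IsLocalRing.residue O)) = bl Yb fun i => (T i).map (algebraMap K κ) := by
      ext p q
      simp only [M, bl, Matrix.map_apply, Matrix.of_apply, map_sum, map_mul]
      rfl
    rw [← h3, ← RingHom.mapMatrix_apply, ← RingHom.map_det, hres]
    rw [← h2, ← RingHom.mapMatrix_apply, ← RingHom.map_det] at h1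
    exact h1))
  obtain ⟨Pb, Qb, a, b, hP, hQ, hba, han, hz⟩ := hN
  have hlift : ∀ M : Matrix (Fin n) (Fin n) κ, ∃ N : Matrix (Fin n) (Fin n) O, N.map (IsLocalRing.residue O) = M := by
    intro M
    choose f hf using fun r c => IsLocalRing.residue_surjective (R := O) (M r c)
    exact ⟨Matrix.of f, by ext r c; simp [hf]⟩
  obtain ⟨P, rfl⟩ := hlift Pb
  obtain ⟨R, rfl⟩ := hlift Qb
  have hval : ∀ M : Matrix (Fin n) (Fin n) O, (M.map (IsLocalRing.residue O)).det ≠ 0 → 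
      O.valuation (M.map (algebraMap O Q)).det = 1 := by
    intro M hM
    rw [← RingHom.mapMatrix_apply, ← RingHom.map_det] at hM
    rw [← RingHom.mapMatrix_apply, ← RingHom.map_det]
    rw [Ne, hres, not_lt] at hM
    exact le_antisymm ((O.valuation_le_one_iff _).2 (M.det).2) hM
  have vP := hval P hP
  have vR := hval R hQ
  let Z0 : Fin m → Matrix (Fin n) (Fin n) O := fun i => R * Y0 i * P
  let P1 := P.map (algebraMap O Q)
  let R1 := R.map (algebraMap O Q)
  have hZ : ∀ i, R1 * Y i * P1 = (Z0 i).map (algebraMap O Q) := by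
    intro i
    simp only [Z0, Matrix.map_mul]
    rfl
  have hz2 : ∀ i r c, b ≤ r.val → c.val < a → O.valuation (Z0 i r c : Q) < 1 := by
    intro i r c hr hc
    rw [← hres, ← hz i r c hr hc]
    simp only [Z0, Yb, ← Matrix.map_mul]
    rfl
  let F : Option (Fin m × Fin n × Fin n) → Q := fun o => o.elim π fun p =>
    if b ≤ p.2.1.val ∧ p.2.2.val < a then (Z0 p.1 p.2.1 p.2.2 : Q) else 0
  obtain ⟨o, ho⟩ := Finite.exists_max (fun o => O.valuation (F o))
  have hF1 : ∀ o, O.valuation (F o) < 1 := by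
    rintro (_ | p)
    · exact hπ
    · show O.valuation (if b ≤ p.2.1.val ∧ p.2.2.val < a then (Z0 p.1 p.2.1 p.2.2 : Q) else 0) < 1
      split_ifs with h
      · exact hz2 _ _ _ h.1 h.2
      · simp
  set t := F o with ht
  have ht1 : O.valuation t < 1 := hF1 o
  have ht0 : t ≠ 0 := by
    intro h0
    have := ho none
    rw [h0, map_zero] at this
    have h2 := le_zero_iff.1 this
    exact hπ0 ((map_eq_zero _).1 h2)
  let d1 : Fin n → Q := fun r => if r.val < b then t else 1
  let d2 : Fin n → Q := fun r => if r.val < a then t⁻¹ else 1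
  have hd1 : (diagonal d1).det = t ^ b := by rw [det_diagonal]; exact prod_lt_pow n b (by omega) t
  have hd2 : (diagonal d2).det = t⁻¹ ^ a := by rw [det_diagonal]; exact prod_lt_pow n a (by omega) _
  have hP1 : P1.det ≠ 0 := by
    intro h; rw [h] at vP; simp at vP
  have hR1 : R1.det ≠ 0 := by
    intro h; rw [h] at vR; simp at vR
  refine ⟨diagonal d1 * R1, P1 * diagonal d2, t, ?_, ?_, ht0, ht1, ?_, ?_⟩
  · rw [det_mul, hd1]; exact mul_ne_zero (pow_ne_zero _ ht0) hR1
  · rw [det_mul, hd2]; exact mul_ne_zero hP1 (pow_ne_zero _ (inv_ne_zero ht0))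
  · rw [det_mul, det_mul, hd1, hd2]
    obtain ⟨q, rfl⟩ : ∃ q, a = b + 1 + q := ⟨a - (b + 1), by omega⟩
    have : t ^ b * R1.det * (P1.det * t⁻¹ ^ (b + 1 + q)) * t = R1.det * P1.det * (t ^ q)⁻¹ := by
      rw [inv_pow]; field_simp; ring
    rw [this, map_mul, map_mul]
    have vP' : O.valuation P1.det = 1 := vP
    have vR' : O.valuation R1.det = 1 := vR
    rw [vP', vR', one_mul, one_mul, map_inv₀, map_pow]
    apply (one_le_inv₀ _).2
    · exact pow_le_one₀ zero_le ht1.le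
    · apply pow_pos
      exact (Valuation.pos_iff _).2 ht0
  · intro i r c
    have : diagonal d1 * R1 * Y i * (P1 * diagonal d2) = diagonal d1 * ((Z0 i).map (algebraMap O Q)) * diagonal d2 := by
      rw [← hZ]; simp only [Matrix.mul_assoc]
    rw [this, Matrix.mul_diagonal, Matrix.diagonal_mul]
    have hz0 : O.valuation ((Z0 i).map (algebraMap O Q) r c) ≤ 1 := (O.valuation_le_one_iff _).2 (Z0 i r c).2
    rw [← O.valuation_le_one_iff]
    simp only [d1, d2]
    by_cases hr : r.val < b
    · by_cases hc : c.val < a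
      · rw [if_pos hr, if_pos hc, mul_comm t, mul_assoc, mul_inv_cancel₀ ht0, mul_one]; exact hz0
      · rw [if_pos hr, if_neg hc, mul_one, map_mul]
        exact mul_le_one' ht1.le hz0
    · by_cases hc : c.val < a
      · rw [if_neg hr, if_pos hc, one_mul, map_mul, map_inv₀]
        have h5 := ho (some (i, r, c))
        have h6 : F (some (i, r, c)) = (Z0 i).map (algebraMap O Q) r c := if_pos ⟨not_lt.1 hr, hc⟩
        rw [h6] at h5
        exact mul_inv_le_one_of_le₀ h5 zero_le
      · rw [if_neg hr, if_neg hc, mul_one, one_mul]; exact hz0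

theorem SSR (hK : ∀ c : K, algebraMap K Q c ∈ O) (π : Q) (hπ : O.valuation π < 1)
    (D : ℕ) (hdisc : ∀ x, O.valuation x < 1 → O.valuation x ^ D ≤ O.valuation π)
    (harch : ∀ w, w ≠ 0 → ∃ j : ℕ, O.valuation π ^ j < O.valuation w)
    (hn : 0 < n) (X : Fin m → Matrix (Fin n) (Fin n) Q)
    (hX : ∀ T : Fin m → Matrix (Fin n) (Fin n) K, (bl X fun i => (T i).map (algebraMap K Q)).det ∈ O)
    (h : MvPolynomial (Idx n m) K) (hh : SInv h) (e : ℕ) (he : h.IsHomogeneous e) : aeval (coo X) h ∈ O := by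
  rcases Nat.eq_zero_or_pos e with rfl | he0
  · have := (totalDegree_eq_zero_iff_eq_C).1 (Nat.le_zero.1 he.totalDegree_le)
    rw [this, aeval_C]
    exact hK _
  by_cases hπ0 : π = 0
  · subst hπ0
    by_contra hne
    have h0 : aeval (coo X) h ≠ 0 := fun h0 => hne (h0 ▸ O.zero_mem)
    have h1 : 1 < O.valuation (aeval (coo X) h) := by
      rw [← not_le, O.valuation_le_one_iff]; exact hne
    have h2 := hdisc (aeval (coo X) h)⁻¹ (by rw [map_inv₀]; exact inv_lt_one_of_one_lt₀ h1)
    rw [map_zero, map_inv₀] at h2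
    have h3 := le_zero_iff.1 h2
    have h4 := eq_zero_of_pow_eq_zero h3
    rw [inv_eq_zero, map_eq_zero] at h4
    exact h0 h4
  have hvπ : 0 < O.valuation π := (Valuation.pos_iff _).2 hπ0
  -- scale to be integral
  obtain ⟨M, hM⟩ : ∃ M : ℕ, ∀ i r c, π ^ M * X i r c ∈ O := by
    have : ∀ p : Idx n m, ∃ j : ℕ, π ^ j * coo X p ∈ O := by
      intro p
      by_cases h0 : coo X p = 0
      · exact ⟨0, by simp [h0]⟩
      · obtain ⟨j, hj⟩ := harch (coo X p)⁻¹ (inv_ne_zero h0)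
        refine ⟨j, ?_⟩
        rw [← O.valuation_le_one_iff, map_mul, map_pow]
        rw [map_inv₀] at hj
        have := mul_inv_le_one_of_le₀ hj.le zero_le
        rwa [inv_inv] at this
    choose j hj using this
    refine ⟨∑ p, j p, fun i r c => ?_⟩
    have h1 : j (i, r, c) ≤ ∑ p, j p := Finset.single_le_sum (f := j) (fun _ _ => Nat.zero_le _) (Finset.mem_univ _)
    obtain ⟨q, hq⟩ := Nat.exists_eq_add_of_le h1
    rw [hq, add_comm, pow_add, mul_assoc]
    refine O.mul_mem _ _ (pow_mem ?_ _) (hj (i, r, c))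
    rw [← O.valuation_le_one_iff]; exact hπ.le
  obtain ⟨δ0, hδ0⟩ : ∃ δ0 : Q, δ0 = (π ^ M) ^ n := ⟨_, rfl⟩
  have hδ00 : δ0 ≠ 0 := hδ0 ▸ pow_ne_zero _ (pow_ne_zero _ hπ0)
  by_contra hne
  have hreach : ∀ j : ℕ, ∃ A B : Matrix (Fin n) (Fin n) Q, A.det ≠ 0 ∧ B.det ≠ 0 ∧ (∀ i r c, (A * X i * B) r c ∈ O) ∧
      O.valuation δ0 ^ D ≤ O.valuation (A.det * B.det) ^ D * O.valuation π ^ j := by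
    intro j
    induction j with
    | zero =>
      refine ⟨π ^ M • 1, 1, ?_, ?_, ?_, ?_⟩
      · rw [det_smul]; simpa using pow_ne_zero _ (pow_ne_zero _ hπ0)
      · simp
      · intro i r c
        simpa using hM i r c
      · rw [det_smul]; simp [hδ0]
    | succ j ih =>
      obtain ⟨A, B, hA, hB, hint, hv⟩ := ih
      by_cases hall : ∀ T : Fin m → Matrix (Fin n) (Fin n) K, 
        O.valuation (bl (fun i => A * X i * B) fun i => (T i).map (algebraMap K Q)).det < 1
      · obtain ⟨A', B', t, hA', hB', ht0, ht1, htv, hint'⟩ := ssr_step O hK π hπ hπ0 _ hint hall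
        refine ⟨A' * A, B * B', ?_, ?_, ?_, ?_⟩
        · rw [det_mul]; exact mul_ne_zero hA' hA
        · rw [det_mul]; exact mul_ne_zero hB hB'
        · intro i r c
          have := hint' i r c
          simpa only [Matrix.mul_assoc] using this
        · refine hv.trans ?_
          have e1 : (A' * A).det * (B * B').det = (A.det * B.det) * (A'.det * B'.det) := by
            rw [det_mul, det_mul]; ring
          rw [e1, map_mul O.valuation (A.det * B.det) (A'.det * B'.det), mul_pow, mul_assoc, pow_succ]
          refine mul_le_mul' le_rfl ?_
          have h6 : 1 ≤ O.valuation (A'.det * B'.det) ^ D * O.valuation π := by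
            refine le_trans ?_ (mul_le_mul_right (hdisc t ht1) _)
            rw [← mul_pow, ← map_mul]
            exact one_le_pow₀ htv
          calc O.valuation π ^ j = O.valuation π ^ j * 1 := (mul_one _).symm
            _ ≤ O.valuation π ^ j * (O.valuation (A'.det * B'.det) ^ D * O.valuation π) := mul_le_mul_right h6 _
            _ = _ := mul_left_comm _ _ _
      · exfalso
        push Not at hall
        obtain ⟨T, hT⟩ := hall
        rw [bl_mul] at hT
        have h1 := (O.valuation_le_one_iff _).2 (hX T)
        rw [map_mul, map_pow, Fintype.card_fin] at hT
        have h2 : 1 ≤ O.valuation (A.det * B.det) ^ n := by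
          refine hT.trans ?_
          have h9 := mul_le_mul_right h1 (O.valuation (A.det * B.det) ^ n)
          rwa [mul_one] at h9
        have h3 : 1 ≤ O.valuation (A.det * B.det) := by
          by_contra hlt
          rw [not_le] at hlt
          exact absurd h2 (not_le.2 (pow_lt_one₀ zero_le hlt hn.ne'))
        have h4 := gl_scale hh he hn A B hA hB X
        have h5 : aeval (coo fun i => A * X i * B) h ∈ O := aeval_mem_of O hK h _ fun p => hint _ _ _
        have h6 : O.valuation (aeval (coo X) h) ^ n ≤ 1 := by
          have h7 := congrArg O.valuation h4
          simp only [map_mul, map_pow] at h7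
          rw [← map_mul] at h7
          have h8 : O.valuation (aeval (coo fun i => A * X i * B) h) ^ n ≤ 1 :=
            pow_le_one₀ zero_le ((O.valuation_le_one_iff _).2 h5)
          rw [h7] at h8
          refine le_trans ?_ h8
          have h9 := mul_le_mul_left (one_le_pow₀ (n := e) h3) (O.valuation (aeval (coo X) h) ^ n)
          rwa [one_mul] at h9
        apply hne
        rw [← O.valuation_le_one_iff]
        by_contra hlt
        rw [not_le] at hlt
        exact absurd h6 (not_le.2 (one_lt_pow₀ hlt hn.ne'))
  have h0 : aeval (coo X) h ≠ 0 := fun h0 => hne (h0 ▸ O.zero_mem)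
  obtain ⟨j, hj⟩ := harch (δ0 ^ (D * e) * (aeval (coo X) h) ^ (n * D))
    (mul_ne_zero (pow_ne_zero _ hδ00) (pow_ne_zero _ h0))
  obtain ⟨A, B, hA, hB, hint, hv⟩ := hreach j
  have h4 := gl_scale hh he hn A B hA hB X
  have h5 : aeval (coo fun i => A * X i * B) h ∈ O := aeval_mem_of O hK h _ fun p => hint _ _ _
  have h7 := congrArg O.valuation h4
  simp only [map_mul, map_pow] at h7
  rw [← map_mul] at h7
  have h8 : O.valuation (aeval (coo fun i => A * X i * B) h) ^ n ≤ 1 :=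
    pow_le_one₀ zero_le ((O.valuation_le_one_iff _).2 h5)
  rw [h7] at h8
  refine absurd hj (not_lt.2 ?_)
  rw [map_mul, map_pow O.valuation δ0, map_pow O.valuation (aeval (coo X) h)]
  calc O.valuation δ0 ^ (D * e) * O.valuation (aeval (coo X) h) ^ (n * D) 
      = (O.valuation δ0 ^ D) ^ e * (O.valuation (aeval (coo X) h) ^ n) ^ D := by rw [pow_mul, pow_mul]
    _ ≤ (O.valuation (A.det * B.det) ^ D * O.valuation π ^ j) ^ e * (O.valuation (aeval (coo X) h) ^ n) ^ D := 
        mul_le_mul_left (pow_le_pow_left₀ zero_le hv e) _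
    _ = (O.valuation (A.det * B.det) ^ e * O.valuation (aeval (coo X) h) ^ n) ^ D * (O.valuation π ^ j) ^ e := by
        rw [mul_pow, mul_pow, ← pow_mul, ← pow_mul, ← pow_mul, ← pow_mul, mul_comm D e]; exact mul_right_comm _ _ _
    _ ≤ 1 * (O.valuation π ^ j) ^ e := mul_le_mul_left (pow_le_one₀ zero_le h8) _
    _ ≤ O.valuation π ^ j := by
        rw [one_mul]
        exact pow_le_of_le_one zero_le (pow_le_one₀ zero_le hπ.le) he0.ne'
end ssr

theorem dominate {K : Type*} [Field K] (A : Subring K) (P : Ideal A) [P.IsPrime] :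
    ∃ V : ValuationSubring K, A ≤ V.toSubring ∧ (∀ a : A, a ∈ P → V.valuation (a : K) < 1) ∧
      ∀ a : A, a ∉ P → V.valuation (a : K) = 1 := by
  obtain ⟨V, hV⟩ := (LocalSubring.ofPrime A P).exists_le_valuationSubring
  have hle : A ≤ V.toSubring := (LocalSubring.le_ofPrime A P).trans hV.1
  refine ⟨V, hle, ?_, ?_⟩
  · intro a ha
    rw [← V.mem_nonunits_iff]
    have h1 : algebraMap A (LocalSubring.ofPrime A P).toSubring a ∈ 
        IsLocalRing.maximalIdeal (LocalSubring.ofPrime A P).toSubring :=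
      (IsLocalization.AtPrime.to_map_mem_maximal_iff _ P a).2 ha
    let y : V := Subring.inclusion hV.1 (algebraMap A (LocalSubring.ofPrime A P).toSubring a)
    have h2 : y ∈ IsLocalRing.maximalIdeal V := by
      rw [IsLocalRing.mem_maximalIdeal, mem_nonunits_iff] at h1
      refine (IsLocalRing.mem_maximalIdeal y).2 ?_
      exact fun hu => h1 (hV.2.1 _ hu)
    exact V.coe_mem_nonunits_iff.2 h2
  · intro a ha
    have h1 : IsUnit (algebraMap A (LocalSubring.ofPrime A P).toSubring a) :=
      (IsLocalization.AtPrime.isUnit_to_map_iff _ P a).2 ha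
    have h2 := h1.map (Subring.inclusion hV.1)
    exact (V.valuation_eq_one_iff ⟨a, hle a.2⟩).1 h2

theorem val_frac {Pi0 F Q : Type*} [CommRing Pi0] [IsDomain Pi0] [UniqueFactorizationMonoid Pi0]
    [Field F] [Algebra Pi0 F] [IsFractionRing Pi0 F] [Field Q] [Algebra Pi0 Q] [Algebra F Q]
    [IsScalarTower Pi0 F Q] (V : ValuationSubring Q) (g : Pi0) (hg : Prime g)
    (hu : ∀ a : Pi0, ¬ g ∣ a → V.valuation (algebraMap Pi0 Q a) = 1) (c : F) (hc : c ≠ 0) :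
    ∃ i j : ℕ, V.valuation (algebraMap F Q c) * V.valuation (algebraMap Pi0 Q g) ^ j
      = V.valuation (algebraMap Pi0 Q g) ^ i := by
  have key : ∀ a : Pi0, a ≠ 0 → ∃ i : ℕ, V.valuation (algebraMap Pi0 Q a) =
      V.valuation (algebraMap Pi0 Q g) ^ i := by
    intro a ha
    have hf := FiniteMultiplicity.of_prime_left hg ha
    obtain ⟨c, hc, hc'⟩ := hf.exists_eq_pow_mul_and_not_dvd
    refine ⟨multiplicity g a, ?_⟩
    conv_lhs => rw [hc]
    rw [map_mul, map_mul, hu c hc', mul_one, map_pow, map_pow]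
  obtain ⟨a, b, hb, rfl⟩ := IsFractionRing.div_surjective (A := Pi0) c
  have hb0 : b ≠ 0 := nonZeroDivisors.ne_zero hb
  have ha0 : a ≠ 0 := by rintro rfl; simp at hc
  obtain ⟨i, hi⟩ := key a ha0
  obtain ⟨j, hj⟩ := key b hb0
  refine ⟨i, j, ?_⟩
  have hb1 : algebraMap Pi0 F b ≠ 0 := by
    simpa using hb0
  rw [← hi, ← hj, ← map_mul, IsScalarTower.algebraMap_apply Pi0 F Q, IsScalarTower.algebraMap_apply Pi0 F Q,
    ← map_mul, div_mul_cancel₀ _ hb1]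

theorem two_terms {Q ι : Type*} [Field Q] [DecidableEq ι] (V : ValuationSubring Q) (s : Finset ι) (f : ι → Q)
    (h0 : ∑ i ∈ s, f i = 0) (k : ι) (hk : k ∈ s) (hfk : f k ≠ 0) :
    ∃ i ∈ s, ∃ j ∈ s, i ≠ j ∧ f i ≠ 0 ∧ f j ≠ 0 ∧ V.valuation (f i) = V.valuation (f j) := by
  obtain ⟨j, hj, hmax⟩ := s.exists_max_image (fun i => V.valuation (f i)) ⟨k, hk⟩
  have hj0 : f j ≠ 0 := by
    intro h
    have := hmax k hk
    simp [h] at this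
    exact hfk this
  by_contra hcon
  push Not at hcon
  have h1 := V.valuation.map_sum_eq_of_lt (f := f) hj (fun i hi => by
    simp only [Finset.mem_sdiff, Finset.mem_singleton] at hi
    refine lt_of_le_of_ne (hmax i hi.1) ?_
    intro he
    refine hcon i hi.1 j hj hi.2 ?_ hj0 he
    intro h
    rw [h, map_zero] at he
    exact hj0 ((V.valuation.zero_iff).1 he.symm))
  rw [h0, map_zero] at h1
  exact hj0 ((V.valuation.zero_iff).1 h1.symm)

theorem val_pow_rel {Pi0 F Q : Type*} [CommRing Pi0] [IsDomain Pi0] [UniqueFactorizationMonoid Pi0]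
    [Field F] [Algebra Pi0 F] [IsFractionRing Pi0 F] [Field Q] [Algebra Pi0 Q] [Algebra F Q]
    [IsScalarTower Pi0 F Q] [FiniteDimensional F Q] (V : ValuationSubring Q) (g : Pi0) (hg : Prime g)
    (hu : ∀ a : Pi0, ¬ g ∣ a → V.valuation (algebraMap Pi0 Q a) = 1) (x : Q) (hx : x ≠ 0) :
    ∃ a b d : ℕ, 0 < d ∧ d ≤ Module.finrank F Q ∧ 
      V.valuation x ^ d * V.valuation (algebraMap Pi0 Q g) ^ b
      = V.valuation (algebraMap Pi0 Q g) ^ a := by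
  have hint : IsIntegral F x := Algebra.IsIntegral.isIntegral x
  set q := minpoly F x with hq
  have hq0 : q ≠ 0 := minpoly.ne_zero hint
  have hsum := minpoly.aeval F x
  rw [← hq, Polynomial.aeval_eq_sum_range] at hsum
  obtain ⟨k, hk, l, hl, hkl, hk0, hl0, he⟩ := two_terms V _ _ hsum q.natDegree (by simp) (by
    rw [Algebra.smul_def]
    refine mul_ne_zero ?_ (pow_ne_zero _ hx)
    have : q.coeff q.natDegree ≠ 0 := by simpa using hq0
    simpa using this)
  wlog hlt : k < l generalizing k l
  · exact this l hl k hk hkl.symm hl0 hk0 he.symm (lt_of_le_of_ne (not_lt.1 hlt) hkl.symm)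
  have hck : q.coeff k ≠ 0 := fun h => hk0 (by simp [h])
  have hcl : q.coeff l ≠ 0 := fun h => hl0 (by simp [h])
  obtain ⟨i, j, hij⟩ := val_frac (F := F) V g hg hu _ hck
  obtain ⟨i', j', hij'⟩ := val_frac (F := F) V g hg hu _ hcl
  have hdeg : q.natDegree ≤ Module.finrank F Q := minpoly.natDegree_le x
  simp only [Finset.mem_range] at hk hl
  refine ⟨i + j', i' + j, l - k, by omega, by omega, ?_⟩
  rw [Algebra.smul_def, Algebra.smul_def, map_mul, map_mul, map_pow, map_pow] at he
  have hvx : V.valuation x ^ k ≠ 0 := pow_ne_zero _ (by simpa using hx)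
  have he2 : V.valuation (algebraMap F Q (q.coeff k)) = V.valuation (algebraMap F Q (q.coeff l)) * V.valuation x ^ (l-k) := by
    have : V.valuation x ^ l = V.valuation x ^ (l-k) * V.valuation x ^ k := by
      rw [← pow_add]; congr 1; omega
    rw [this, ← mul_assoc] at he
    exact mul_right_cancel₀ hvx he
  rw [pow_add, pow_add, ← hij, ← hij', he2]
  simp only [mul_comm, mul_left_comm, mul_assoc]

theorem core_dv {Pi0 F Q : Type*} [CommRing Pi0] [IsDomain Pi0] [UniqueFactorizationMonoid Pi0]
    [Field F] [Algebra Pi0 F] [IsFractionRing Pi0 F] [Field Q] [Algebra Pi0 Q] [Algebra F Q]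
    [IsScalarTower Pi0 F Q] [FiniteDimensional F Q] [Module.IsTorsionFree Pi0 Q] (z : Q) (hz : IsIntegral Pi0 z)
    (hz0 : (minpoly Pi0 z).coeff 0 ≠ 0) (hzu : ¬ IsUnit ((minpoly Pi0 z).coeff 0)) :
    ∃ (O : ValuationSubring Q) (π : Q) (D : ℕ), (∀ a : Pi0, algebraMap Pi0 Q a ∈ O) ∧
      O.valuation z < 1 ∧ O.valuation π < 1 ∧
      (∀ x, O.valuation x < 1 → O.valuation x ^ D ≤ O.valuation π) ∧
      (∀ w, w ≠ 0 → ∃ j : ℕ, O.valuation π ^ j < O.valuation w) := by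
  obtain ⟨g, hg, hgd⟩ := WfDvdMonoid.exists_irreducible_factor hzu hz0
  have hgp : Prime g := hg.prime
  have : (Ideal.span {g}).IsPrime := (Ideal.span_singleton_prime hgp.ne_zero).2 hgp
  let φ : AdjoinRoot (minpoly Pi0 z) →+* Pi0 ⧸ Ideal.span {g} :=
    AdjoinRoot.lift (Ideal.Quotient.mk (Ideal.span {g})) 0 (by
      rw [Polynomial.eval₂_at_zero]
      exact Ideal.Quotient.eq_zero_iff_mem.2 (Ideal.mem_span_singleton.2 hgd))
  let A := Algebra.adjoin Pi0 ({z} : Set Q)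
  let ε := minpoly.equivAdjoin hz
  let χ : A →+* Pi0 ⧸ Ideal.span {g} := φ.comp ε.symm.toRingEquiv.toRingHom
  have hχa : ∀ a : Pi0, χ (algebraMap Pi0 A a) = Ideal.Quotient.mk _ a := by
    intro a
    show φ (ε.symm (algebraMap Pi0 A a)) = _
    rw [AlgEquiv.commutes]
    exact AdjoinRoot.lift_of _
  have hzA : z ∈ A := Algebra.subset_adjoin rfl
  have hχz : χ ⟨z, hzA⟩ = 0 := by
    show φ (ε.symm ⟨z, hzA⟩) = _
    have : ε.symm ⟨z, hzA⟩ = AdjoinRoot.root _ := by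
      rw [AlgEquiv.symm_apply_eq]
      apply Subtype.ext
      simp [ε]
    rw [this]
    exact AdjoinRoot.lift_root _
  let P : Ideal A.toSubring := RingHom.ker (show A.toSubring →+* Pi0 ⧸ Ideal.span {g} from χ)
  have hP : P.IsPrime := RingHom.ker_isPrime _
  obtain ⟨V, hV, h1, h2⟩ := dominate A.toSubring P
  have hu : ∀ a : Pi0, ¬ g ∣ a → V.valuation (algebraMap Pi0 Q a) = 1 := by
    intro a ha
    refine h2 ⟨algebraMap Pi0 Q a, A.algebraMap_mem a⟩ ?_
    intro h
    apply ha
    have h3 : χ (algebraMap Pi0 A a) = 0 := h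
    rw [hχa] at h3
    exact Ideal.mem_span_singleton.1 (Ideal.Quotient.eq_zero_iff_mem.1 h3)
  have hvg : V.valuation (algebraMap Pi0 Q g) < 1 := by
    refine h1 ⟨algebraMap Pi0 Q g, A.algebraMap_mem g⟩ ?_
    show χ (algebraMap Pi0 A g) = 0
    rw [hχa]
    exact Ideal.Quotient.eq_zero_iff_mem.2 (Ideal.mem_span_singleton_self g)
  have hvz : V.valuation z < 1 := h1 ⟨z, hzA⟩ hχz
  have hg0 : V.valuation (algebraMap Pi0 Q g) ≠ 0 := by
    simpa using hgp.ne_zero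
  refine ⟨V, algebraMap Pi0 Q g, Module.finrank F Q, fun a => hV (A.algebraMap_mem a), hvz, hvg, ?_, ?_⟩
  · intro x hx
    by_cases hx0 : x = 0
    · have : 0 < Module.finrank F Q := Module.finrank_pos
      rw [hx0, map_zero, zero_pow this.ne']
      exact zero_le
    obtain ⟨a, b, d, hd, hdD, h⟩ := val_pow_rel (F := F) V g hgp hu x hx0
    have hxd : V.valuation x ^ d < 1 := pow_lt_one' hx hd.ne'
    have hab : b < a := by
      by_contra hab
      push Not at hab
      have h3 : V.valuation (algebraMap Pi0 Q g) ^ b ≤ V.valuation (algebraMap Pi0 Q g) ^ a :=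
        pow_le_pow_right_of_le_one' hvg.le hab
      rw [← h] at h3
      have h4 : V.valuation x ^ d * V.valuation (algebraMap Pi0 Q g) ^ b < 1 * V.valuation (algebraMap Pi0 Q g) ^ b :=
        mul_lt_mul_of_pos_right hxd (zero_lt_iff.2 (pow_ne_zero _ hg0))
      rw [one_mul] at h4
      exact absurd h3 (not_le.2 h4)
    have h5 : V.valuation x ^ d = V.valuation (algebraMap Pi0 Q g) ^ (a - b) := by
      apply mul_right_cancel₀ (pow_ne_zero b hg0)
      rw [h, ← pow_add]; congr 1; omega
    calc V.valuation x ^ Module.finrank F Q ≤ V.valuation x ^ d :=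
          pow_le_pow_right_of_le_one' hx.le hdD
      _ = _ := h5
      _ ≤ V.valuation (algebraMap Pi0 Q g) ^ 1 := pow_le_pow_right_of_le_one' hvg.le (by omega)
      _ = _ := pow_one _
  · intro w hw
    by_cases hw1 : 1 ≤ V.valuation w
    · exact ⟨1, by rw [pow_one]; exact hvg.trans_le hw1⟩
    push Not at hw1
    obtain ⟨a, b, d, hd, hdD, h⟩ := val_pow_rel (F := F) V g hgp hu w hw
    refine ⟨a + 1, ?_⟩
    calc V.valuation (algebraMap Pi0 Q g) ^ (a+1) < V.valuation (algebraMap Pi0 Q g) ^ a := by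
          rw [pow_succ]
          calc _ < V.valuation (algebraMap Pi0 Q g) ^ a * 1 := 
                mul_lt_mul_of_pos_left hvg (zero_lt_iff.2 (pow_ne_zero _ hg0))
            _ = _ := mul_one _
      _ = V.valuation w ^ d * V.valuation (algebraMap Pi0 Q g) ^ b := h.symm
      _ ≤ V.valuation w ^ 1 * 1 := mul_le_mul' (pow_le_pow_right_of_le_one' hw1.le hd) (pow_le_one' hvg.le _)
      _ = _ := by rw [mul_one, pow_one]

theorem mem_V_of_integral {R Q : Type*} [CommRing R] [Field Q] [Algebra R Q] (V : ValuationSubring Q)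
    (h : ∀ a, algebraMap R Q a ∈ V) (x : Q) (hx : IsIntegral R x) : x ∈ V := by
  obtain ⟨p, hp, hpx⟩ := hx
  let f : R →+* V := (algebraMap R Q).codRestrict V h
  have h1 : IsIntegral V x := by
    refine ⟨p.map f, hp.map f, ?_⟩
    rw [Polynomial.eval₂_map]
    exact hpx
  obtain ⟨y, hy⟩ := IsIntegrallyClosed.isIntegral_iff.1 h1
  rw [← hy]
  exact y.2

open TensorProduct in
theorem spec_dv {P S : Type u} [CommRing P] [IsDomain P] [UniqueFactorizationMonoid P]
    [CommRing S] [IsDomain S] [Algebra P S] [Module.IsTorsionFree P S] [Algebra.FiniteType P S] (y : S) (hy : IsIntegral P y)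
    (hy0 : (minpoly P y).coeff 0 ≠ 0) (hyu : ¬ IsUnit ((minpoly P y).coeff 0)) :
    ∃ (Q : Type u) (_ : Field Q) (_ : Algebra P Q) (ψ : S →ₐ[P] Q) 
    (O : ValuationSubring Q) (π : Q) (D : ℕ), (∀ a : P, algebraMap P Q a ∈ O) ∧
      O.valuation (ψ y) < 1 ∧ O.valuation π < 1 ∧
      (∀ x, O.valuation x < 1 → O.valuation x ^ D ≤ O.valuation π) ∧
      (∀ w, w ≠ 0 → ∃ j : ℕ, O.valuation π ^ j < O.valuation w) := by
  let F := FractionRing P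
  have hinj : Function.Injective (algebraMap P S) := FaithfulSMul.algebraMap_injective P S
  have hfl : Module.Flat P F := IsLocalization.flat F (nonZeroDivisors P)
  have hnt : Nontrivial (F ⊗[P] S) := by
    have := Algebra.TensorProduct.includeLeft_injective (S := P) (A := F) hinj
    exact this.nontrivial
  obtain ⟨mm, hmm⟩ := Ideal.exists_maximal (F ⊗[P] S)
  letI : Field ((F ⊗[P] S) ⧸ mm) := Ideal.Quotient.field mm
  have hft : Algebra.FiniteType F (F ⊗[P] S) := inferInstance
  have hft2 : Algebra.FiniteType F ((F ⊗[P] S) ⧸ mm) := inferInstance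
  have hfin : Module.Finite F ((F ⊗[P] S) ⧸ mm) := finite_of_finite_type_of_isJacobsonRing F _
  let ψ : S →ₐ[P] ((F ⊗[P] S) ⧸ mm) := (Ideal.Quotient.mkₐ P mm).comp Algebra.TensorProduct.includeRight
  have htower : IsScalarTower P F ((F ⊗[P] S) ⧸ mm) := inferInstance
  have hinj2 : Function.Injective (algebraMap P ((F ⊗[P] S) ⧸ mm)) := by
    rw [IsScalarTower.algebraMap_eq P F ((F ⊗[P] S) ⧸ mm)]
    exact (algebraMap F ((F ⊗[P] S) ⧸ mm)).injective.comp (IsFractionRing.injective P F)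
  have htf : Module.IsTorsionFree P ((F ⊗[P] S) ⧸ mm) := 
    Module.isTorsionFree_iff_algebraMap_injective.2 hinj2
  have hz : IsIntegral P (ψ y) := hy.map ψ
  have hmin : minpoly P (ψ y) = minpoly P y := by
    have hd : minpoly P (ψ y) ∣ minpoly P y := by
      apply minpoly.isIntegrallyClosed_dvd hz
      rw [Polynomial.aeval_algHom_apply, minpoly.aeval, map_zero]
    have hirr : Irreducible (minpoly P y) := (minpoly.prime_of_isIntegrallyClosed hy).irreducible
    refine Polynomial.eq_of_monic_of_associated (minpoly.monic hz) (minpoly.monic hy) ?_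
    refine Irreducible.associated_of_dvd ?_ hirr hd
    exact (minpoly.prime_of_isIntegrallyClosed hz).irreducible
  obtain ⟨O, π, D, h⟩ := core_dv (F := F) (ψ y) hz (by rwa [hmin]) (by rwa [hmin])
  exact ⟨_, _, inferInstance, ψ, O, π, D, h⟩

set_option maxHeartbeats 1000000 in
theorem exists_dv_aux {K S E : Type u} [Field K] [CommRing S] [IsDomain S] [Algebra K S] [Algebra.FiniteType K S]
    [Field E] [Algebra S E] [Algebra K E] [IsScalarTower K S E] (hinjE : Function.Injective (algebraMap S E))
    (G : Finset S) (h : S) (hni : ¬ IsIntegral (Algebra.adjoin K (G : Set S)) h) :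
    ∃ (Q : Type u) (_ : Field Q) (_ : Algebra K Q) (ψ : S →ₐ[K] Q) 
    (O : ValuationSubring Q) (π : Q) (D : ℕ), (∀ c : K, algebraMap K Q c ∈ O) ∧
      (∀ f ∈ G, ψ f ∈ O) ∧ ψ h ∉ O ∧ O.valuation π < 1 ∧
      (∀ x, O.valuation x < 1 → O.valuation x ^ D ≤ O.valuation π) ∧
      (∀ w, w ≠ 0 → ∃ j : ℕ, O.valuation π ^ j < O.valuation w) := by
  classical
  let A := Algebra.adjoin K (G : Set S)
  let h' : E := algebraMap S E h
  have hni' : ¬ IsIntegral A h' := by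
    intro hc
    exact hni ((isIntegral_algebraMap_iff (A := S) (B := E) hinjE).1 hc)
  have hh0 : h' ≠ 0 := by
    intro h0
    rw [h0] at hni'
    exact hni' isIntegral_zero
  obtain ⟨V, hV, hhV⟩ : ∃ V : ValuationSubring E, (∀ a : A, algebraMap A E a ∈ V) ∧ h' ∉ V := by
    have : IsIntegrallyClosedIn (integralClosure A E).toSubring E :=
      inferInstanceAs (IsIntegrallyClosedIn (integralClosure A E) E)
    obtain ⟨V, hV, hx⟩ := Subring.exists_le_valuationSubring_of_isIntegrallyClosedIn
      (x := h') (R := (integralClosure A E).toSubring) hni'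
    exact ⟨V, fun a => hV (isIntegral_algebraMap), hx⟩
  let C : Subalgebra K E := Algebra.adjoin K ((G.image (algebraMap S E) ∪ {h'⁻¹} : Finset E) : Set E)
  have hCV : ∀ c ∈ C, c ∈ V := by
    intro c hc
    induction hc using Algebra.adjoin_induction with
    | mem x hx =>
      simp only [Finset.coe_union, Finset.coe_image, Finset.coe_singleton, Set.union_singleton,
        Set.mem_insert_iff, Set.mem_image] at hx
      rcases hx with rfl | ⟨f, hf, rfl⟩
      · exact (V.mem_or_inv_mem h').resolve_left hhV
      · exact hV ⟨f, Algebra.subset_adjoin hf⟩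
    | algebraMap r =>
      have := hV (algebraMap K A r)
      rwa [← IsScalarTower.algebraMap_apply] at this
    | add x y _ _ hx hy => exact V.add_mem _ _ hx hy
    | mul x y _ _ hx hy => exact V.mul_mem _ _ hx hy
  have hCft : Algebra.FiniteType K C := by
    rw [← Subalgebra.fg_iff_finiteType]
    exact ⟨_, rfl⟩
  obtain ⟨s, g, hginj, hgint⟩ := exists_integral_inj_algHom_of_fg K C
  let S' : Subalgebra S E := Algebra.adjoin S {h'⁻¹}
  have hCS : C ≤ S'.restrictScalars K := by
    apply Algebra.adjoin_le
    intro x hx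
    simp only [Finset.coe_union, Finset.coe_image, Finset.coe_singleton, Set.union_singleton,
        Set.mem_insert_iff, Set.mem_image] at hx
    rcases hx with rfl | ⟨f, hf, rfl⟩
    · exact Algebra.subset_adjoin rfl
    · exact S'.algebraMap_mem f
  let P := MvPolynomial (Fin s) K
  let ι : C →ₐ[K] S' := Subalgebra.inclusion hCS
  letI algPS : Algebra P S' := (ι.comp g).toRingHom.toAlgebra
  have hPS : ∀ a : P, algebraMap P S' a = ι (g a) := fun a => rfl
  have tw : IsScalarTower K P S' := by
    refine IsScalarTower.of_algebraMap_eq ?_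
    intro x
    rw [hPS, AlgHom.commutes, AlgHom.commutes]
  have hιinj : Function.Injective ι := Subalgebra.inclusion_injective hCS
  have htf : Module.IsTorsionFree P S' := 
    Module.isTorsionFree_iff_algebraMap_injective.2 (hιinj.comp hginj)
  have hft0 : Algebra.FiniteType S S' := by
    rw [← Subalgebra.fg_iff_finiteType]
    exact ⟨{h'⁻¹}, by simp [S']⟩
  have hft1 : Algebra.FiniteType K S' := Algebra.FiniteType.trans (S := S) inferInstance hft0
  have hft : Algebra.FiniteType P S' := Algebra.FiniteType.of_restrictScalars_finiteType K P S'
  have hint : ∀ c : C, IsIntegral P (ι c) := by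
    intro c
    obtain ⟨p, hp, hpc⟩ := hgint c
    refine ⟨p, hp, ?_⟩
    have := congrArg ι hpc
    rw [map_zero] at this
    rw [← this]
    exact (Polynomial.hom_eval₂ p g.toRingHom ι.toRingHom c).symm
  have hyC : h'⁻¹ ∈ C := Algebra.subset_adjoin (by simp)
  let y : S' := ι ⟨h'⁻¹, hyC⟩
  have hyE : (y : E) = h'⁻¹ := rfl
  have hy : IsIntegral P y := hint _
  have hy0 : y ≠ 0 := by
    intro h0
    have : (y : E) = 0 := by rw [h0]; rfl
    rw [hyE] at this
    exact hh0 (inv_eq_zero.1 this)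
  let hS : S' := algebraMap S S' h
  have hyh : y * hS = 1 := by
    apply Subtype.ext
    show h'⁻¹ * h' = 1
    exact inv_mul_cancel₀ hh0
  have hc0 : (minpoly P y).coeff 0 ≠ 0 := by
    intro hc
    have hirr : Irreducible (minpoly P y) := (minpoly.prime_of_isIntegrallyClosed hy).irreducible
    have hX := Polynomial.eq_of_monic_of_associated Polynomial.monic_X (minpoly.monic hy)
      (Polynomial.irreducible_X.associated_of_dvd hirr (Polynomial.X_dvd_iff.2 hc))
    have h1 := minpoly.aeval P y
    rw [← hX, Polynomial.aeval_X] at h1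
    exact hy0 h1
  have hcu : ¬ IsUnit ((minpoly P y).coeff 0) := by
    intro hu
    obtain ⟨u, hu⟩ := hu
    have h1 := minpoly.aeval P y
    rw [← Polynomial.divX_mul_X_add (minpoly P y)] at h1
    simp only [map_add, map_mul, Polynomial.aeval_X, Polynomial.aeval_C] at h1
    set w := Polynomial.aeval y (minpoly P y).divX with hw
    have h2 : hS = - algebraMap P S' (↑u⁻¹ : P) * w := by
      have h3 : algebraMap P S' (↑u⁻¹ : P) * algebraMap P S' ((minpoly P y).coeff 0) = 1 := by
        rw [← hu, ← map_mul, Units.inv_mul, map_one]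
      linear_combination (algebraMap P S' (↑u⁻¹ : P)) * hS * h1 - w * algebraMap P S' (↑u⁻¹ : P) * hyh - hS * h3
    have hwint : IsIntegral P w := by
      have : w ∈ Algebra.adjoin P {y} := Polynomial.aeval_mem_adjoin_singleton P y
      exact IsIntegral.of_mem_of_fg _ hy.fg_adjoin_singleton w this
    have h4 : IsIntegral P hS := by
      rw [h2]
      exact (isIntegral_algebraMap.neg).mul hwint
    apply hhV
    letI : Algebra P E := (C.val.comp g).toRingHom.toAlgebra
    refine mem_V_of_integral (R := P) V (fun a => hCV _ (g a).2) h' ?_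
    obtain ⟨p, hp, hpc⟩ := h4
    refine ⟨p, hp, ?_⟩
    have := congrArg S'.val hpc
    rw [map_zero] at this
    rw [← this]
    exact (Polynomial.hom_eval₂ p (algebraMap P S') S'.val.toRingHom hS).symm
  obtain ⟨Q, fQ, aQ, ψ, O, π, D, hO, hv, hπ, hdisc, harch⟩ := spec_dv y hy hc0 hcu
  letI : Algebra K Q := ((algebraMap P Q).comp (algebraMap K P)).toAlgebra
  have tw2 : IsScalarTower K P Q := IsScalarTower.of_algebraMap_eq (fun x => rfl)
  let ψ' : S' →ₐ[K] Q := ψ.restrictScalars K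
  let φ : S →ₐ[K] Q := ψ'.comp (IsScalarTower.toAlgHom K S S')
  have hφ : ∀ x, φ x = ψ (algebraMap S S' x) := fun x => rfl
  refine ⟨Q, fQ, inferInstance, φ, O, π, D, fun c => hO _, ?_, ?_, hπ, hdisc, harch⟩
  · intro f hf
    have hfC : algebraMap S E f ∈ C := Algebra.subset_adjoin (by
      simp only [Finset.coe_union, Finset.coe_image, Finset.coe_singleton, Set.union_singleton,
        Set.mem_insert_iff, Set.mem_image]
      exact Or.inr ⟨f, hf, rfl⟩)
    have : IsIntegral P (ι ⟨_, hfC⟩) := hint _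
    exact mem_V_of_integral (R := P) O hO _ (this.map ψ)
  · intro hmem
    have h1 : ψ y * φ h = 1 := by
      rw [hφ, ← map_mul]
      show ψ (y * hS) = 1
      rw [hyh, map_one]
    have h2 := (O.valuation_le_one_iff _).2 hmem
    have h3 : O.valuation (ψ y) * O.valuation (φ h) < 1 := by
      calc _ ≤ O.valuation (ψ y) * 1 := mul_le_mul' le_rfl h2
        _ = O.valuation (ψ y) := mul_one _
        _ < 1 := hv
    rw [← map_mul, h1, map_one] at h3
    exact lt_irrefl _ h3

theorem exists_dv {K S : Type u} [Field K] [CommRing S] [IsDomain S] [Algebra K S] [Algebra.FiniteType K S]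
    (G : Finset S) (h : S) (hni : ¬ IsIntegral (Algebra.adjoin K (G : Set S)) h) :
    ∃ (Q : Type u) (_ : Field Q) (_ : Algebra K Q) (ψ : S →ₐ[K] Q) 
    (O : ValuationSubring Q) (π : Q) (D : ℕ), (∀ c : K, algebraMap K Q c ∈ O) ∧
      (∀ f ∈ G, ψ f ∈ O) ∧ ψ h ∉ O ∧ O.valuation π < 1 ∧
      (∀ x, O.valuation x < 1 → O.valuation x ^ D ≤ O.valuation π) ∧
      (∀ w, w ≠ 0 → ∃ j : ℕ, O.valuation π ^ j < O.valuation w) := by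
  exact exists_dv_aux (E := FractionRing S) (IsFractionRing.injective S _) G h hni

theorem lin_subst_coeff {K B σ : Type*} [Field K] [CommRing B] [Algebra K B] (a : σ → B) (c : σ → K)
    (P : MvPolynomial σ K) (e : ℕ) (he : P.totalDegree ≤ e) :
    (aeval (fun i => Polynomial.C (a i) + Polynomial.C (algebraMap K B (c i)) * Polynomial.X) P : Polynomial B).natDegree ≤ e ∧
    (aeval (fun i => Polynomial.C (a i) + Polynomial.C (algebraMap K B (c i)) * Polynomial.X) P : Polynomial B).coeff e =
      algebraMap K B (eval c (homogeneousComponent e P)) := by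
  classical
  set L : σ → Polynomial B := fun i => Polynomial.C (a i) + Polynomial.C (algebraMap K B (c i)) * Polynomial.X with hL
  have hLd : ∀ i, (L i).natDegree ≤ 1 := by
    intro i
    rw [hL]
    show (Polynomial.C (a i) + Polynomial.C (algebraMap K B (c i)) * Polynomial.X).natDegree ≤ 1
    rw [add_comm]
    exact Polynomial.natDegree_linear_le
  have hLc : ∀ i, (L i).coeff 1 = algebraMap K B (c i) := by
    intro i
    simp [hL]
  have hmon : ∀ (s : σ →₀ ℕ) (S : Finset σ), (∏ i ∈ S, L i ^ s i).natDegree ≤ ∑ i ∈ S, s i ∧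
      (∏ i ∈ S, L i ^ s i).coeff (∑ i ∈ S, s i) = ∏ i ∈ S, algebraMap K B (c i) ^ s i := by
    intro s S
    induction S using Finset.induction_on with
    | empty => simp
    | insert x S hx ih =>
      rw [Finset.prod_insert hx, Finset.sum_insert hx, Finset.prod_insert hx]
      have h1 : (L x ^ s x).natDegree ≤ s x := by
        have := Polynomial.natDegree_pow_le_of_le (s x) (hLd x)
        omega
      refine ⟨Polynomial.natDegree_mul_le_of_le h1 ih.1, ?_⟩
      rw [Polynomial.coeff_mul_add_eq_of_natDegree_le h1 ih.1, ih.2]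
      have := Polynomial.coeff_pow_of_natDegree_le (m := s x) (hLd x)
      rw [mul_one, hLc] at this
      rw [this]
  have hd : ∀ s : σ →₀ ℕ, ∑ i ∈ s.support, s i = s.degree := fun s => rfl
  have hP : ∀ s ∈ P.support, s.degree ≤ e := by
    intro s hs
    exact le_trans (le_totalDegree hs) he
  have hterm : ∀ s ∈ P.support, (Polynomial.C (algebraMap K B (P.coeff s)) * ∏ i ∈ s.support, L i ^ s i).natDegree ≤ e := by
    intro s hs
    refine le_trans (Polynomial.natDegree_C_mul_le _ _) ?_
    exact ((hmon s s.support).1).trans (hP s hs)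
  have hexp : aeval L P = ∑ s ∈ P.support, Polynomial.C (algebraMap K B (P.coeff s)) * ∏ i ∈ s.support, L i ^ s i := by
    rw [aeval_def, eval₂_eq]
    rfl
  rw [hexp]
  refine ⟨Polynomial.natDegree_sum_le_of_forall_le _ _ hterm, ?_⟩
  rw [Polynomial.finset_sum_coeff, homogeneousComponent_apply, map_sum, map_sum, Finset.sum_filter]
  refine Finset.sum_congr rfl fun s hs => ?_
  rw [Polynomial.coeff_C_mul]
  split_ifs with h
  · have := (hmon s s.support).2
    rw [hd, h] at this
    rw [this, eval_monomial, Finsupp.prod, map_mul, map_prod]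
    simp
  · have h1 : s.degree < e := lt_of_le_of_ne (hP s hs) h
    rw [Polynomial.coeff_eq_zero_of_natDegree_lt, mul_zero]
    exact lt_of_le_of_lt (hmon s s.support).1 h1

theorem NN_step {K S : Type*} [Field K] [Infinite K] [CommRing S] [Algebra K S] (M : ℕ) (f : Fin (M+1) → S)
    (hdep : ¬ AlgebraicIndependent K f) :
    ∃ c : Fin M → K, ∀ i, IsIntegral (Algebra.adjoin K (Set.range fun j : Fin M => f j.castSucc - c j • f (Fin.last M))) (f i) := by
  classical
  rw [AlgebraicIndependent, injective_iff_map_eq_zero] at hdep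
  push Not at hdep
  obtain ⟨P, hP0, hP⟩ := hdep
  set e := P.totalDegree with he
  have hPe : homogeneousComponent e P ≠ 0 := by
    intro h0
    obtain ⟨s, hs, hse⟩ : ∃ s ∈ P.support, s.degree = e := by
      obtain ⟨s, hs, h⟩ := Finset.exists_mem_eq_sup P.support (by simpa using hP) (fun s => s.degree)
      exact ⟨s, hs, h.symm⟩
    have := congrArg (coeff s) h0
    rw [coeff_homogeneousComponent, if_pos hse, coeff_zero] at this
    exact (mem_support_iff.1 hs) this
  obtain ⟨c, hc⟩ : ∃ c : Fin (M+1) → K, eval c (homogeneousComponent e P * X (Fin.last M)) ≠ 0 := by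
    by_contra hcon
    push Not at hcon
    have : homogeneousComponent e P * X (Fin.last M) = 0 := by
      apply MvPolynomial.funext
      intro x
      rw [hcon x, map_zero]
    rcases mul_eq_zero.1 this with h | h
    · exact hPe h
    · exact X_ne_zero _ h
  rw [map_mul, eval_X] at hc
  have hcl : c (Fin.last M) ≠ 0 := right_ne_zero_of_mul hc
  have hce : eval c (homogeneousComponent e P) ≠ 0 := left_ne_zero_of_mul hc
  let d : Fin M → K := fun j => c j.castSucc / c (Fin.last M)
  refine ⟨d, ?_⟩
  set B := Algebra.adjoin K (Set.range fun j : Fin M => f j.castSucc - d j • f (Fin.last M)) with hB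
  let g : Fin M → B := fun j => ⟨_, Algebra.subset_adjoin ⟨j, rfl⟩⟩
  let a : Fin (M+1) → B := Fin.snoc g 0
  let y : S := (c (Fin.last M))⁻¹ • f (Fin.last M)
  have hf : ∀ i, f i = (a i : S) + c i • y := by
    intro i
    refine Fin.lastCases ?_ ?_ i
    · simp only [a, Fin.snoc_last, y, smul_smul, mul_inv_cancel₀ hcl, one_smul]
      simp
    · intro j
      simp only [a, Fin.snoc_castSucc, y, smul_smul, g, d, div_eq_mul_inv]
      simp
  obtain ⟨hd1, hd2⟩ := lin_subst_coeff a c P e le_rfl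
  set q : Polynomial B := aeval (fun i => Polynomial.C (a i) + Polynomial.C (algebraMap K B (c i)) * Polynomial.X) P with hq
  have hqy : Polynomial.aeval y q = 0 := by
    have : Polynomial.aeval y q = aeval f P := by
      rw [hq]
      have h2 := comp_aeval_apply (f := fun i => Polynomial.C (a i) + Polynomial.C (algebraMap K B (c i)) * Polynomial.X)
        ((Polynomial.aeval (R := B) y).restrictScalars K) P
      refine h2.trans ?_
      congr 2
      funext i
      rw [hf i]
      simp only [AlgHom.coe_restrictScalars', map_add, map_mul, Polynomial.aeval_C, Polynomial.aeval_X]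
      rw [Algebra.smul_def, ← IsScalarTower.algebraMap_apply]
      rfl
    rw [this, hP0]
  have hy : IsIntegral B y := by
    let w := (eval c (homogeneousComponent e P))⁻¹
    refine ⟨Polynomial.C (algebraMap K B w) * q, ?_, ?_⟩
    · refine Polynomial.monic_of_natDegree_le_of_coeff_eq_one e ?_ ?_
      · exact (Polynomial.natDegree_C_mul_le _ _).trans hd1
      · rw [Polynomial.coeff_C_mul, hd2, ← map_mul, inv_mul_cancel₀ hce, map_one]
    · show Polynomial.aeval y _ = 0
      rw [map_mul, hqy, mul_zero]
  intro i
  rw [hf i, Algebra.smul_def, IsScalarTower.algebraMap_apply K B S]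
  exact (isIntegral_algebraMap (x := a i)).add (isIntegral_algebraMap.mul hy)

theorem integral_trans_adjoin {K S : Type*} [Field K] [CommRing S] [Algebra K S] {s : Set S} {B : Subalgebra K S}
    (hs : ∀ x ∈ s, IsIntegral B x) {y : S} (hy : IsIntegral (Algebra.adjoin K s) y) : IsIntegral B y := by
  have hle : Algebra.adjoin K s ≤ (integralClosure B S).restrictScalars K := Algebra.adjoin_le hs
  obtain ⟨p, hp, hpx⟩ := hy
  let φ : Algebra.adjoin K s →+* integralClosure B S :=
    (algebraMap (Algebra.adjoin K s) S).codRestrict (integralClosure B S) (fun x => hle x.2)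
  have h2 : IsIntegral (integralClosure B S) y := by
    refine ⟨p.map φ, hp.map _, ?_⟩
    rw [Polynomial.eval₂_map]
    exact hpx
  exact isIntegral_trans (R := B) (A := integralClosure B S) y h2

theorem NN {K σ : Type*} [Field K] [Infinite K] [Fintype σ] (M : ℕ) (f : Fin M → MvPolynomial σ K) :
    ∃ r ≤ Fintype.card σ, ∃ g : Fin r → MvPolynomial σ K, (∀ i, g i ∈ Submodule.span K (Set.range f)) ∧
      ∀ i, IsIntegral (Algebra.adjoin K (Set.range g)) (f i) := by
  induction M with
  | zero => exact ⟨0, Nat.zero_le _, f, fun i => i.elim0, fun i => i.elim0⟩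
  | succ M ih =>
    by_cases hM : M + 1 ≤ Fintype.card σ
    · exact ⟨M+1, hM, f, fun i => Submodule.subset_span ⟨i, rfl⟩, fun i =>
        isIntegral_algebraMap (R := Algebra.adjoin K (Set.range f)) (x := ⟨f i, Algebra.subset_adjoin ⟨i, rfl⟩⟩)⟩
    · have hdep : ¬ AlgebraicIndependent K f := by
        intro hi
        have h1 := hi.lift_cardinalMk_le_trdeg
        rw [MvPolynomial.trdeg_of_isDomain] at h1
        simp only [Cardinal.mk_fin, Cardinal.lift_natCast, Cardinal.mk_fintype] at h1
        exact hM (by rw [← Fintype.card_fin (M+1)]; exact_mod_cast h1)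
      obtain ⟨c, hc⟩ := NN_step M f hdep
      obtain ⟨r, hr, g, hg, hgi⟩ := ih (fun j : Fin M => f j.castSucc - c j • f (Fin.last M))
      refine ⟨r, hr, g, ?_, ?_⟩
      · intro i
        refine Submodule.span_le.2 ?_ (hg i)
        rintro _ ⟨j, rfl⟩
        exact Submodule.sub_mem _ (Submodule.subset_span ⟨_, rfl⟩)
          (Submodule.smul_mem _ _ (Submodule.subset_span ⟨_, rfl⟩))
      · intro i
        refine integral_trans_adjoin ?_ (hc i)
        rintro _ ⟨j, rfl⟩
        exact hgi j

noncomputable def fT {K : Type*} [Field K] {n m : ℕ} (T : Fin m → Matrix (Fin n) (Fin n) K) :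
    MvPolynomial (Idx n m) K :=
  (bl (fun i => Matrix.of fun r c => (X (i, r, c) : MvPolynomial (Idx n m) K)) (fun i => (T i).map C)).det

theorem aeval_fT {K A : Type*} [Field K] [CommRing A] [Algebra K A] {n m : ℕ} (T : Fin m → Matrix (Fin n) (Fin n) K)
    (Y : Fin m → Matrix (Fin n) (Fin n) A) :
    aeval (coo Y) (fT T) = (bl Y (fun i => (T i).map (algebraMap K A))).det := by
  rw [fT, AlgHom.map_det]
  congr 1
  ext p q
  simp [bl, coo]

theorem fT_hom {K : Type*} [Field K] {n m : ℕ} (T : Fin m → Matrix (Fin n) (Fin n) K) :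
    (fT T).IsHomogeneous (n ^ 2) := by
  rw [fT, Matrix.det_apply]
  apply IsHomogeneous.sum
  intro σ _
  have : (∏ p : Fin n × Fin n, bl (fun i => Matrix.of fun r c => (X (i, r, c) : MvPolynomial (Idx n m) K)) (fun i => (T i).map C) (σ p) p).IsHomogeneous (∑ p : Fin n × Fin n, 1) := by
    apply IsHomogeneous.prod
    intro p _
    refine IsHomogeneous.sum Finset.univ (fun i => (X (i, (σ p).1, p.1) : MvPolynomial (Idx n m) K) * C (T i (σ p).2 p.2)) 1 ?_
    intro i _
    exact (isHomogeneous_X K _).mul (isHomogeneous_C _ _)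
  have h2 : (∑ p : Fin n × Fin n, 1) = n ^ 2 := by simp [sq]
  rw [h2] at this
  rcases Int.units_eq_one_or (Equiv.Perm.sign σ) with h | h
  · rw [h, one_smul]; exact this
  · rw [h, Units.smul_def]; simpa using this.neg

theorem coo_surj {A : Type*} {n m : ℕ} (x : Idx n m → A) :
    coo (fun i => Matrix.of fun r c => x (i, r, c)) = x := rfl

theorem fT_SInv {K : Type*} [Field K] [Infinite K] {n m : ℕ} (T : Fin m → Matrix (Fin n) (Fin n) K) :
    SInv (fT T) := by
  apply SInv_of_points
  intro a b hab t x
  rw [← coo_surj x, ← coo_row, ← coo_col, aeval_fT, aeval_fT, aeval_fT]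
  set Y : Fin m → Matrix (Fin n) (Fin n) K := fun i => Matrix.of fun r c => x (i, r, c)
  constructor
  · have := bl_mul (transvection a b t) 1 Y (fun i => (T i).map (algebraMap K K))
    simp only [mul_one, det_transvection_of_ne _ _ hab, det_one, one_pow, one_mul] at this
    exact this
  · have := bl_mul 1 (transvection b a t) Y (fun i => (T i).map (algebraMap K K))
    simp only [mul_one, det_transvection_of_ne _ _ hab.symm, det_one, one_pow, one_mul] at this
    exact this

theorem integral_over_fT {K : Type} [Field K] [Infinite K] {n m : ℕ} (hn : 0 < n) :
    ∃ r ≤ m * n ^ 2, ∃ g : Fin r → MvPolynomial (Idx n m) K, (∀ i, SInv (g i) ∧ (g i).IsHomogeneous (n ^ 2)) ∧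
      ∀ (h : MvPolynomial (Idx n m) K) (e : ℕ), SInv h → h.IsHomogeneous e →
        IsIntegral (Algebra.adjoin K (Set.range g)) h := by
  classical
  let W : Submodule K (MvPolynomial (Idx n m) K) := Submodule.span K (Set.range fT)
  have hWle : W ≤ homogeneousSubmodule (Idx n m) K (n ^ 2) := by
    apply Submodule.span_le.2
    rintro _ ⟨T, rfl⟩
    exact fT_hom T
  have hWfg : W.FG := by
    have : Module.Finite K (homogeneousSubmodule (Idx n m) K (n ^ 2)) :=
      Module.Finite.iff_fg.2 (homogeneousSubmodule_fg (Idx n m) K (n^2))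
    exact Submodule.FG.of_le (homogeneousSubmodule_fg (Idx n m) K (n^2)) hWle
  obtain ⟨G, hG⟩ := hWfg
  have hWS : ∀ f ∈ W, SInv f := by
    intro f hf
    induction hf using Submodule.span_induction with
    | mem x hx => obtain ⟨T, rfl⟩ := hx; exact fT_SInv T
    | zero => intro a b _; simp
    | add x y _ _ hx hy => intro a b hab; simp [(hx a b hab).1, (hx a b hab).2, (hy a b hab).1, (hy a b hab).2]
    | smul c x _ hx =>
      intro a b hab
      simp only [map_smul, (hx a b hab).1, (hx a b hab).2]
      simp [Polynomial.smul_C]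
  let eG := G.equivFin
  let f : Fin G.card → MvPolynomial (Idx n m) K := fun i => (eG.symm i : MvPolynomial (Idx n m) K)
  have hfr : Set.range f = G := by
    ext x
    constructor
    · rintro ⟨i, rfl⟩
      exact (eG.symm i).2
    · intro hx
      exact ⟨eG ⟨x, hx⟩, by simp [f]⟩
  obtain ⟨r, hr, g, hg, hgi⟩ := NN G.card f
  rw [hfr, hG] at hg
  refine ⟨r, ?_, g, fun i => ⟨hWS _ (hg i), hWle (hg i)⟩, ?_⟩
  · refine hr.trans (le_of_eq ?_)
    simp [sq]
  intro h e hh he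
  have hGi : ∀ x ∈ (G : Set (MvPolynomial (Idx n m) K)), IsIntegral (Algebra.adjoin K (Set.range g)) x := by
    intro x hx
    rw [← hfr] at hx
    obtain ⟨i, rfl⟩ := hx
    exact hgi i
  refine integral_trans_adjoin hGi ?_
  by_contra hni
  obtain ⟨Q, fQ, aQ, ψ, O, π, D, hK, hGO, hhO, hπ, hdisc, harch⟩ := exists_dv G h hni
  apply hhO
  have hψ : ∀ p, ψ p = aeval (coo fun i => Matrix.of fun r c => ψ (X (i, r, c))) p := by
    intro p
    conv_lhs => rw [aeval_unique ψ]
    rfl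
  rw [hψ]
  refine SSR O hK π hπ D hdisc harch hn _ ?_ h hh e he
  intro T
  rw [← aeval_fT, ← hψ]
  have hTW : fT T ∈ W := Submodule.subset_span ⟨T, rfl⟩
  rw [← hG] at hTW
  generalize fT T = x at hTW
  induction hTW using Submodule.span_induction with
  | mem x hx => exact hGO x hx
  | zero => rw [map_zero]; exact O.zero_mem
  | add x y _ _ hx hy => rw [map_add]; exact O.add_mem _ _ hx hy
  | smul c x _ hx => rw [map_smul, Algebra.smul_def]; exact O.mul_mem _ _ (hK c) hx

section top
variable {K σ : Type*} [CommRing K]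

def LowP (w : σ → ℕ) (W : ℕ) (f : MvPolynomial σ K) : Prop := ∀ u, coeff u f ≠ 0 → Finsupp.weight w u < W

def TopP (w : σ → ℕ) (f : MvPolynomial σ K) (s : σ →₀ ℕ) : Prop := LowP w (Finsupp.weight w s) (f - monomial s 1)

theorem LowP.add {w : σ → ℕ} {W : ℕ} {f g : MvPolynomial σ K} (hf : LowP w W f) (hg : LowP w W g) : LowP w W (f + g) := by
  intro u hu
  by_cases h : coeff u f = 0
  · apply hg
    intro h2
    rw [coeff_add, h, h2, add_zero] at hu
    exact hu rfl
  · exact hf u h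

theorem LowP.zero (w : σ → ℕ) (W : ℕ) : LowP w W (0 : MvPolynomial σ K) := by
  intro u hu; simp at hu

theorem LowP.sum {ι : Type*} {w : σ → ℕ} {W : ℕ} {f : ι → MvPolynomial σ K} (S : Finset ι) (hf : ∀ i ∈ S, LowP w W (f i)) :
    LowP w W (∑ i ∈ S, f i) := by
  classical
  induction S using Finset.induction_on with
  | empty => simpa using LowP.zero w W
  | insert a S ha ih =>
    rw [Finset.sum_insert ha]
    exact (hf a (by simp)).add (ih fun i hi => hf i (by simp [hi]))

theorem LowP.mul {w : σ → ℕ} {V W : ℕ} {f g : MvPolynomial σ K} (hf : LowP w V f) (hg : LowP w (W+1) g) :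
    LowP w (V + W) (f * g) := by
  classical
  intro u hu
  rw [coeff_mul] at hu
  obtain ⟨x, hx, hx2⟩ := Finset.exists_ne_zero_of_sum_ne_zero hu
  rw [Finset.HasAntidiagonal.mem_antidiagonal] at hx
  rw [← hx, map_add]
  have h1 := hf _ (left_ne_zero_of_mul hx2)
  have h2 := hg _ (right_ne_zero_of_mul hx2)
  omega

theorem LowP.mono {w : σ → ℕ} {V W : ℕ} {f : MvPolynomial σ K} (hf : LowP w V f) (h : V ≤ W) : LowP w W f :=
  fun u hu => (hf u hu).trans_le h

theorem lowP_monomial (w : σ → ℕ) (s : σ →₀ ℕ) (c : K) : LowP w (Finsupp.weight w s + 1) (monomial s c) := by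
  classical
  intro u hu
  rw [coeff_monomial] at hu
  split_ifs at hu with h
  · rw [h]; omega
  · exact absurd rfl hu

theorem TopP.le {w : σ → ℕ} {f : MvPolynomial σ K} {s : σ →₀ ℕ} (hf : TopP w f s) : LowP w (Finsupp.weight w s + 1) f := by
  have := (LowP.mono hf (Nat.le_succ _)).add (lowP_monomial w s (1 : K))
  simpa using this

theorem TopP.coeff {w : σ → ℕ} {f : MvPolynomial σ K} {s : σ →₀ ℕ} (hf : TopP w f s) : coeff s f = 1 := by
  classical
  by_contra h
  have := hf s (by rw [coeff_sub, coeff_monomial, if_pos rfl]; exact sub_ne_zero.2 h)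
  omega

theorem TopP.mul {w : σ → ℕ} {f g : MvPolynomial σ K} {s t : σ →₀ ℕ} (hf : TopP w f s) (hg : TopP w g t) :
    TopP w (f * g) (s + t) := by
  have e : f * g - monomial (s + t) 1 = (f - monomial s 1) * g + (g - monomial t 1) * monomial s 1 := by
    have : (monomial (s + t) 1 : MvPolynomial σ K) = monomial s 1 * monomial t 1 := by simp [monomial_mul]
    rw [this]; ring
  rw [TopP, e, map_add]
  refine (LowP.mul hf hg.le).add ?_
  rw [add_comm]
  exact LowP.mul hg (lowP_monomial w s 1)

theorem TopP.one (w : σ → ℕ) : TopP w (1 : MvPolynomial σ K) 0 := by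
  have : (1 : MvPolynomial σ K) - monomial 0 1 = 0 := by simp
  rw [TopP, this]
  exact LowP.zero _ _

theorem TopP.prod {ι : Type*} {w : σ → ℕ} {f : ι → MvPolynomial σ K} {s : ι → σ →₀ ℕ} (S : Finset ι)
    (hf : ∀ i ∈ S, TopP w (f i) (s i)) : TopP w (∏ i ∈ S, f i) (∑ i ∈ S, s i) := by
  classical
  induction S using Finset.induction_on with
  | empty => simpa using TopP.one w
  | insert a S ha ih =>
    rw [Finset.prod_insert ha, Finset.sum_insert ha]
    exact (hf a (by simp)).mul (ih fun i hi => hf i (by simp [hi]))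

theorem TopP.pow {w : σ → ℕ} {f : MvPolynomial σ K} {s : σ →₀ ℕ} (hf : TopP w f s) (k : ℕ) : TopP w (f ^ k) (k • s) := by
  have := TopP.prod (Finset.range k) (fun i _ => hf)
  simpa using this

end top

section tr
variable {K σ : Type*} [Field K] [Fintype σ] (p : ℕ) [hp : Fact p.Prime] [CharP K p] [PerfectRing K p]

noncomputable def cc (σ : Type*) [Fintype σ] (p : ℕ) : σ →₀ ℕ := Finsupp.equivFunOnFinite.symm fun _ => p - 1

theorem cc_apply (q : σ) : cc σ p q = p - 1 := rfl

theorem shift_inj : Function.Injective (fun s : σ →₀ ℕ => p • s + cc σ p) := by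
  intro s t h
  ext q
  have := DFunLike.congr_fun h q
  simp only [Finsupp.add_apply, Finsupp.smul_apply, smul_eq_mul, add_left_inj] at this
  exact Nat.eq_of_mul_eq_mul_left hp.out.pos this

theorem exists_Tr : ∃ Tr : MvPolynomial σ K → MvPolynomial σ K,
    ∀ f t, coeff t (Tr f) = (frobeniusEquiv K p).symm (coeff (p • t + cc σ p) f) := by
  classical
  refine ⟨fun f => ∑ t ∈ (f.support.preimage _ (shift_inj p).injOn), monomial t ((frobeniusEquiv K p).symm (coeff (p • t + cc σ p) f)), ?_⟩
  intro f t
  rw [coeff_sum]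
  simp only [coeff_monomial]
  rw [Finset.sum_ite_eq']
  split_ifs with h
  · rfl
  · simp only [Finset.mem_preimage, mem_support_iff, not_not] at h
    rw [h, map_zero]

noncomputable def Tr (f : MvPolynomial σ K) : MvPolynomial σ K := (exists_Tr p).choose f

theorem coeff_Tr (f : MvPolynomial σ K) (t) : coeff t (Tr p f) = (frobeniusEquiv K p).symm (coeff (p • t + cc σ p) f) :=
  (exists_Tr p).choose_spec f t

theorem Tr_add (f g : MvPolynomial σ K) : Tr p (f + g) = Tr p f + Tr p g := by
  ext t
  simp [coeff_Tr]

theorem Tr_zero : Tr p (0 : MvPolynomial σ K) = 0 := by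
  ext t
  simp [coeff_Tr]

theorem Tr_sum {ι : Type*} (S : Finset ι) (f : ι → MvPolynomial σ K) : Tr p (∑ i ∈ S, f i) = ∑ i ∈ S, Tr p (f i) := by
  classical
  induction S using Finset.induction_on with
  | empty => simp [Tr_zero]
  | insert a S ha ih => rw [Finset.sum_insert ha, Finset.sum_insert ha, Tr_add, ih]

theorem Tr_pow_mul (a f : MvPolynomial σ K) : Tr p (a ^ p * f) = a * Tr p f := by
  classical
  have : CharP (MvPolynomial σ K) p := inferInstance
  have : ExpChar (MvPolynomial σ K) p := ExpChar.prime hp.out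
  induction a using MvPolynomial.induction_on' with
  | add x y hx hy => rw [add_pow_expChar, add_mul, Tr_add, hx, hy, add_mul]
  | monomial u r =>
    ext t
    rw [coeff_Tr, monomial_pow, coeff_monomial_mul', coeff_monomial_mul']
    have h1 : p • u ≤ p • t + cc σ p ↔ u ≤ t := by
      constructor
      · intro h q
        have := h q
        simp only [Finsupp.add_apply, Finsupp.smul_apply, smul_eq_mul, cc_apply] at this
        by_contra hc
        push Not at hc
        have h2 : p * (t q + 1) ≤ p * u q := Nat.mul_le_mul_left _ hc
        have := hp.out.pos
        rw [mul_add, mul_one] at h2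
        omega
      · intro h q
        simp only [Finsupp.add_apply, Finsupp.smul_apply, smul_eq_mul]
        have := Nat.mul_le_mul_left p (h q)
        omega
    by_cases h : u ≤ t
    · rw [if_pos h, if_pos (h1.2 h), map_mul, coeff_Tr]
      have h3 : p • t + cc σ p - p • u = p • (t - u) + cc σ p := by
        ext q
        have := Nat.mul_le_mul_left p (h q)
        simp only [Finsupp.add_apply, Finsupp.smul_apply, smul_eq_mul, Finsupp.tsub_apply, Nat.mul_sub]
        omega
      rw [h3]
      congr 1
      rw [← frobenius_def, ← coe_frobeniusEquiv]
      exact (frobeniusEquiv K p).symm_apply_apply r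
    · rw [if_neg h, if_neg (fun h' => h (h1.1 h')), map_zero]

theorem deg_cc : (cc σ p).degree = Fintype.card σ * (p - 1) := by
  rw [Finsupp.degree_apply]
  rw [Finset.sum_subset (Finset.subset_univ _) (by intro x _ hx; simpa using hx)]
  simp [cc_apply]

theorem Tr_of_hom (f : MvPolynomial σ K) (e : ℕ) (hf : f.IsHomogeneous e) (he : e ≤ Fintype.card σ * (p - 1)) :
    Tr p f = C ((frobeniusEquiv K p).symm (coeff (cc σ p) f)) := by
  classical
  ext t
  rw [coeff_Tr, coeff_C]
  split_ifs with h
  · rw [← h, smul_zero, zero_add]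
  · by_cases hc : coeff (p • t + cc σ p) f = 0
    · rw [hc, map_zero]
    · exfalso
      have h1 : (p • t + cc σ p).degree = e := by
        by_contra hne
        exact hc (hf.coeff_eq_zero hne)
      rw [map_add, deg_cc, map_nsmul, smul_eq_mul] at h1
      have h2 : t.degree = 0 := by
        have : p * t.degree = 0 := by omega
        exact (Nat.mul_eq_zero.1 this).resolve_left hp.out.ne_zero
      exact h ((Finsupp.degree_eq_zero_iff _).1 h2).symm

/-- equivariance of the trace -/
theorem Tr_equiv (θ : MvPolynomial σ K →ₐ[K] MvPolynomial σ K) (hθ : ∀ q, (θ (X q)).IsHomogeneous 1)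
    (w : σ → ℕ) (hw : ∀ q, TopP w (θ (X q)) (Finsupp.single q 1)) (f : MvPolynomial σ K) :
    Tr p (θ f) = θ (Tr p f) := by
  classical
  have hmonθ : ∀ v : σ →₀ ℕ, θ (monomial v 1) = ∏ q, θ (X q) ^ v q := by
    intro v
    rw [monomial_eq, Finsupp.prod_fintype _ _ (by simp), C_1, one_mul, map_prod]
    simp
  have key : ∀ v : σ →₀ ℕ, v ≤ cc σ p → Tr p (θ (monomial v 1)) = θ (Tr p (monomial v 1)) := by
    intro v hv
    have hdeg : ∀ v : σ →₀ ℕ, ∑ q, v q = v.degree := by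
      intro v
      rw [Finsupp.degree_apply]
      exact (Finset.sum_subset (Finset.subset_univ _) (by intro x _ hx; simpa using hx)).symm
    have hh : (θ (monomial v 1)).IsHomogeneous (v.degree) := by
      rw [hmonθ, ← hdeg]
      refine IsHomogeneous.prod _ _ _ fun q _ => ?_
      simpa using (hθ q).pow (v q)
    have hle : v.degree ≤ Fintype.card σ * (p - 1) := by
      rw [← deg_cc, ← hdeg, ← hdeg]
      exact Finset.sum_le_sum fun q _ => hv q
    rw [Tr_of_hom p _ _ hh hle, Tr_of_hom p _ _ (isHomogeneous_monomial 1 rfl) hle]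
    have hθC : ∀ c : K, θ (C c) = C c := fun c => θ.commutes c
    rw [hθC]
    congr 2
    by_cases hvc : v = cc σ p
    · have h1 : TopP w (θ (monomial v 1)) v := by
        rw [hmonθ]
        have := TopP.prod Finset.univ (fun q _ => (hw q).pow (v q))
        convert this using 1
        ext q
        simp [Finsupp.finset_sum_apply, Finsupp.single_apply]
      rw [← hvc, h1.coeff, coeff_monomial, if_pos rfl]
    · rw [coeff_monomial, if_neg hvc]
      apply hh.coeff_eq_zero
      intro hd
      apply hvc
      rw [← hdeg, ← hdeg] at hd
      have := (Finset.sum_eq_sum_iff_of_le (fun q _ => hv q)).1 hd.symm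
      ext q
      exact this q (Finset.mem_univ q)
  induction f using MvPolynomial.induction_on' with
  | add x y hx hy => rw [map_add, Tr_add, Tr_add, map_add, hx, hy]
  | monomial s r =>
    let u : σ →₀ ℕ := Finsupp.equivFunOnFinite.symm fun q => s q / p
    let v : σ →₀ ℕ := Finsupp.equivFunOnFinite.symm fun q => s q % p
    have hs : s = p • u + v := by
      ext q
      exact (Nat.div_add_mod (s q) p).symm
    have hv : v ≤ cc σ p := by
      intro q
      have : s q % p < p := Nat.mod_lt _ hp.out.pos
      show s q % p ≤ p - 1
      omega
    have hr : ((frobeniusEquiv K p).symm r) ^ p = r := by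
      rw [← frobenius_def, ← coe_frobeniusEquiv]
      exact (frobeniusEquiv K p).apply_symm_apply r
    have e : (monomial s r : MvPolynomial σ K) = (monomial u ((frobeniusEquiv K p).symm r)) ^ p * monomial v 1 := by
      rw [monomial_pow, hr, monomial_mul, mul_one, ← hs]
    rw [e, map_mul, map_pow, Tr_pow_mul, Tr_pow_mul, key v hv, map_mul]

end tr

section dets
variable {A : Type*} [CommRing A] {N : ℕ}

theorem det_colop (M M' : Matrix (Fin N) (Fin N) A) (c : Fin N → A) (π : Fin N → Fin N)
    (h : ∀ r k, M' r k = M r k + c k * M r (π k))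
    (hπ : (∀ k, c k ≠ 0 → π k < k) ∨ (∀ k, c k ≠ 0 → k < π k)) : M'.det = M.det := by
  let U : Matrix (Fin N) (Fin N) A := 1 + Matrix.of fun i k => if i = π k then c k else 0
  have e : M' = M * U := by
    ext r k
    rw [h]
    simp only [U]
    rw [mul_add, mul_one, Matrix.add_apply, Matrix.mul_apply]
    simp [mul_comm]
  have hd : ∀ k, U k k = 1 := by
    intro k
    simp only [U, Matrix.add_apply, Matrix.one_apply_eq, Matrix.of_apply]
    split_ifs with hk
    · have : c k = 0 := by
        by_contra hc
        rcases hπ with hπ | hπ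
        · exact absurd (hπ k hc) (by rw [← hk]; exact lt_irrefl _)
        · exact absurd (hπ k hc) (by rw [← hk]; exact lt_irrefl _)
      rw [this, add_zero]
    · rw [add_zero]
  have hU : U.det = 1 := by
    rcases hπ with hπ | hπ
    · rw [Matrix.det_of_upperTriangular]
      · simp [hd]
      · intro i k hik
        simp only [id] at hik
        simp only [U, Matrix.add_apply, Matrix.one_apply_ne hik.ne', Matrix.of_apply, zero_add]
        split_ifs with hk
        · by_contra hc
          exact absurd (hπ k hc) (by rw [← hk]; exact hik.asymm)
        · rfl
    · rw [Matrix.det_of_lowerTriangular]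
      · simp [hd]
      · intro i k hik
        have hik : i < k := hik
        simp only [U, Matrix.add_apply, Matrix.one_apply_ne hik.ne, Matrix.of_apply, zero_add]
        split_ifs with hk
        · by_contra hc
          exact absurd (hπ k hc) (by rw [← hk]; exact hik.asymm)
        · rfl
  rw [e, det_mul, hU, mul_one]

theorem det_colop2 (M M' : Matrix (Fin N) (Fin N) A) (c : Fin N → A) (π : Fin N → Fin N) (k0 : Fin N)
    (t : A) (v : Fin N → A)
    (h : ∀ r k, M' r k = M r k + c k * M r (π k) + if k = k0 then t * v r else 0)
    (hπ : (∀ k, c k ≠ 0 → π k < k) ∨ (∀ k, c k ≠ 0 → k < π k)) (hk0 : v = 0 ∨ ∀ k, c k ≠ 0 → π k ≠ k0) :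
    M'.det = M.det + t * (M.updateCol k0 v).det := by
  rcases hk0 with rfl | hk0
  · rw [Matrix.det_eq_zero_of_column_eq_zero (A := M.updateCol k0 0) k0 (by intro i; simp), mul_zero, add_zero]
    refine det_colop _ _ c π ?_ hπ
    intro r k
    rw [h]; simp
  have e : M'.det = (M.updateCol k0 ((fun r => M r k0) + t • v)).det := by
    refine det_colop _ _ c π ?_ hπ
    intro r k
    rw [h]
    by_cases hc : c k = 0
    · rw [hc, zero_mul, zero_mul, add_zero, add_zero, Matrix.updateCol_apply]
      split_ifs with hk
      · simp [hk]
      · simp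
    · rw [Matrix.updateCol_apply, Matrix.updateCol_apply, if_neg (hk0 k hc)]
      split_ifs with hk
      · simp [hk]; ring
      · simp
  rw [e, det_updateCol_add, det_updateCol_smul]
  congr 2
  exact Matrix.updateCol_eq_self M k0

end dets

section topdet
variable {K σ : Type*} [CommRing K] {N : ℕ}

theorem LowP.prod {ι : Type*} {w : σ → ℕ} {f : ι → MvPolynomial σ K} {v : ι → ℕ} (S : Finset ι)
    (hf : ∀ i ∈ S, LowP w (v i + 1) (f i)) : LowP w (∑ i ∈ S, v i + 1) (∏ i ∈ S, f i) := by
  classical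
  induction S using Finset.induction_on with
  | empty => simpa using (TopP.one (K := K) w).le
  | insert a S ha ih =>
    rw [Finset.prod_insert ha, Finset.sum_insert ha]
    have := LowP.mul (hf a (by simp)) (ih fun i hi => hf i (by simp [hi]))
    exact this.mono (by omega)

theorem TopP_X (w : σ → ℕ) (q : σ) : TopP w (X q : MvPolynomial σ K) (Finsupp.single q 1) := by
  have : (X q : MvPolynomial σ K) - monomial (Finsupp.single q 1) 1 = 0 := sub_self _
  rw [TopP, this]; exact LowP.zero _ _

theorem perm_sum_lt (π : Equiv.Perm (Fin N)) (h : π ≠ 1) :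
    ∑ i, 2 * ((π i).val * i.val) < ∑ i : Fin N, 2 * (i.val * i.val) := by
  have h1 : ∑ i, (π i).val * (π i).val = ∑ i : Fin N, i.val * i.val := Equiv.sum_comp π (fun i => i.val * i.val)
  obtain ⟨i, hi⟩ : ∃ i, π i ≠ i := by
    by_contra hc
    push Not at hc
    exact h (Equiv.ext hc)
  have h2 : ∑ i, 2 * ((π i).val * i.val) < ∑ i, ((π i).val * (π i).val + i.val * i.val) := by
    apply Finset.sum_lt_sum
    · intro i _
      zify
      nlinarith [sq_nonneg (((π i).val : ℤ) - i.val)]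
    · refine ⟨i, Finset.mem_univ _, ?_⟩
      have : ((π i).val : ℤ) - i.val ≠ 0 := by
        intro h
        apply hi
        apply Fin.ext
        omega
      zify
      nlinarith [sq_pos_of_ne_zero this]
  rw [Finset.sum_add_distrib, h1] at h2
  rw [← Finset.mul_sum (s := Finset.univ) (f := fun i : Fin N => i.val * i.val)]
  omega

theorem TopP_det (w : σ → ℕ) (M : Matrix (Fin N) (Fin N) (MvPolynomial σ K)) (F G : Fin N → ℕ)
    (v : Fin N → σ) (hM : ∀ r k, LowP w (2 * (r.val * k.val) + (F r + G k) + 1) (M r k))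
    (hv : ∀ r, M r r = X (v r)) (hw : ∀ r, w (v r) = 2 * (r.val * r.val) + (F r + G r)) :
    TopP w M.det (∑ r, Finsupp.single (v r) 1) := by
  have hW : Finsupp.weight w (∑ r, Finsupp.single (v r) 1) = ∑ r : Fin N, 2 * (r.val * r.val) + ∑ r, (F r + G r) := by
    rw [map_sum, ← Finset.sum_add_distrib]
    refine Finset.sum_congr rfl fun r _ => ?_
    rw [← hw]; simp [Finsupp.weight_apply]
  have hid : (∏ r, M r r) = monomial (∑ r, Finsupp.single (v r) 1) 1 := by
    rw [monomial_sum_one]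
    exact Finset.prod_congr rfl fun r _ => hv r
  rw [TopP, hW, Matrix.det_apply, ← Finset.add_sum_erase _ _ (Finset.mem_univ (1 : Equiv.Perm (Fin N)))]
  simp only [Equiv.Perm.sign_one, one_smul, Equiv.Perm.one_apply]
  rw [hid, add_sub_cancel_left]
  apply LowP.sum
  intro π hπ
  have h1 := LowP.prod Finset.univ (fun i _ => hM (π i) i)
  have h2 := perm_sum_lt π (Finset.ne_of_mem_erase hπ)
  have h3 : ∑ i, F (π i) = ∑ i, F i := Equiv.sum_comp π F
  rw [Finset.sum_add_distrib, Finset.sum_add_distrib, h3, ← Finset.sum_add_distrib] at h1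
  have h4 : LowP w (∑ r : Fin N, 2 * (r.val * r.val) + ∑ r, (F r + G r)) (∏ i, M (π i) i) := h1.mono (by omega)
  intro u hu
  apply h4 u
  intro h0
  apply hu
  rcases Int.units_eq_one_or (Equiv.Perm.sign π) with h | h
  · rw [h, one_smul, h0]
  · rw [h, Units.neg_smul, one_smul, coeff_neg, h0, neg_zero]

theorem prod_one_change {A ι : Type*} [CommRing A] [DecidableEq ι] (S : Finset ι) (F F' : ι → A) (j0 : ι) (hj : j0 ∈ S)
    (t Q : A) (h : ∀ j ∈ S, j ≠ j0 → F' j = F j) (h0 : F' j0 = F j0 + t * Q) :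
    ∏ j ∈ S, F' j = ∏ j ∈ S, F j + t * (Q * ∏ j ∈ S.erase j0, F j) := by
  rw [← Finset.mul_prod_erase _ _ hj, ← Finset.mul_prod_erase _ _ hj, h0,
    Finset.prod_congr rfl (fun j hj => h j (Finset.mem_of_mem_erase hj) (Finset.ne_of_mem_erase hj))]
  ring

end topdet

section constr
variable (K : Type*) [CommRing K] (n s : ℕ) [NeZero n] [NeZero s]

def vr (R C : ℕ) : Idx n (2 * s) := (Fin.ofNat (2 * s) (R / n + C / n), Fin.ofNat n R, Fin.ofNat n C)

noncomputable def ZA (R C : ℕ) : MvPolynomial (Idx n (2 * s)) K :=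
  if C / n = R / n ∨ C / n = R / n + 1 then X (vr n s R C) else 0

noncomputable def AA (j : ℕ) : MvPolynomial (Idx n (2 * s)) K :=
  Matrix.det (Matrix.of fun R k : Fin (s * n) => ZA K n s R.val (j + k.val))

def sw (n m : ℕ) (q : Idx n m) : Idx n m := (q.1, q.2.2, q.2.1)

def wG (n m : ℕ) (q : Idx n m) : ℕ := 2 * ((q.2.1.val + n * q.1.val) * (q.2.2.val + n * q.1.val))

theorem wG_vr {R C : ℕ} (hR : R < s * n) (h : C / n = R / n ∨ C / n = R / n + 1) :
    wG n (2 * s) (vr n s R C) = 2 * (R * C) + ((2 * (R / n) * n * R + n * n * ((R / n) * (R / n + 1)))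
      + (2 * (C / n) * n * C + n * n * ((C / n) * (C / n - 1)))) := by
  have ht : R / n < s := Nat.div_lt_of_lt_mul (by rwa [mul_comm] at hR)
  have hi : (R / n + C / n) % (2 * s) = R / n + C / n := Nat.mod_eq_of_lt (by omega)
  have e1 := Nat.div_add_mod R n
  have e2 := Nat.div_add_mod C n
  simp only [wG, vr, Fin.val_ofNat, hi]
  generalize R / n = t at *
  generalize C / n = t' at *
  generalize R % n = r at *
  generalize C % n = c at *
  subst e1 e2
  rcases h with rfl | rfl
  · rcases t' with _ | t'
    · ring
    · simp only [Nat.add_sub_cancel]; ring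
  · simp only [Nat.add_sub_cancel]; ring

theorem diag_cond {R j : ℕ} (hj : j ≤ n) : (j + R) / n = R / n ∨ (j + R) / n = R / n + 1 := by
  have hn : 0 < n := Nat.pos_of_ne_zero (NeZero.ne n)
  have h1 : R / n ≤ (j + R) / n := Nat.div_le_div_right (by omega)
  have h2 : (j + R) / n ≤ (R + n) / n := Nat.div_le_div_right (by omega)
  rw [Nat.add_div_right _ hn] at h2
  omega

theorem LowP_ZA {R C : ℕ} (hR : R < s * n) (w : Idx n (2 * s) → ℕ) (W : ℕ)
    (hw : (C / n = R / n ∨ C / n = R / n + 1) → w (vr n s R C) = W) : LowP w (W + 1) (ZA K n s R C) := by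
  rw [ZA]
  split_ifs with h
  · have := (TopP_X (K := K) w (vr n s R C)).le
    rw [Finsupp.weight_single, smul_eq_mul, one_mul, hw h] at this
    exact this
  · exact LowP.zero _ _

theorem TopP_AA {j : ℕ} (hj : j ≤ n) : TopP (wG n (2 * s)) (AA K n s j)
    (∑ R : Fin (s * n), Finsupp.single (vr n s R.val (j + R.val)) 1) := by
  refine TopP_det _ _ (fun R => 2 * (R.val * j) + (2 * (R.val / n) * n * R.val + n * n * ((R.val / n) * (R.val / n + 1))))
    (fun k => 2 * ((j + k.val) / n) * n * (j + k.val) + n * n * (((j + k.val) / n) * ((j + k.val) / n - 1))) _ ?_ ?_ ?_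
  · intro R k
    apply LowP_ZA K n s R.2
    intro h
    rw [wG_vr n s R.2 h]; ring
  · intro R
    simp only [Matrix.of_apply, ZA]
    rw [if_pos (diag_cond n hj)]
  · intro R
    rw [wG_vr n s R.2 (diag_cond n hj)]; ring

theorem wG_sw (m : ℕ) (q : Idx n m) : wG n m (sw n m q) = wG n m q := by
  simp only [wG, sw, mul_comm]

theorem TopP_AA_sw {j : ℕ} (hj : j ≤ n) : TopP (wG n (2 * s)) (rename (sw n (2 * s)) (AA K n s j))
    (∑ R : Fin (s * n), Finsupp.single (sw n (2 * s) (vr n s R.val (j + R.val))) 1) := by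
  have e : rename (sw n (2 * s)) (AA K n s j) = Matrix.det ((rename (R := K) (sw n (2 * s))).mapMatrix
      (Matrix.of fun R k : Fin (s * n) => ZA K n s R.val (j + k.val))) := by
    rw [AA, AlgHom.map_det]
  rw [e]
  refine TopP_det _ _ (fun R => 2 * (R.val * j) + (2 * (R.val / n) * n * R.val + n * n * ((R.val / n) * (R.val / n + 1))))
    (fun k => 2 * ((j + k.val) / n) * n * (j + k.val) + n * n * (((j + k.val) / n) * ((j + k.val) / n - 1))) _ ?_ ?_ ?_
  · intro R k
    simp only [AlgHom.mapMatrix_apply, Matrix.map_apply, Matrix.of_apply, ZA]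
    split_ifs with h
    · rw [rename_X]
      have := (TopP_X (K := K) (wG n (2 * s)) (sw n (2 * s) (vr n s R (j + k)))).le
      rw [Finsupp.weight_single, smul_eq_mul, one_mul, wG_sw, wG_vr n s R.2 h] at this
      convert this using 1; ring
    · rw [map_zero]; exact LowP.zero _ _
  · intro R
    simp only [AlgHom.mapMatrix_apply, Matrix.map_apply, Matrix.of_apply, ZA]
    rw [if_pos (diag_cond n hj), rename_X]
  · intro R
    rw [wG_sw, wG_vr n s R.2 (diag_cond n hj)]; ring

theorem AA_hom (j : ℕ) : (AA K n s j).IsHomogeneous (s * n) := by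
  rw [AA, Matrix.det_apply]
  apply IsHomogeneous.sum
  intro π _
  have h : (∏ i : Fin (s * n), (Matrix.of fun R k : Fin (s * n) => ZA K n s R.val (j + k.val)) (π i) i).IsHomogeneous (s * n) := by
    have := IsHomogeneous.prod Finset.univ (fun i : Fin (s * n) => (Matrix.of fun R k : Fin (s * n) => ZA K n s R.val (j + k.val)) (π i) i)
      (fun _ => 1) (by
        intro i _
        simp only [Matrix.of_apply, ZA]
        split_ifs
        · exact isHomogeneous_X _ _
        · exact isHomogeneous_zero _ _ _)
    simpa using this
  rcases Int.units_eq_one_or (Equiv.Perm.sign π) with h' | h'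
  · rw [h', one_smul]; exact h
  · rw [h', Units.neg_smul, one_smul]; exact h.neg

noncomputable def P1 : MvPolynomial (Idx n (2 * s)) K := ∏ j ∈ Finset.range (n + 1), AA K n s j
noncomputable def P2 : MvPolynomial (Idx n (2 * s)) K := ∏ j ∈ Finset.Ico 1 n, AA K n s j
noncomputable def gG : MvPolynomial (Idx n (2 * s)) K := P1 K n s * rename (sw n (2 * s)) (P2 K n s)

noncomputable def EE : Idx n (2 * s) →₀ ℕ :=
  (∑ j ∈ Finset.range (n + 1), ∑ R : Fin (s * n), Finsupp.single (vr n s R.val (j + R.val)) 1) +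
  ∑ j ∈ Finset.Ico 1 n, ∑ R : Fin (s * n), Finsupp.single (sw n (2 * s) (vr n s R.val (j + R.val))) 1

theorem TopP_gG : TopP (wG n (2 * s)) (gG K n s) (EE n s) := by
  rw [gG, EE, P1, P2, map_prod]
  refine TopP.mul (TopP.prod _ ?_) (TopP.prod _ ?_)
  · intro j hj
    rw [Finset.mem_range] at hj
    exact TopP_AA K n s (by omega)
  · intro j hj
    rw [Finset.mem_Ico] at hj
    exact TopP_AA_sw K n s (by omega)

theorem gG_hom : (gG K n s).IsHomogeneous (Fintype.card (Idx n (2 * s))) := by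
  have hn : 0 < n := Nat.pos_of_ne_zero (NeZero.ne n)
  have h1 : (P1 K n s).IsHomogeneous ((n + 1) * (s * n)) := by
    have := IsHomogeneous.prod (Finset.range (n + 1)) (fun j => AA K n s j) (fun _ => s * n) (fun j _ => AA_hom K n s j)
    simpa [P1] using this
  have h2 : (P2 K n s).IsHomogeneous ((n - 1) * (s * n)) := by
    have := IsHomogeneous.prod (Finset.Ico 1 n) (fun j => AA K n s j) (fun _ => s * n) (fun j _ => AA_hom K n s j)
    simpa [P2] using this
  have := h1.mul (h2.rename_isHomogeneous (f := sw n (2 * s)))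
  rw [gG]
  convert this using 1
  simp only [Fintype.card_prod, Fintype.card_fin, Idx]
  rw [← add_mul]
  have : n + 1 + (n - 1) = 2 * n := by omega
  rw [this]; ring

theorem EE_ge (q : Idx n (2 * s)) : 1 ≤ EE n s q := by
  have hn : 0 < n := Nat.pos_of_ne_zero (NeZero.ne n)
  obtain ⟨i, r, c⟩ := q
  have hir : i.val < 2 * s := i.2
  have hr := r.2
  have hc := c.2
  -- reduction
  have red1 : ∀ j ≤ n, ∀ R < s * n, vr n s R (j + R) = (i, r, c) → 1 ≤ EE n s (i, r, c) := by
    intro j hj R hR h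
    rw [EE, Finsupp.add_apply, Finsupp.finset_sum_apply]
    refine le_trans ?_ (Nat.le_add_right _ _)
    refine le_trans ?_ (Finset.single_le_sum (fun _ _ => Nat.zero_le _) (Finset.mem_range.2 (Nat.lt_succ_of_le hj)))
    rw [Finsupp.finset_sum_apply]
    refine le_trans ?_ (Finset.single_le_sum (fun _ _ => Nat.zero_le _) (Finset.mem_univ (⟨R, hR⟩ : Fin (s * n))))
    simp only [h, Finsupp.single_eq_same, le_refl]
  have red2 : ∀ j, 1 ≤ j → j < n → ∀ R < s * n, sw n (2 * s) (vr n s R (j + R)) = (i, r, c) → 1 ≤ EE n s (i, r, c) := by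
    intro j hj1 hj R hR h
    rw [EE, Finsupp.add_apply, Finsupp.finset_sum_apply]
    refine le_trans ?_ (Nat.le_add_left _ _)
    rw [Finsupp.finset_sum_apply]
    refine le_trans ?_ (Finset.single_le_sum (fun _ _ => Nat.zero_le _) (Finset.mem_Ico.2 ⟨hj1, hj⟩))
    rw [Finsupp.finset_sum_apply]
    refine le_trans ?_ (Finset.single_le_sum (fun _ _ => Nat.zero_le _) (Finset.mem_univ (⟨R, hR⟩ : Fin (s * n))))
    simp only [h, Finsupp.single_eq_same, le_refl]
  have dv : ∀ t x, x < n → (n * t + x) / n = t := by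
    intro t x hx
    rw [Nat.mul_add_div hn, Nat.div_eq_of_lt hx, add_zero]
  have md : ∀ t x, x < n → (n * t + x) % n = x := by
    intro t x hx
    rw [Nat.mul_add_mod, Nat.mod_eq_of_lt hx]
  have hb : ∀ t x, t < s → x < n → n * t + x < s * n := by
    intro t x ht hx
    calc n * t + x < n * t + n := by omega
      _ = (t + 1) * n := by ring
      _ ≤ s * n := Nat.mul_le_mul_right _ ht
  have hvr : ∀ t t' x y, x < n → y < n → t + t' = i.val → vr n s (n * t + x) (n * t' + y) = (i, ⟨x % n, Nat.mod_lt _ hn⟩, ⟨y % n, Nat.mod_lt _ hn⟩) := by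
    intro t t' x y hx hy h
    simp only [vr, dv _ _ hx, dv _ _ hy]
    refine Prod.ext (Fin.ext ?_) (Prod.ext (Fin.ext ?_) (Fin.ext ?_))
    · simp [h, Nat.mod_eq_of_lt hir]
    · simp
    · simp
  rcases Nat.even_or_odd' i.val with ⟨t, ht | ht⟩
  · by_cases hrc : r.val ≤ c.val
    · refine red1 (c.val - r.val) (by omega) (n * t + r.val) (hb _ _ (by omega) hr) ?_
      rw [show c.val - r.val + (n * t + r.val) = n * t + c.val by omega, hvr _ _ _ _ hr hc (by omega)]
      simp [Nat.mod_eq_of_lt]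
    · refine red2 (r.val - c.val) (by omega) (by omega) (n * t + c.val) (hb _ _ (by omega) hc) ?_
      rw [show r.val - c.val + (n * t + c.val) = n * t + r.val by omega, hvr _ _ _ _ hc hr (by omega)]
      simp [Nat.mod_eq_of_lt, sw]
  · by_cases hrc : c.val ≤ r.val
    · refine red1 (n + c.val - r.val) (by omega) (n * t + r.val) (hb _ _ (by omega) hr) ?_
      rw [show n + c.val - r.val + (n * t + r.val) = n * (t + 1) + c.val by rw [mul_add]; omega, hvr _ _ _ _ hr hc (by omega)]
      simp [Nat.mod_eq_of_lt]
    · refine red2 (n + r.val - c.val) (by omega) (by omega) (n * t + c.val) (hb _ _ (by omega) hc) ?_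
      rw [show n + r.val - c.val + (n * t + c.val) = n * (t + 1) + r.val by rw [mul_add]; omega, hvr _ _ _ _ hc hr (by omega)]
      simp [Nat.mod_eq_of_lt, sw]

theorem EE_eq (q : Idx n (2 * s)) : EE n s q = 1 := by
  have h1 : (EE n s).degree = Fintype.card (Idx n (2 * s)) := by
    have h := gG_hom ℤ n s
    have h2 := (TopP_gG ℤ n s).coeff
    by_contra hne
    rw [h.coeff_eq_zero hne] at h2
    exact zero_ne_one h2
  have hdeg : ∑ q, EE n s q = (EE n s).degree := by
    rw [Finsupp.degree_apply]
    exact (Finset.sum_subset (Finset.subset_univ _) (by intro x _ hx; simpa using hx)).symm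
  have := (Finset.sum_eq_sum_iff_of_le (s := Finset.univ) (f := fun _ => 1) (g := fun q => EE n s q) (fun q _ => EE_ge n s q)).1 (by
    rw [hdeg, h1]; simp)
  exact (this q (Finset.mem_univ q)).symm

theorem TopP_gG_pow (p : ℕ) : TopP (wG n (2 * s)) (gG K n s ^ (p - 1)) (cc (Idx n (2 * s)) p) := by
  have := (TopP_gG K n s).pow (p - 1)
  convert this using 1
  ext q
  show p - 1 = _
  simp [EE_eq]

end constr

section ops
variable (K : Type*) [CommRing K]

noncomputable def rowOp (n m : ℕ) (a b : Fin n) (t : K) : MvPolynomial (Idx n m) K →ₐ[K] MvPolynomial (Idx n m) K :=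
  aeval (rowPt a b (C t) X)
noncomputable def colOp (n m : ℕ) (a b : Fin n) (t : K) : MvPolynomial (Idx n m) K →ₐ[K] MvPolynomial (Idx n m) K :=
  aeval (colPt a b (C t) X)

theorem row_sw (n m : ℕ) (a b : Fin n) (t : K) (f : MvPolynomial (Idx n m) K) :
    rowOp K n m a b t (rename (sw n m) f) = rename (sw n m) (colOp K n m a b t f) := by
  have : (rowOp K n m a b t).comp (rename (sw n m)) = (rename (sw n m)).comp (colOp K n m a b t) := by
    apply MvPolynomial.algHom_ext
    intro q
    simp only [AlgHom.comp_apply, rename_X, rowOp, colOp, aeval_X, rowPt, colPt, map_add, sw]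
    congr 1
    split_ifs <;> simp [sw]
  exact DFunLike.congr_fun this f

theorem col_sw (n m : ℕ) (a b : Fin n) (t : K) (f : MvPolynomial (Idx n m) K) :
    colOp K n m a b t (rename (sw n m) f) = rename (sw n m) (rowOp K n m a b t f) := by
  have : (colOp K n m a b t).comp (rename (sw n m)) = (rename (sw n m)).comp (rowOp K n m a b t) := by
    apply MvPolynomial.algHom_ext
    intro q
    simp only [AlgHom.comp_apply, rename_X, rowOp, colOp, aeval_X, rowPt, colPt, map_add, sw]
    congr 1
    split_ifs <;> simp [sw]
  exact DFunLike.congr_fun this f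

variable (n s : ℕ) [NeZero n] [NeZero s]

theorem colOp_ZA (a b : Fin n) (t : K) (R D : ℕ) : colOp K n (2 * s) a b t (ZA K n s R D) =
    ZA K n s R D + if D % n = a.val then C t * ZA K n s R (n * (D / n) + b.val) else 0 := by
  have hn : 0 < n := Nat.pos_of_ne_zero (NeZero.ne n)
  have h1 : (n * (D / n) + b.val) / n = D / n := by rw [Nat.mul_add_div hn, Nat.div_eq_of_lt b.2, add_zero]
  have h2 : Fin.ofNat n (n * (D / n) + b.val) = b := by
    apply Fin.ext
    simp [Nat.mul_add_mod, Nat.mod_eq_of_lt b.2]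
  have h3 : (Fin.ofNat n D = a) ↔ D % n = a.val := by
    rw [Fin.ext_iff]; simp
  simp only [ZA, h1]
  by_cases h : D / n = R / n ∨ D / n = R / n + 1
  · rw [if_pos h, if_pos h, colOp, aeval_X, colPt]
    simp only [vr, h1, h2, h3]
  · rw [if_neg h, if_neg h]; simp

theorem rowOp_ZA (a b : Fin n) (t : K) (R D : ℕ) : rowOp K n (2 * s) a b t (ZA K n s R D) =
    ZA K n s R D + if R % n = a.val then C t * ZA K n s (n * (R / n) + b.val) D else 0 := by
  have hn : 0 < n := Nat.pos_of_ne_zero (NeZero.ne n)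
  have h1 : (n * (R / n) + b.val) / n = R / n := by rw [Nat.mul_add_div hn, Nat.div_eq_of_lt b.2, add_zero]
  have h2 : Fin.ofNat n (n * (R / n) + b.val) = b := by
    apply Fin.ext
    simp [Nat.mul_add_mod, Nat.mod_eq_of_lt b.2]
  have h3 : (Fin.ofNat n R = a) ↔ R % n = a.val := by
    rw [Fin.ext_iff]; simp
  simp only [ZA, h1]
  by_cases h : D / n = R / n ∨ D / n = R / n + 1
  · rw [if_pos h, if_pos h, rowOp, aeval_X, rowPt]
    simp only [vr, h1, h2, h3]
  · rw [if_neg h, if_neg h]; simp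

theorem rowOp_AA (a b : Fin n) (hab : a ≠ b) (t : K) (j : ℕ) : rowOp K n (2 * s) a b t (AA K n s j) = AA K n s j := by
  have hn : 0 < n := Nat.pos_of_ne_zero (NeZero.ne n)
  have hab' : a.val ≠ b.val := fun h => hab (Fin.ext h)
  rw [AA, AlgHom.map_det, ← Matrix.det_transpose, ← Matrix.det_transpose (Matrix.of _)]
  have hb : ∀ R : Fin (s * n), n * (R.val / n) + b.val < s * n := by
    intro R
    have : R.val / n < s := Nat.div_lt_of_lt_mul (lt_of_lt_of_eq R.2 (mul_comm _ _))
    calc n * (R.val / n) + b.val < n * (R.val / n) + n := by omega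
      _ = (R.val / n + 1) * n := by ring
      _ ≤ s * n := Nat.mul_le_mul_right _ this
  refine det_colop _ _ (fun R => if R.val % n = a.val then C t else 0) (fun R => ⟨n * (R.val / n) + b.val, hb R⟩) ?_ ?_
  · intro k R
    simp only [Matrix.transpose_apply, AlgHom.mapMatrix_apply, Matrix.map_apply, Matrix.of_apply, rowOp_ZA, ite_mul, zero_mul]
  · have key : ∀ R : Fin (s * n), (if R.val % n = a.val then (C t : MvPolynomial (Idx n (2 * s)) K) else 0) ≠ 0 → R.val = n * (R.val / n) + a.val := by
      intro R h
      have h2 : R.val % n = a.val := by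
        by_contra hc
        rw [if_neg hc] at h
        exact h rfl
      rw [← h2]; exact (Nat.div_add_mod _ _).symm
    rcases lt_or_gt_of_ne hab' with h | h
    · right
      intro R hR
      have := key R hR
      rw [Fin.lt_def]; simp only; omega
    · left
      intro R hR
      have := key R hR
      rw [Fin.lt_def]; simp only; omega

/-- descending simple column operation -/
theorem colOp_AA (a b : Fin n) (hab : a.val + 1 = b.val ∨ b.val + 1 = a.val) (j : ℕ) (hj : j ≤ n) :
    ∃ Q, (j ≠ max a.val b.val → Q = 0) ∧ ∀ t : K, colOp K n (2 * s) a b t (AA K n s j) = AA K n s j + C t * Q := by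
  have hn : 0 < n := Nat.pos_of_ne_zero (NeZero.ne n)
  have hs : 0 < s := Nat.pos_of_ne_zero (NeZero.ne s)
  have ha := a.2
  have hb := b.2
  have hN : 0 < s * n := Nat.mul_pos hs hn
  have key : ∀ D, D % n = a.val → n * (D / n) + b.val + a.val = D + b.val := by
    intro D h
    have := Nat.div_add_mod D n
    omega
  rcases hab with hab | hab
  · -- the source column is the next one
    let k0 : Fin (s * n) := ⟨s * n - 1, by omega⟩
    let v : Fin (s * n) → MvPolynomial (Idx n (2 * s)) K := fun R =>
      if (j + (s * n - 1)) % n = a.val then ZA K n s R.val (j + s * n) else 0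
    refine ⟨((Matrix.of fun R k : Fin (s * n) => ZA K n s R.val (j + k.val)).updateCol k0 v).det, ?_, ?_⟩
    · intro hne
      apply Matrix.det_eq_zero_of_column_eq_zero k0
      intro R
      rw [Matrix.updateCol_self]
      refine if_neg fun h => hne ?_
      have h1 : (j + (s * n - 1) + 1) % n = (a.val + 1) % n := by rw [Nat.add_mod, h]; simp
      rw [show j + (s * n - 1) + 1 = j + s * n by omega, Nat.add_mul_mod_self_right, hab, Nat.mod_eq_of_lt hb] at h1
      rcases Nat.lt_or_ge j n with h2 | h2
      · rw [Nat.mod_eq_of_lt h2] at h1; omega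
      · rw [show j = n by omega, Nat.mod_self] at h1; omega
    · intro t
      rw [AA, AlgHom.map_det]
      refine det_colop2 _ _ (fun k => if (j + k.val) % n = a.val ∧ k.val + 1 < s * n then C t else 0)
        (fun k => if h : k.val + 1 < s * n then ⟨k.val + 1, h⟩ else k) k0 (C t) v ?_ (Or.inr ?_) ?_
      · intro R k
        simp only [AlgHom.mapMatrix_apply, Matrix.map_apply, Matrix.of_apply, colOp_ZA]
        rw [add_assoc]
        congr 1
        by_cases h1 : (j + k.val) % n = a.val
        · have hk := key _ h1
          rw [if_pos h1]
          by_cases h2 : k.val + 1 < s * n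
          · rw [if_pos ⟨h1, h2⟩, dif_pos h2, if_neg (fun h => by rw [h] at h2; simp only [k0] at h2; omega), add_zero]
            congr 2
            simp only; omega
          · have h3 : k.val = s * n - 1 := by have := k.2; omega
            rw [if_neg (fun h => h2 h.2), zero_mul, zero_add, if_pos (Fin.ext h3)]
            simp only [v]
            rw [← h3, if_pos h1]
            congr 2
            omega
        · rw [if_neg h1, if_neg (fun h => h1 h.1), zero_mul, zero_add]
          split_ifs with h
          · have h3 : k.val = s * n - 1 := by rw [h]
            simp only [v]
            rw [← h3, if_neg h1, mul_zero]
          · rfl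
      · intro k hk
        have : (j + k.val) % n = a.val ∧ k.val + 1 < s * n := by
          by_contra hc; rw [if_neg hc] at hk; exact hk rfl
        simp only [dif_pos this.2, Fin.lt_def]; omega
      · by_cases hjj : (j + (s * n - 1)) % n = a.val
        · right
          intro k hk
          have h := (by by_contra hc; rw [if_neg hc] at hk; exact hk rfl : (j + k.val) % n = a.val ∧ k.val + 1 < s * n)
          rw [dif_pos h.2]
          intro h4
          have h5 : k.val + 1 = s * n - 1 := congrArg Fin.val h4
          rw [← h5, ← add_assoc] at hjj
          have h6 : (j + k.val + 1) % n = (a.val + 1) % n := by rw [Nat.add_mod, h.1]; simp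
          rw [hab, Nat.mod_eq_of_lt hb] at h6
          omega
        · left
          funext R
          exact if_neg hjj
  · -- the source column is the previous one
    let k0 : Fin (s * n) := ⟨0, hN⟩
    let v : Fin (s * n) → MvPolynomial (Idx n (2 * s)) K := fun R =>
      if j % n = a.val then ZA K n s R.val (j - 1) else 0
    refine ⟨((Matrix.of fun R k : Fin (s * n) => ZA K n s R.val (j + k.val)).updateCol k0 v).det, ?_, ?_⟩
    · intro hne
      apply Matrix.det_eq_zero_of_column_eq_zero k0
      intro R
      rw [Matrix.updateCol_self]
      refine if_neg fun h1 => hne ?_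
      rcases Nat.lt_or_ge j n with h2 | h2
      · rw [Nat.mod_eq_of_lt h2] at h1; omega
      · rw [show j = n by omega, Nat.mod_self] at h1; omega
    · intro t
      rw [AA, AlgHom.map_det]
      refine det_colop2 _ _ (fun k => if (j + k.val) % n = a.val ∧ k.val ≠ 0 then C t else 0)
        (fun k => ⟨k.val - 1, by have := k.2; omega⟩) k0 (C t) v ?_ (Or.inl ?_) ?_
      · intro R k
        simp only [AlgHom.mapMatrix_apply, Matrix.map_apply, Matrix.of_apply, colOp_ZA]
        rw [add_assoc]
        congr 1
        by_cases h1 : (j + k.val) % n = a.val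
        · have hk := key _ h1
          rw [if_pos h1]
          by_cases h2 : k.val ≠ 0
          · rw [if_pos ⟨h1, h2⟩, if_neg (fun h => h2 (by rw [h])), add_zero]
            congr 2
            omega
          · have h3 : k.val = 0 := by omega
            rw [if_neg (fun h => h2 h.2), zero_mul, zero_add, if_pos (Fin.ext h3)]
            simp only [v]
            rw [h3, add_zero] at h1
            rw [if_pos h1]
            congr 2
            omega
        · rw [if_neg h1, if_neg (fun h => h1 h.1), zero_mul, zero_add]
          split_ifs with h
          · have h3 : k.val = 0 := by rw [h]
            rw [h3, add_zero] at h1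
            simp only [v]
            rw [if_neg h1, mul_zero]
          · rfl
      · intro k hk
        have : (j + k.val) % n = a.val ∧ k.val ≠ 0 := by
          by_contra hc; rw [if_neg hc] at hk; exact hk rfl
        simp only [Fin.lt_def]; omega
      · by_cases hjj : j % n = a.val
        · right
          intro k hk
          have h := (by by_contra hc; rw [if_neg hc] at hk; exact hk rfl : (j + k.val) % n = a.val ∧ k.val ≠ 0)
          intro h4
          have h5 : k.val - 1 = 0 := congrArg Fin.val h4
          have h7 : k.val = 1 := by omega
          have h6 : (j + 1) % n = (a.val + 1) % n := by rw [Nat.add_mod, hjj]; simp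
          rw [← h7, h.1, h7] at h6
          rcases Nat.lt_or_ge (a.val + 1) n with h2 | h2
          · rw [Nat.mod_eq_of_lt h2] at h6; omega
          · rw [show a.val + 1 = n by omega, Nat.mod_self] at h6; omega
        · left
          funext R
          exact if_neg hjj

theorem gG_ops (a b : Fin n) (hab : a.val + 1 = b.val ∨ b.val + 1 = a.val) :
    (∃ g', ∀ t : K, rowOp K n (2 * s) a b t (gG K n s) = gG K n s + C t * g') ∧
    (∃ g', ∀ t : K, colOp K n (2 * s) a b t (gG K n s) = gG K n s + C t * g') := by
  have ha := a.2
  have hb := b.2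
  have hne : a ≠ b := fun h => by rw [h] at hab; omega
  have hrow : ∀ (S : Finset ℕ) (t : K), rowOp K n (2 * s) a b t (∏ j ∈ S, AA K n s j) = ∏ j ∈ S, AA K n s j := by
    intro S t
    rw [map_prod]
    exact Finset.prod_congr rfl fun j _ => rowOp_AA K n s a b hne t j
  have hcol : ∀ S : Finset ℕ, max a.val b.val ∈ S → (∀ j ∈ S, j ≤ n) → ∃ Q, ∀ t : K,
      colOp K n (2 * s) a b t (∏ j ∈ S, AA K n s j) = ∏ j ∈ S, AA K n s j + C t * Q := by
    intro S hS hle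
    obtain ⟨Q, _, hQ⟩ := colOp_AA K n s a b hab (max a.val b.val) (hle _ hS)
    refine ⟨Q * ∏ j ∈ S.erase (max a.val b.val), AA K n s j, fun t => ?_⟩
    rw [map_prod]
    refine prod_one_change S _ _ _ hS (C t) Q ?_ (hQ t)
    intro j hj hjne
    obtain ⟨Q', h0, hQ'⟩ := colOp_AA K n s a b hab j (hle _ hj)
    rw [hQ', h0 hjne, mul_zero, add_zero]
  obtain ⟨Q1, h1⟩ := hcol (Finset.range (n + 1)) (by rw [Finset.mem_range]; omega) (by intro j hj; rw [Finset.mem_range] at hj; omega)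
  obtain ⟨Q2, h2⟩ := hcol (Finset.Ico 1 n) (by rw [Finset.mem_Ico]; omega) (by intro j hj; rw [Finset.mem_Ico] at hj; omega)
  constructor
  · refine ⟨P1 K n s * rename (sw n (2 * s)) Q2, fun t => ?_⟩
    rw [gG, map_mul, row_sw, P1, P2, hrow, h2, map_add, map_mul, rename_C]; ring
  · refine ⟨Q1 * rename (sw n (2 * s)) (P2 K n s), fun t => ?_⟩
    rw [gG, map_mul, col_sw, P1, P2, hrow, h1]; ring

end ops

section lin
variable {k : Type*} [CommRing k] {n m m' : ℕ}

noncomputable def linL (Λ : Fin m → Fin m' → k) (q : Idx n m) : MvPolynomial (Idx n m') k :=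
  ∑ i', C (Λ q.1 i') * X (i', q.2.1, q.2.2)

theorem SInv_lin (Λ : Fin m → Fin m' → k) {f : MvPolynomial (Idx n m) k} (hf : SInv f) :
    SInv (aeval (linL Λ) f) := by
  intro a b hab
  have hC : aeval (fun q : Idx n m => Polynomial.C (linL (n := n) Λ q)) f = Polynomial.C (aeval (linL Λ) f) := by
    have := MvPolynomial.aeval_algebraMap_apply (Polynomial (MvPolynomial (Idx n m') k)) (linL (n := n) Λ) f
    exact this
  have hb : ∀ Y : Idx n m' → Polynomial (MvPolynomial (Idx n m') k), aeval Y (aeval (linL (n := n) Λ) f) =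
      aeval (fun q => aeval Y (linL (n := n) Λ q)) f := fun Y => aeval_bind₁ _ _ f
  constructor
  · refine Eq.trans (hb _) (Eq.trans ?_ ((hf.row hab Polynomial.X _).trans hC))
    congr 2
    funext q
    simp only [linL, map_sum, map_mul, aeval_X, rowPt, mul_add, Finset.sum_add_distrib]
    congr 1
    · refine Finset.sum_congr rfl fun i _ => ?_
      congr 1
      exact (aeval _ : MvPolynomial (Idx n m') k →ₐ[k] _).commutes _
    · split_ifs
      · rw [Finset.mul_sum]
        refine Finset.sum_congr rfl fun i _ => ?_
        rw [mul_left_comm]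
        congr 2
        exact (aeval _ : MvPolynomial (Idx n m') k →ₐ[k] _).commutes _
      · simp
  · refine Eq.trans (hb _) (Eq.trans ?_ ((hf.col hab Polynomial.X _).trans hC))
    congr 2
    funext q
    simp only [linL, map_sum, map_mul, aeval_X, colPt, mul_add, Finset.sum_add_distrib]
    congr 1
    · refine Finset.sum_congr rfl fun i _ => ?_
      congr 1
      exact (aeval _ : MvPolynomial (Idx n m') k →ₐ[k] _).commutes _
    · split_ifs
      · rw [Finset.mul_sum]
        refine Finset.sum_congr rfl fun i _ => ?_
        rw [mul_left_comm]
        congr 2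
        exact (aeval _ : MvPolynomial (Idx n m') k →ₐ[k] _).commutes _
      · simp

theorem lin_comp (Λ : Fin m → Fin m' → k) (Λ' : Fin m' → Fin m → k) (h : ∀ i j, ∑ i', Λ i i' * Λ' i' j = if i = j then 1 else 0)
    (f : MvPolynomial (Idx n m) k) : aeval (linL Λ') (aeval (linL (n := n) Λ) f) = f := by
  have hb : aeval (linL (n := n) Λ') (aeval (linL (n := n) Λ) f) =
      aeval (fun q => aeval (linL Λ') (linL (n := n) Λ q)) f := aeval_bind₁ _ _ f
  rw [hb]
  have : (fun q => aeval (linL (n := n) Λ') (linL (n := n) Λ q)) = X := by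
    funext q
    have hc : ∀ x : k, aeval (linL (n := n) Λ') (C x) = C x := fun x => (aeval (linL (n := n) Λ')).commutes x
    simp only [linL, map_sum, map_mul, aeval_X, Finset.mul_sum]
    rw [Finset.sum_comm]
    have e : ∀ j : Fin m, (∑ i', aeval (linL (n := n) Λ') (C (Λ q.1 i')) * (C (Λ' i' j) * X (j, q.2.1, q.2.2)) : MvPolynomial (Idx n m) k)
        = if q.1 = j then (X (j, q.2.1, q.2.2) : MvPolynomial (Idx n m) k) else 0 := by
      intro j
      simp only [hc, ← mul_assoc, ← C_mul]
      rw [← Finset.sum_mul, ← map_sum, h]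
      split_ifs <;> simp
    refine (Finset.sum_congr rfl fun j _ => e j).trans ?_
    simp
  rw [this, aeval_X_left_apply]
end lin

section fp
variable {K : Type*} [Field K] [Infinite K] (p : ℕ) [hp : Fact p.Prime] [CharP K p] [PerfectRing K p] {n m : ℕ}

theorem poly_const {σ : Type*} (H : Polynomial (MvPolynomial σ K)) (q : ℕ → MvPolynomial σ K)
    (h : ∀ u : K, H.eval (C (u ^ p)) = ∑ j ∈ Finset.range p, C u ^ j * q j) (t : MvPolynomial σ K) : H.eval t = H.eval 0 := by
  have e : Polynomial.expand _ p H = ∑ j ∈ Finset.range p, Polynomial.X ^ j * Polynomial.C (q j) := by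
    apply Polynomial.eq_of_infinite_eval_eq
    apply Set.Infinite.mono (s := Set.range (C : K → MvPolynomial σ K))
    · rintro _ ⟨u, rfl⟩
      simp only [Set.mem_setOf_eq, Polynomial.expand_eval, ← C_pow, h, Polynomial.eval_finset_sum]
      simp
      exact Finset.sum_congr rfl fun x _ => mul_comm _ _
    · exact Set.infinite_range_of_injective (C_injective _ _)
  have h1 : (Polynomial.expand _ p H).natDegree < p := by
    rw [e]
    refine lt_of_le_of_lt (Polynomial.natDegree_sum_le_of_forall_le (n := p - 1) _ _ ?_) (Nat.sub_lt hp.out.pos one_pos)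
    intro j hj
    rw [Finset.mem_range] at hj
    refine (Polynomial.natDegree_mul_C_le _ _).trans ?_
    rw [Polynomial.natDegree_X_pow]; omega
  rw [Polynomial.natDegree_expand] at h1
  have h2 : H.natDegree = 0 := by
    by_contra hc
    have := Nat.le_mul_of_pos_left p (Nat.pos_of_ne_zero hc)
    omega
  rw [Polynomial.eq_C_of_natDegree_eq_zero h2]
  simp

theorem rowOp_eval (a b : Fin n) (t : K) (f : MvPolynomial (Idx n m) K) :
    rowOp K n m a b t f = (aeval (rowPt a b Polynomial.X (fun p => Polynomial.C (X p : MvPolynomial (Idx n m) K))) f).eval (C t) := by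
  have : rowOp K n m a b t = ((Polynomial.aeval (R := MvPolynomial (Idx n m) K) (C t)).restrictScalars K).comp
    (aeval (rowPt a b Polynomial.X (fun p => Polynomial.C (X p : MvPolynomial (Idx n m) K)))) := by
    apply MvPolynomial.algHom_ext
    intro q
    simp only [rowOp, aeval_X, AlgHom.comp_apply, rowPt]
    split_ifs <;> simp
    exact mul_comm _ _
  rw [this]
  simp [Polynomial.coe_aeval_eq_eval]

theorem colOp_eval (a b : Fin n) (t : K) (f : MvPolynomial (Idx n m) K) :
    colOp K n m a b t f = (aeval (colPt a b Polynomial.X (fun p => Polynomial.C (X p : MvPolynomial (Idx n m) K))) f).eval (C t) := by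
  have : colOp K n m a b t = ((Polynomial.aeval (R := MvPolynomial (Idx n m) K) (C t)).restrictScalars K).comp
    (aeval (colPt a b Polynomial.X (fun p => Polynomial.C (X p : MvPolynomial (Idx n m) K)))) := by
    apply MvPolynomial.algHom_ext
    intro q
    simp only [colOp, aeval_X, AlgHom.comp_apply, colPt]
    split_ifs <;> simp
    exact mul_comm _ _
  rw [this]
  simp [Polynomial.coe_aeval_eq_eval]

theorem Tr_row (a b : Fin n) (hab : a ≠ b) (t : K) (f : MvPolynomial (Idx n m) K) :
    Tr p (rowOp K n m a b t f) = rowOp K n m a b t (Tr p f) := by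
  refine Tr_equiv p _ ?_ (fun q => if q.2.1 = a then 1 else 0) ?_ f
  · intro q
    rw [rowOp, aeval_X, rowPt]
    refine (isHomogeneous_X _ _).add ?_
    split_ifs
    · simpa using (isHomogeneous_C _ t).mul (isHomogeneous_X K _)
    · exact isHomogeneous_zero _ _ _
  · intro q
    rw [rowOp, aeval_X, rowPt, TopP, Finsupp.weight_single, smul_eq_mul, one_mul]
    rw [show ∀ y : MvPolynomial (Idx n m) K, X q + y - monomial (Finsupp.single q 1) 1 = y from fun y => add_sub_cancel_left _ _]
    split_ifs with h
    · have := lowP_monomial (fun q : Idx n m => if q.2.1 = a then 1 else 0) (Finsupp.single (q.1, b, q.2.2) 1) t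
      rw [Finsupp.weight_single, if_neg hab.symm] at this
      rw [C_mul_X_eq_monomial]
      simpa using this
    · exact LowP.zero _ _

theorem Tr_col (a b : Fin n) (hab : a ≠ b) (t : K) (f : MvPolynomial (Idx n m) K) :
    Tr p (colOp K n m a b t f) = colOp K n m a b t (Tr p f) := by
  refine Tr_equiv p _ ?_ (fun q => if q.2.2 = a then 1 else 0) ?_ f
  · intro q
    rw [colOp, aeval_X, colPt]
    refine (isHomogeneous_X _ _).add ?_
    split_ifs
    · simpa using (isHomogeneous_C _ t).mul (isHomogeneous_X K _)
    · exact isHomogeneous_zero _ _ _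
  · intro q
    rw [colOp, aeval_X, colPt, TopP, Finsupp.weight_single, smul_eq_mul, one_mul]
    rw [show ∀ y : MvPolynomial (Idx n m) K, X q + y - monomial (Finsupp.single q 1) 1 = y from fun y => add_sub_cancel_left _ _]
    split_ifs with h
    · have := lowP_monomial (fun q : Idx n m => if q.2.2 = a then 1 else 0) (Finsupp.single (q.1, q.2.1, b) 1) t
      rw [Finsupp.weight_single, if_neg hab.symm] at this
      rw [C_mul_X_eq_monomial]
      simpa using this
    · exact LowP.zero _ _

theorem tr_key {σ : Type*} [Fintype σ] (θ : K → MvPolynomial σ K →ₐ[K] MvPolynomial σ K)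
    (hθ : ∀ t f, Tr p (θ t f) = θ t (Tr p f)) (H : MvPolynomial σ K → Polynomial (MvPolynomial σ K))
    (hH : ∀ t f, θ t f = (H f).eval (C t)) (h0 : ∀ f, θ 0 f = f)
    (g g' : MvPolynomial σ K) (hg : ∀ t, θ t g = g + C t * g') (f : MvPolynomial σ K) (hf : ∀ t, θ t f = f) (t : K) :
    θ t (Tr p (g ^ (p - 1) * f)) = Tr p (g ^ (p - 1) * f) := by
  rw [hH, poly_const p (H (Tr p (g ^ (p - 1) * f))) (fun j => Tr p (g' ^ j * g ^ (p - 1 - j) * ((p - 1).choose j : MvPolynomial σ K) * f)), ← C_0, ← hH, h0]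
  intro u
  rw [← hH, ← hθ, map_mul, map_pow, hg, hf, add_comm, add_pow, Finset.sum_mul, Tr_sum,
    Nat.sub_add_cancel hp.out.one_le]
  refine Finset.sum_congr rfl fun j _ => ?_
  rw [← Tr_pow_mul]
  congr 1
  rw [C_pow]; ring

theorem SInv_phi [NeZero n] (s : ℕ) [NeZero s] (f : MvPolynomial (Idx n (2 * s)) K) (hf : SInv f) :
    SInv (Tr p (gG K n s ^ (p - 1) * f)) := by
  apply SInv_of_simple
  intro a b hab t
  have hne : a ≠ b := fun h => by rw [h] at hab; omega
  obtain ⟨⟨g1, h1⟩, ⟨g2, h2⟩⟩ := gG_ops K n s a b hab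
  constructor
  · refine tr_key p (rowOp K n (2 * s) a b) (Tr_row p a b hne) _ (rowOp_eval a b) ?_ _ g1 h1 f ?_ t
    · intro f
      rw [rowOp]
      have : rowPt a b (C (0 : K)) (X : Idx n (2 * s) → MvPolynomial (Idx n (2 * s)) K) = X := by
        funext q; simp [rowPt]
      rw [this, aeval_X_left_apply]
    · intro t
      rw [rowOp, hf.row hne, aeval_X_left_apply]
  · refine tr_key p (colOp K n (2 * s) a b) (Tr_col p a b hne) _ (colOp_eval a b) ?_ _ g2 h2 f ?_ t
    · intro f
      rw [colOp]
      have : colPt a b (C (0 : K)) (X : Idx n (2 * s) → MvPolynomial (Idx n (2 * s)) K) = X := by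
        funext q; simp [colPt]
      rw [this, aeval_X_left_apply]
    · intro t
      rw [colOp, hf.col hne, aeval_X_left_apply]

theorem Tr_sigma [NeZero n] (s : ℕ) [NeZero s] : Tr p (gG K n s ^ (p - 1)) = 1 := by
  rw [Tr_of_hom p _ _ ((gG_hom K n s).pow (p - 1)) (by rw [mul_comm]), (TopP_gG_pow K n s p).coeff, map_one, C_1]

theorem Fpure1 (hn : 0 < n) (hm : 0 < m) {ι : Type*} (S : Finset ι) (h : MvPolynomial (Idx n m) K)
    (f b : ι → MvPolynomial (Idx n m) K) (hb : ∀ i ∈ S, SInv (b i)) (e : h ^ p = ∑ i ∈ S, f i ^ p * b i) :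
    ∃ b' : ι → MvPolynomial (Idx n m) K, (∀ i ∈ S, SInv (b' i)) ∧ h = ∑ i ∈ S, f i * b' i := by
  haveI : NeZero n := ⟨hn.ne'⟩
  haveI : NeZero m := ⟨hm.ne'⟩
  let Λ : Fin m → Fin (2 * m) → K := fun i j => if j.val = 2 * i.val then 1 else 0
  let Λ' : Fin (2 * m) → Fin m → K := fun j i => if j.val = 2 * i.val then 1 else 0
  have hΛ : ∀ i j, ∑ i', Λ i i' * Λ' i' j = if i = j then 1 else 0 := by
    intro i j
    rw [Finset.sum_eq_single (⟨2 * i.val, by have := i.2; omega⟩ : Fin (2 * m))]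
    · simp only [Λ, Λ', if_true, one_mul]
      congr 1
      rw [Fin.ext_iff]
      apply propext
      omega
    · intro b _ hb
      simp only [Λ]
      rw [if_neg, zero_mul]
      exact fun h => hb (Fin.ext h)
    · simp
  let A := aeval (R := K) (linL (n := n) Λ)
  let B := aeval (R := K) (linL (n := n) Λ')
  have hAB : ∀ f, B (A f) = f := lin_comp Λ Λ' hΛ
  refine ⟨fun i => B (Tr p (gG K n m ^ (p - 1) * A (b i))), fun i hi => SInv_lin _ (SInv_phi p m _ (SInv_lin _ (hb i hi))), ?_⟩
  have e1 := congrArg (fun x => B (Tr p (gG K n m ^ (p - 1) * A x))) e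
  simp only [map_sum, map_mul, map_pow, Finset.mul_sum, Tr_sum] at e1
  rw [mul_comm (gG K n m ^ (p - 1)) (A h ^ p), Tr_pow_mul, Tr_sigma, mul_one, hAB] at e1
  rw [e1]
  refine Finset.sum_congr rfl fun i _ => ?_
  rw [mul_left_comm, Tr_pow_mul, map_mul, hAB]

theorem Fpure (hn : 0 < n) (hm : 0 < m) {ι : Type*} (S : Finset ι) (h : MvPolynomial (Idx n m) K)
    (f : ι → MvPolynomial (Idx n m) K) (k : ℕ) (b : ι → MvPolynomial (Idx n m) K) (hb : ∀ i ∈ S, SInv (b i))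
    (e : h ^ (p ^ k) = ∑ i ∈ S, f i ^ (p ^ k) * b i) :
    ∃ b' : ι → MvPolynomial (Idx n m) K, (∀ i ∈ S, SInv (b' i)) ∧ h = ∑ i ∈ S, f i * b' i := by
  induction k generalizing b with
  | zero => exact ⟨b, hb, by simpa using e⟩
  | succ k ih =>
    simp only [pow_succ, pow_mul] at e
    obtain ⟨b', hb', e'⟩ := Fpure1 p hn hm S (h ^ (p ^ k)) (fun i => f i ^ (p ^ k)) b hb e
    exact ih b' hb' e'

end fp

section sia
variable {k : Type*} [CommRing k] {n m : ℕ}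

theorem SInv.zero : SInv (0 : MvPolynomial (Idx n m) k) := fun a b _ => by simp
theorem SInv.one : SInv (1 : MvPolynomial (Idx n m) k) := fun a b _ => by simp
theorem SInv.add {f g : MvPolynomial (Idx n m) k} (hf : SInv f) (hg : SInv g) : SInv (f + g) := fun a b hab => by
  simp only [map_add, (hf a b hab).1, (hf a b hab).2, (hg a b hab).1, (hg a b hab).2, and_self]
theorem SInv.mul {f g : MvPolynomial (Idx n m) k} (hf : SInv f) (hg : SInv g) : SInv (f * g) := fun a b hab => by
  simp only [map_mul, (hf a b hab).1, (hf a b hab).2, (hg a b hab).1, (hg a b hab).2, and_self]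
theorem SInv.C (c : k) : SInv (C c : MvPolynomial (Idx n m) k) := fun a b _ => by
  constructor <;>
  exact (aeval _ : MvPolynomial (Idx n m) k →ₐ[k] _).commutes c

def SIA (k : Type*) [CommRing k] (n m : ℕ) : Subalgebra k (MvPolynomial (Idx n m) k) where
  carrier := {f | SInv f}
  mul_mem' := SInv.mul
  add_mem' := SInv.add
  algebraMap_mem' := SInv.C

theorem mem_SIA {f : MvPolynomial (Idx n m) k} : f ∈ SIA k n m ↔ SInv f := Iff.rfl
end sia

section comp
variable {k σ : Type*} [CommRing k]

theorem hc_hom {f : MvPolynomial σ k} {d : ℕ} (hf : f.IsHomogeneous d) (e : ℕ) :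
    homogeneousComponent e f = if e = d then f else 0 := homogeneousComponent_of_mem hf

theorem hc_alg (θ : MvPolynomial σ k →ₐ[k] MvPolynomial σ k) (hθ : ∀ q, (θ (X q)).IsHomogeneous 1) (d : ℕ)
    (f : MvPolynomial σ k) : homogeneousComponent d (θ f) = θ (homogeneousComponent d f) := by
  have h : ∀ i, (θ (homogeneousComponent i f)).IsHomogeneous i := by
    intro i
    have e : θ = aeval (fun q => θ (X q)) := (MvPolynomial.aeval_unique θ)
    rw [e]
    simpa using (homogeneousComponent_isHomogeneous i f).aeval (fun q => θ (X q)) hθ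
  conv_lhs => rw [← sum_homogeneousComponent f]
  rw [map_sum, map_sum]
  simp only [hc_hom (h _)]
  rw [Finset.sum_ite_eq]
  split_ifs with hd
  · rfl
  · rw [Finset.mem_range, not_lt] at hd
    rw [homogeneousComponent_eq_zero _ _ (by omega), map_zero]

theorem hc_mul {g : MvPolynomial σ k} {d : ℕ} (hg : g.IsHomogeneous d) (e : ℕ) (f : MvPolynomial σ k) :
    homogeneousComponent (d + e) (g * f) = g * homogeneousComponent e f := by
  have h : ∀ i, (g * homogeneousComponent i f).IsHomogeneous (d + i) := fun i => hg.mul (homogeneousComponent_isHomogeneous i f)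
  conv_lhs => rw [← sum_homogeneousComponent f]
  rw [Finset.mul_sum, map_sum]
  simp only [hc_hom (h _), add_right_inj]
  rw [Finset.sum_ite_eq]
  split_ifs with hd
  · rfl
  · rw [Finset.mem_range, not_lt] at hd
    rw [homogeneousComponent_eq_zero _ _ (by omega), mul_zero]
end comp

section fin
variable {K : Type*} [Field K] [Infinite K] {n m : ℕ}

theorem SInv.hc {f : MvPolynomial (Idx n m) K} (hf : SInv f) (d : ℕ) : SInv (homogeneousComponent d f) := by
  apply SInv_of_simple
  intro a b hab t
  have hne : a ≠ b := fun h => by rw [h] at hab; omega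
  constructor
  · rw [← hc_alg]
    · rw [hf.row hne, aeval_X_left_apply]
    · intro q
      rw [aeval_X, rowPt]
      refine (isHomogeneous_X _ _).add ?_
      split_ifs
      · simpa using (isHomogeneous_C _ t).mul (isHomogeneous_X K _)
      · exact isHomogeneous_zero _ _ _
  · rw [← hc_alg]
    · rw [hf.col hne, aeval_X_left_apply]
    · intro q
      rw [aeval_X, colPt]
      refine (isHomogeneous_X _ _).add ?_
      split_ifs
      · simpa using (isHomogeneous_C _ t).mul (isHomogeneous_X K _)
      · exact isHomogeneous_zero _ _ _
end fin

theorem arith_aux (q N e r n2 j : ℕ) (hq : N * e + 1 < q) (hj : j < N) (he : r * n2 < e) (a : ℕ) (ha : a ≤ r * (q - 1))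
    (h : a * n2 + j * e = q * e) : False := by
  obtain ⟨q, rfl⟩ : ∃ q', q = q' + 1 := ⟨q - 1, by omega⟩
  obtain ⟨e, rfl⟩ : ∃ e', e = e' + 1 := ⟨e - 1, by omega⟩
  simp only [Nat.add_sub_cancel] at ha
  have h1 : a * n2 ≤ r * q * n2 := Nat.mul_le_mul_right _ ha
  have h2 : r * n2 * q ≤ e * q := Nat.mul_le_mul_right _ (by omega)
  have h3 : j * (e + 1) ≤ N * (e + 1) := Nat.mul_le_mul_right _ (by omega)
  nlinarith

theorem charp_main (K : Type) [Field K] [IsAlgClosed K] (p : ℕ) [hp : Fact p.Prime] [CharP K p] (n m : ℕ) (hn : 0 < n) (hm : 0 < m) :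
    ∀ (e : ℕ) (h : MvPolynomial (Idx n m) K), SInv h → h.IsHomogeneous e →
      h ∈ Algebra.adjoin K {f : MvPolynomial (Idx n m) K | SInv f ∧ ∃ d ≤ m * n ^ 4, f.IsHomogeneous d} := by
  haveI : Infinite K := IsAlgClosed.instInfinite
  haveI : ExpChar K p := ExpChar.prime hp.out
  haveI : PerfectField K := inferInstance
  haveI : PerfectRing K p := inferInstance
  obtain ⟨r, hr, g, hg, hint⟩ := integral_over_fT (K := K) (m := m) hn
  have hn2 : n ^ 2 ≤ m * n ^ 4 := by
    calc n ^ 2 ≤ n ^ 4 := Nat.pow_le_pow_right hn (by norm_num)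
      _ ≤ m * n ^ 4 := Nat.le_mul_of_pos_left _ hm
  have hrn : r * n ^ 2 ≤ m * n ^ 4 := by
    calc r * n ^ 2 ≤ m * n ^ 2 * n ^ 2 := Nat.mul_le_mul_right _ hr
      _ = m * n ^ 4 := by ring
  intro e
  induction e using Nat.strong_induction_on with
  | _ e ih =>
  intro h hh hhe
  rcases Nat.lt_or_ge (m * n ^ 4) e with he | he
  swap
  · exact Algebra.subset_adjoin ⟨hh, e, he, hhe⟩
  obtain ⟨P, hP, hPe⟩ := hint h e hh hhe
  have hP1 : P ≠ 1 := by
    rintro rfl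
    simp at hPe
  set N := P.natDegree with hN
  obtain ⟨k, hk⟩ : ∃ k, N * e + 1 < p ^ k := ⟨N * e + 1, Nat.lt_pow_self hp.out.one_lt⟩
  set q := p ^ k with hq
  let J : AddSubmonoid (MvPolynomial (Idx n m) K) :=
    { carrier := {x | ∃ b : Fin r → MvPolynomial (Idx n m) K, (∀ i, SInv (b i)) ∧ x = ∑ i, g i ^ q * b i}
      zero_mem' := ⟨fun _ => 0, fun _ => SInv.zero, by simp⟩
      add_mem' := by
        rintro _ _ ⟨b, hb, rfl⟩ ⟨c, hc, rfl⟩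
        exact ⟨fun i => b i + c i, fun i => (hb i).add (hc i), by simp only [mul_add, Finset.sum_add_distrib]⟩ }
  have hJ : ∀ i b, SInv b → g i ^ q * b ∈ J := by
    intro i b hb
    refine ⟨fun i' => if i' = i then b else 0, fun i' => ?_, ?_⟩
    · simp only; split_ifs
      · exact hb
      · exact SInv.zero
    · simp
  -- monomials
  have hmon : ∀ (α : Fin r →₀ ℕ) (c : K) (j : ℕ), j < N →
      homogeneousComponent (q * e) (aeval g (monomial α c) * h ^ j) ∈ J := by
    intro α c j hj
    have e1 : aeval g (monomial α c) = C c * ∏ i, g i ^ α i := by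
      rw [aeval_monomial, Finsupp.prod_fintype _ _ (by simp)]; rfl
    have hh1 : (∏ i, g i ^ α i).IsHomogeneous ((∑ i, α i) * n ^ 2) := by
      rw [Finset.sum_mul]
      refine IsHomogeneous.prod _ _ _ fun i _ => ?_
      rw [mul_comm]
      exact (hg i).2.pow _
    have hh2 : (aeval g (monomial α c) * h ^ j).IsHomogeneous ((∑ i, α i) * n ^ 2 + j * e) := by
      rw [e1]
      have := ((isHomogeneous_C _ c).mul hh1).mul (hhe.pow j)
      rwa [zero_add, mul_comm e j] at this
    rw [hc_hom hh2]
    split_ifs with hd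
    · obtain ⟨i, hi⟩ : ∃ i, q ≤ α i := by
        by_contra hc
        push Not at hc
        have h1 : ∑ i, α i ≤ r * (q - 1) := by
          calc ∑ i, α i ≤ ∑ i : Fin r, (q - 1) := Finset.sum_le_sum fun i _ => by have := hc i; omega
            _ = r * (q - 1) := by simp
        exact arith_aux q N e r (n ^ 2) j hk hj (by omega) _ h1 hd.symm
      have e2 : aeval g (monomial α c) * h ^ j = g i ^ q * (C c * (g i ^ (α i - q) * ∏ i' ∈ Finset.univ.erase i, g i' ^ α i') * h ^ j) := by
        rw [e1, ← Finset.mul_prod_erase _ _ (Finset.mem_univ i)]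
        have : g i ^ α i = g i ^ q * g i ^ (α i - q) := by rw [← pow_add]; congr 1; omega
        rw [this]; ring
      rw [e2]
      apply hJ
      rw [← mem_SIA]
      exact mul_mem (mul_mem (SInv.C c) (mul_mem (pow_mem (mem_SIA.2 (hg i).1) _) (prod_mem fun i' _ => pow_mem (mem_SIA.2 (hg i').1) _))) (pow_mem (mem_SIA.2 hh) _)
    · exact J.zero_mem
  have hhq : h ^ q ∈ J := by
    have e1 : (Polynomial.X ^ q %ₘ P).eval₂ (algebraMap _ _) h = h ^ q := by
      have := congrArg (Polynomial.eval₂ (algebraMap (Algebra.adjoin K (Set.range g)) (MvPolynomial (Idx n m) K)) h) (Polynomial.modByMonic_add_div (Polynomial.X ^ q) P)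
      rw [Polynomial.eval₂_add, Polynomial.eval₂_mul, hPe, zero_mul, add_zero, Polynomial.eval₂_X_pow] at this
      exact this
    rw [Polynomial.eval₂_eq_sum_range' _ (Polynomial.natDegree_modByMonic_lt _ hP hP1)] at e1
    have e2 : h ^ q = homogeneousComponent (q * e) (h ^ q) := by
      have := hhe.pow q
      rw [mul_comm] at this
      rw [hc_hom this, if_pos rfl]
    rw [e2, ← e1, map_sum]
    refine sum_mem fun j hj => ?_
    have hj := Finset.mem_range.1 hj
    generalize (Polynomial.X ^ q %ₘ P).coeff j = b
    obtain ⟨β, hβ⟩ : ∃ β : MvPolynomial (Fin r) K, aeval g β = b.1 := by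
      have h1 : ∀ x, x ∈ Algebra.adjoin K (Set.range g) → ∃ β : MvPolynomial (Fin r) K, aeval g β = x := by
        intro x hx
        rw [Algebra.adjoin_range_eq_range_aeval] at hx
        exact hx
      exact h1 b.1 b.2
    show homogeneousComponent (q * e) (b.1 * h ^ j) ∈ J
    rw [← hβ, β.as_sum, map_sum, Finset.sum_mul, map_sum]
    exact sum_mem fun α _ => hmon α _ j hj
  obtain ⟨b, hb, hbe⟩ := hhq
  obtain ⟨b', hb', hb'e⟩ := Fpure p hn hm Finset.univ h g k b (fun i _ => hb i) hbe
  have e3 : h = ∑ i, g i * homogeneousComponent (e - n ^ 2) (b' i) := by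
    have := congrArg (homogeneousComponent e) hb'e
    rw [hc_hom hhe, if_pos rfl, map_sum] at this
    rw [this]
    refine Finset.sum_congr rfl fun i _ => ?_
    rw [← hc_mul (hg i).2]
    congr 2
    omega
  rw [e3]
  refine sum_mem fun i hi => mul_mem (Algebra.subset_adjoin ⟨(hg i).1, n ^ 2, hn2, (hg i).2⟩) ?_
  exact ih (e - n ^ 2) (Nat.sub_lt (by omega) (pow_pos hn 2)) _ ((hb' i hi).hc _) (homogeneousComponent_isHomogeneous _ _)

theorem lin_uniform {I J : Type} [Fintype I] [DecidableEq I] (M : J → I → ℤ) :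
    ∃ (Δ : ℤ) (Q : I → I → ℤ), Δ ≠ 0 ∧ (∀ j i, ∑ l, M j l * Q l i = 0) ∧
      ∀ (F : Type) [Field F], ∀ x : I → F, (∀ j, ∑ l, (M j l : F) * x l = 0) →
        ∀ l, (Δ : F) * x l = ∑ i, (Q l i : F) * x i := by
  classical
  let r : J → I → ℚ := fun j l => (M j l : ℚ)
  obtain ⟨T0, hT0, hT1⟩ := Submodule.fg_span_iff_fg_span_finset_subset (R := ℚ) (Set.range r) |>.1
    (IsNoetherian.noetherian _)
  have hc : ∀ t : T0, ∃ j, r j = t.1 := fun t => hT0 t.2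
  choose jj hjj using hc
  let f : (I → ℚ) →ₗ[ℚ] (T0 → ℚ) := LinearMap.pi fun t =>
    ∑ l, (M (jj t) l : ℚ) • (LinearMap.proj l : (I → ℚ) →ₗ[ℚ] ℚ)
  have hf : ∀ x t, f x t = ∑ l, (M (jj t) l : ℚ) * x l := fun x t => by
    simp [f]
  obtain ⟨g0, hg0⟩ := f.rangeRestrict.exists_rightInverse_of_surjective f.range_rangeRestrict
  obtain ⟨g, hg⟩ := LinearMap.exists_extend g0
  have hfg : ∀ x, f (g (f x)) = f x := by
    intro x
    have h1 : g (f x) = g0 (f.rangeRestrict x) := by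
      rw [← hg]; rfl
    rw [h1]
    have h2 := LinearMap.congr_fun hg0 (f.rangeRestrict x)
    exact congrArg Subtype.val h2
  let G : I × T0 → ℚ := fun q => g (Pi.single q.2 1) q.1
  have hG : ∀ y l, g y l = ∑ t, G (l, t) * y t := by
    intro y l
    conv_lhs => rw [LinearMap.pi_apply_eq_sum_univ g y]
    simp only [Finset.sum_apply, Pi.smul_apply, smul_eq_mul, G]
    refine Finset.sum_congr rfl fun t _ => ?_
    rw [mul_comm]
    congr 1
    refine congrArg (fun z => g z l) ?_
    funext s
    simp [Pi.single_apply, eq_comm]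
  obtain ⟨⟨Δ, hΔ⟩, hΔ2⟩ := IsLocalization.exist_integer_multiples_of_finite (nonZeroDivisors ℤ) G
  choose H hH using hΔ2
  have hH' : ∀ q, (H q : ℚ) = Δ * G q := fun q => by
    have := hH q
    simpa using this
  refine ⟨Δ, fun l i => (if l = i then Δ else 0) - ∑ t, H (l, t) * M (jj t) i, ?_, ?_, ?_⟩
  · exact nonZeroDivisors.ne_zero hΔ
  · have key : ∀ i, ∀ y ∈ Submodule.span ℚ (Set.range r),
        ∑ l, y l * ((if l = i then (Δ : ℚ) else 0) - ∑ t, (H (l, t) : ℚ) * M (jj t) i) = 0 := by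
      intro i y hy
      rw [hT1] at hy
      induction hy using Submodule.span_induction with
      | mem y hy =>
        have := hjj ⟨y, hy⟩
        simp only at this
        rw [← this]
        have e := congrFun (hfg (Pi.single i 1)) ⟨y, hy⟩
        rw [hf, hf] at e
        simp only [hG, hf] at e
        simp only [r, mul_sub, Finset.sum_sub_distrib, hH']
        simp only [Pi.single_apply, mul_ite, mul_one, mul_zero, Finset.sum_ite_eq', Finset.mem_univ, if_true] at e ⊢
        rw [← e, sub_eq_zero, Finset.sum_mul]
        refine Finset.sum_congr rfl fun l _ => ?_
        rw [mul_assoc, Finset.sum_mul]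
        congr 1
        refine Finset.sum_congr rfl fun l _ => by ring
      | zero => simp
      | add y z _ _ hy hz => simp only [Pi.add_apply, add_mul, Finset.sum_add_distrib, hy, hz, add_zero]
      | smul c y _ hy =>
        simp only [Pi.smul_apply, smul_eq_mul, mul_assoc]
        rw [← Finset.mul_sum, hy, mul_zero]
    intro j i
    have := key i (r j) (Submodule.subset_span ⟨j, rfl⟩)
    have h2 : ((∑ l, M j l * ((if l = i then Δ else 0) - ∑ t, H (l, t) * M (jj t) i) : ℤ) : ℚ) = 0 := by
      rw [← this]; push_cast; rfl
    exact_mod_cast h2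
  · intro F _ x hx l
    push_cast
    simp only [sub_mul, Finset.sum_sub_distrib]
    have : ∑ i, (∑ t, (H (l, t) : F) * M (jj t) i) * x i = 0 := by
      simp only [Finset.sum_mul]
      rw [Finset.sum_comm]
      refine Finset.sum_eq_zero fun t _ => ?_
      simp only [mul_assoc]
      rw [← Finset.mul_sum, hx, mul_zero]
    rw [this]
    simp

section ell
variable {n m : ℕ}

noncomputable def PhiB (k : Type*) [CommRing k] (s : Bool) (a b : Fin n) :
    MvPolynomial (Idx n m) k →ₐ[k] Polynomial (MvPolynomial (Idx n m) k) :=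
  aeval (if s then rowPt a b Polynomial.X (fun p => Polynomial.C (X p : MvPolynomial (Idx n m) k))
    else colPt a b Polynomial.X (fun p => Polynomial.C (X p : MvPolynomial (Idx n m) k)))

theorem PhiB_map {k l : Type*} [CommRing k] [CommRing l] (φ : k →+* l) (s : Bool) (a b : Fin n)
    (f : MvPolynomial (Idx n m) k) :
    PhiB l s a b (map φ f) = Polynomial.map (map φ) (PhiB k s a b f) := by
  have : (PhiB (n := n) (m := m) l s a b).toRingHom.comp (map φ) =
      (Polynomial.mapRingHom (map φ)).comp (PhiB (n := n) (m := m) k s a b).toRingHom := by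
    refine MvPolynomial.ringHom_ext ?_ ?_
    · intro r
      have h1 : PhiB (n := n) (m := m) l s a b (C (φ r)) = Polynomial.C (C (φ r)) :=
        (PhiB (n := n) (m := m) l s a b).commutes (φ r)
      have h2 : PhiB (n := n) (m := m) k s a b (C r) = Polynomial.C (C r) :=
        (PhiB (n := n) (m := m) k s a b).commutes r
      simp [h1, h2]
    · intro p
      cases s
      · simp [PhiB, colPt]; split_ifs <;> simp
      · simp [PhiB, rowPt]; split_ifs <;> simp
  exact RingHom.congr_fun this f

theorem SInv_iff_Phi {k : Type*} [CommRing k] (f : MvPolynomial (Idx n m) k) :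
    SInv f ↔ ∀ s (a b : Fin n), a ≠ b → PhiB k s a b f = Polynomial.C f := by
  constructor
  · intro h s a b hab
    cases s
    · simpa [PhiB] using (h a b hab).2
    · simpa [PhiB] using (h a b hab).1
  · intro h a b hab
    exact ⟨by simpa [PhiB] using h true a b hab, by simpa [PhiB] using h false a b hab⟩

theorem SInv.map {k l : Type*} [CommRing k] [CommRing l] (φ : k →+* l) {f : MvPolynomial (Idx n m) k}
    (hf : SInv f) : SInv (MvPolynomial.map φ f) := by
  rw [SInv_iff_Phi] at hf ⊢
  intro s a b hab
  rw [PhiB_map, hf s a b hab, Polynomial.map_C]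

abbrev JJ (n m : ℕ) := Bool × {ab : Fin n × Fin n // ab.1 ≠ ab.2} × ℕ × (Idx n m →₀ ℕ)

noncomputable def ell (k : Type*) [CommRing k] (j : JJ n m) : MvPolynomial (Idx n m) k →+ k where
  toFun f := coeff j.2.2.2 ((PhiB k j.1 j.2.1.1.1 j.2.1.1.2 f).coeff j.2.2.1) -
    coeff j.2.2.2 ((Polynomial.C f).coeff j.2.2.1)
  map_zero' := by simp
  map_add' f g := by simp only [map_add, Polynomial.coeff_add, coeff_add]; ring

theorem ell_map {k l : Type*} [CommRing k] [CommRing l] (φ : k →+* l) (j : JJ n m)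
    (f : MvPolynomial (Idx n m) k) : ell l j (map φ f) = φ (ell k j f) := by
  simp only [ell, AddMonoidHom.coe_mk, ZeroHom.coe_mk, PhiB_map, Polynomial.coeff_map, coeff_map, map_sub]
  rw [← Polynomial.map_C, Polynomial.coeff_map, coeff_map]

theorem ell_C_mul {k : Type*} [CommRing k] (j : JJ n m) (c : k)
    (f : MvPolynomial (Idx n m) k) : ell k j (C c * f) = c * ell k j f := by
  have h2 : PhiB (n := n) (m := m) k j.1 j.2.1.1.1 j.2.1.1.2 (C c) = Polynomial.C (C c) :=
        (PhiB (n := n) (m := m) k j.1 j.2.1.1.1 j.2.1.1.2).commutes c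
  simp only [ell, AddMonoidHom.coe_mk, ZeroHom.coe_mk, map_mul, h2, Polynomial.coeff_C_mul, coeff_C_mul, mul_sub]

theorem SInv_iff_ell {k : Type*} [CommRing k] (f : MvPolynomial (Idx n m) k) :
    SInv f ↔ ∀ j : JJ n m, ell k j f = 0 := by
  rw [SInv_iff_Phi]
  constructor
  · intro h j
    simp only [ell, AddMonoidHom.coe_mk, ZeroHom.coe_mk]
    rw [h _ _ _ j.2.1.2, sub_self]
  · intro h s a b hab
    ext i t
    exact sub_eq_zero.1 (h (s, ⟨(a, b), hab⟩, i, t))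

abbrev II (n m e : ℕ) := ↥((Finset.univ : Finset (Idx n m)).finsuppAntidiag e)

theorem mem_II {n m e : ℕ} (s : Idx n m →₀ ℕ) : s ∈ (Finset.univ : Finset (Idx n m)).finsuppAntidiag e ↔
    s.degree = e := by
  rw [Finset.mem_finsuppAntidiag]
  simp [Finsupp.degree_eq_sum]

theorem hom_expand {k : Type*} [CommRing k] {e : ℕ} {f : MvPolynomial (Idx n m) k} (hf : f.IsHomogeneous e) :
    f = ∑ l : II n m e, monomial l.1 (coeff l.1 f) := by
  ext s
  rw [coeff_sum]
  simp only [coeff_monomial]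
  by_cases hs : s.degree = e
  · rw [Finset.sum_eq_single (⟨s, (mem_II s).2 hs⟩ : II n m e)]
    · simp
    · rintro b _ hb
      rw [if_neg]
      rintro rfl
      exact hb rfl
    · simp
  · rw [hf.coeff_eq_zero hs, Finset.sum_eq_zero]
    intro l _
    rw [if_neg]
    rintro rfl
    exact hs ((mem_II _).1 l.2)

theorem hom_sum {k : Type*} [CommRing k] {e : ℕ} (c : II n m e → k) :
    (∑ l : II n m e, monomial l.1 (c l)).IsHomogeneous e := by
  refine IsHomogeneous.sum _ _ _ fun l _ => isHomogeneous_monomial _ ((mem_II _).1 l.2)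

theorem ell_sum {k : Type*} [CommRing k] {e : ℕ} (c : II n m e → k) (j : JJ n m) :
    ell k j (∑ l : II n m e, monomial l.1 (c l)) =
      ∑ l : II n m e, ((ell ℤ j (monomial l.1 1) : ℤ) : k) * c l := by
  rw [map_sum]
  refine Finset.sum_congr rfl fun l _ => ?_
  have h1 : (monomial l.1 (c l) : MvPolynomial (Idx n m) k) = C (c l) * map (Int.castRingHom k) (monomial l.1 1) := by
    simp [C_mul_monomial]
  rw [h1, ell_C_mul, ell_map, mul_comm]
  rfl

theorem col_id {F : Type} [Field F] {e : ℕ} {Δ : ℤ} (c : II n m e → F) (Q : II n m e → II n m e → ℤ)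
    (hΔF : (Δ : F) ≠ 0) (h1 : ∀ l, (Δ : F) * c l = ∑ i, (Q l i : F) * c i) :
    ∑ l : II n m e, (monomial l.1 (c l) : MvPolynomial (Idx n m) F) = ∑ i : II n m e, (((Δ : F)⁻¹ * c i)) •
        map (Int.castRingHom F) (∑ l : II n m e, monomial l.1 (Q l i)) := by
  have h3 : ∀ i : II n m e, (((Δ : F)⁻¹ * c i)) •
        map (Int.castRingHom F) (∑ l : II n m e, monomial l.1 (Q l i)) =
        ∑ l : II n m e, monomial l.1 (((Δ : F)⁻¹ * c i) * (Q l i : F)) := by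
    intro i
    rw [map_sum, Finset.smul_sum]
    refine Finset.sum_congr rfl fun l _ => ?_
    rw [map_monomial, smul_monomial]
    rfl
  rw [Finset.sum_congr rfl fun i _ => h3 i, Finset.sum_comm]
  refine Finset.sum_congr rfl fun l _ => ?_
  have h4 := map_sum (monomial (R := F) l.1) (fun i => ((Δ : F)⁻¹ * c i) * (Q l i : F)) Finset.univ
  refine Eq.trans ?_ h4
  refine congrArg _ ?_
  rw [← mul_right_inj' hΔF, h1 l, Finset.mul_sum]
  refine Finset.sum_congr rfl fun i _ => ?_
  field_simp

theorem LS_exists (n m e : ℕ) : ∃ (Δ : ℤ) (v : II n m e → MvPolynomial (Idx n m) ℤ), Δ ≠ 0 ∧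
    (∀ i, SInv (v i) ∧ (v i).IsHomogeneous e) ∧
    ∀ (F : Type) [Field F], (Δ : F) ≠ 0 → ∀ x : MvPolynomial (Idx n m) F, SInv x → x.IsHomogeneous e →
      x ∈ Submodule.span F (Set.range fun i => map (Int.castRingHom F) (v i)) := by
  obtain ⟨Δ, Q, hΔ, hQ, hF⟩ := lin_uniform (fun (j : JJ n m) (l : II n m e) => ell ℤ j (monomial l.1 1))
  refine ⟨Δ, fun i => ∑ l : II n m e, monomial l.1 (Q l i), hΔ, fun i => ⟨?_, hom_sum _⟩, ?_⟩
  · rw [SInv_iff_ell]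
    intro j
    rw [ell_sum]
    simpa using hQ j i
  · intro F _ hΔF x hx hxe
    have h1 := hF F (fun l => coeff l.1 x) (fun j => by
      rw [← ell_sum (fun l : II n m e => coeff l.1 x), ← hom_expand hxe]
      exact (SInv_iff_ell x).1 hx j)
    have h2 := col_id (fun l : II n m e => coeff l.1 x) Q hΔF h1
    rw [← hom_expand hxe] at h2
    rw [h2]
    exact Submodule.sum_mem _ fun i _ => Submodule.smul_mem _ _ (Submodule.subset_span ⟨i, rfl⟩)
end ell

section trans
variable {n m : ℕ}

theorem hom_closure {A : Type} {σ : Type} {k : Type} [CommRing k] (g : A → MvPolynomial σ k) (hg : ∀ a, ∃ d, (g a).IsHomogeneous d)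
    {q : MvPolynomial σ k} (hq : q ∈ Submonoid.closure (Set.range g)) : ∃ d, q.IsHomogeneous d := by
  induction hq using Submonoid.closure_induction with
  | mem x hx => obtain ⟨a, rfl⟩ := hx; exact hg a
  | one => exact ⟨0, isHomogeneous_one _ _⟩
  | mul x y _ _ hx hy =>
    obtain ⟨a, ha⟩ := hx
    obtain ⟨b, hb⟩ := hy
    exact ⟨_, ha.mul hb⟩

theorem adjoin_hc {A σ F : Type} [Field F] (g : A → MvPolynomial σ ℤ) (hg : ∀ a, ∃ d, (g a).IsHomogeneous d)
    (e : ℕ) (x : MvPolynomial σ F)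
    (hx : x ∈ Algebra.adjoin F (Set.range fun a => map (Int.castRingHom F) (g a))) :
    homogeneousComponent e x ∈ Submodule.span F
      (map (Int.castRingHom F) '' {q | q ∈ Submonoid.closure (Set.range g) ∧ q.IsHomogeneous e}) := by
  rw [← Subalgebra.mem_toSubmodule, Algebra.adjoin_eq_span] at hx
  induction hx using Submodule.span_induction with
  | mem x hx =>
    have : ∃ q ∈ Submonoid.closure (Set.range g), map (Int.castRingHom F) q = x := by
      induction hx using Submonoid.closure_induction with
      | mem x hx =>
        obtain ⟨a, rfl⟩ := hx
        exact ⟨_, Submonoid.subset_closure ⟨a, rfl⟩, rfl⟩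
      | one => exact ⟨1, one_mem _, map_one _⟩
      | mul x y _ _ hx hy =>
        obtain ⟨a, ha, rfl⟩ := hx
        obtain ⟨b, hb, rfl⟩ := hy
        exact ⟨_, mul_mem ha hb, map_mul _ _ _⟩
    obtain ⟨q, hq, rfl⟩ := this
    obtain ⟨d, hd⟩ := hom_closure g hg hq
    rw [hc_hom (hd.map _)]
    split_ifs with h
    · subst h
      exact Submodule.subset_span ⟨q, ⟨hq, hd⟩, rfl⟩
    · exact zero_mem _
  | zero => simp
  | add x y _ _ hx hy => rw [map_add]; exact add_mem hx hy
  | smul c x _ hx => rw [map_smul]; exact Submodule.smul_mem _ _ hx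

theorem int_functional {e : ℕ} (φ : MvPolynomial (Idx n m) ℚ →ₗ[ℚ] ℚ) : ∃ (δ : ℤ) (c : II n m e → ℤ), δ ≠ 0 ∧
    ∀ f : MvPolynomial (Idx n m) ℤ, f.IsHomogeneous e →
      ((∑ l : II n m e, c l * coeff l.1 f : ℤ) : ℚ) = δ * φ (map (Int.castRingHom ℚ) f) := by
  obtain ⟨⟨δ, hδ⟩, hδ2⟩ := IsLocalization.exist_integer_multiples_of_finite (nonZeroDivisors ℤ)
    (fun l : II n m e => φ (monomial l.1 1))
  choose c hc using hδ2
  have hc' : ∀ l, (c l : ℚ) = δ * φ (monomial l.1 1) := fun l => by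
    have := hc l
    simpa using this
  refine ⟨δ, c, nonZeroDivisors.ne_zero hδ, fun f hf => ?_⟩
  have h1 := hom_expand (hf.map (Int.castRingHom ℚ))
  rw [h1, map_sum, Finset.mul_sum]
  push_cast
  refine Finset.sum_congr rfl fun l _ => ?_
  have h2 : (monomial l.1 (coeff l.1 (map (Int.castRingHom ℚ) f)) : MvPolynomial (Idx n m) ℚ) =
      ((coeff l.1 f : ℤ) : ℚ) • monomial l.1 1 := by
    rw [smul_monomial, coeff_map]; simp
  rw [h2, map_smul, hc', smul_eq_mul]
  ring

theorem exists_char (z : ℤ) (hz : z ≠ 0) : ∃ (p : ℕ) (_ : Fact p.Prime) (F : Type) (_ : Field F) (_ : IsAlgClosed F)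
    (_ : CharP F p), (z : F) ≠ 0 := by
  obtain ⟨p, hp, hpp⟩ := Nat.exists_infinite_primes (z.natAbs + 1)
  haveI : Fact p.Prime := ⟨hpp⟩
  haveI : CharP (AlgebraicClosure (ZMod p)) p :=
    charP_of_injective_algebraMap (algebraMap (ZMod p) (AlgebraicClosure (ZMod p))).injective p
  refine ⟨p, ⟨hpp⟩, AlgebraicClosure (ZMod p), inferInstance, inferInstance, inferInstance, ?_⟩
  intro h
  rw [CharP.intCast_eq_zero_iff _ p] at h
  have := Nat.le_of_dvd (Int.natAbs_pos.2 hz) (Int.natCast_dvd.1 h)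
  omega

theorem char0_main (K : Type) [Field K] [IsAlgClosed K] [CharZero K] (n m : ℕ) (hn : 0 < n) (hm : 0 < m) :
    ∀ e (h : MvPolynomial (Idx n m) K), SInv h → h.IsHomogeneous e → h ∈ Algebra.adjoin K
      {f : MvPolynomial (Idx n m) K | SInv f ∧ ∃ d ≤ m * n ^ 4, f.IsHomogeneous d} := by
  intro e h hS he
  choose Δ v hΔ hv hF using LS_exists n m
  let g : (Σ d : Fin (m * n ^ 4 + 1), II n m d) → MvPolynomial (Idx n m) ℤ := fun a => v a.1 a.2
  have hg : ∀ a, ∃ d, (g a).IsHomogeneous d := fun a => ⟨_, (hv a.1 a.2).2⟩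
  let P : Set (MvPolynomial (Idx n m) ℤ) := {q | q ∈ Submonoid.closure (Set.range g) ∧ q.IsHomogeneous e}
  have key : ∀ j, map (Int.castRingHom ℚ) (v e j) ∈ Submodule.span ℚ (map (Int.castRingHom ℚ) '' P) := by
    intro j
    by_contra hw
    obtain ⟨φ, hφ1, hφ2⟩ := Submodule.exists_le_ker_of_notMem hw
    obtain ⟨δ, c, hδ, hc⟩ := int_functional (e := e) φ
    have hN : (∑ l : II n m e, c l * coeff l.1 (v e j)) ≠ 0 := by
      intro h0
      have := hc _ (hv e j).2
      rw [h0] at this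
      simp only [Int.cast_zero, zero_eq_mul, Int.cast_eq_zero, hδ, false_or] at this
      exact hφ1 this
    have hP : ∀ q ∈ P, (∑ l : II n m e, c l * coeff l.1 q) = 0 := by
      intro q hq
      have := hc q hq.2
      rw [LinearMap.mem_ker.1 (hφ2 (Submodule.subset_span ⟨q, hq, rfl⟩)), mul_zero] at this
      exact_mod_cast this
    obtain ⟨p, _, F, _, _, _, hz⟩ := exists_char
      ((∑ l : II n m e, c l * coeff l.1 (v e j)) * ∏ d : Fin (m * n ^ 4 + 1), Δ d)
      (mul_ne_zero hN (Finset.prod_ne_zero_iff.2 fun d _ => hΔ d))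
    rw [Int.cast_mul] at hz
    have hz1 := left_ne_zero_of_mul hz
    have hz2 := right_ne_zero_of_mul hz
    rw [Int.cast_prod, Finset.prod_ne_zero_iff] at hz2
    have hwF := charp_main F p n m hn hm e (map (Int.castRingHom F) (v e j)) ((hv e j).1.map _) ((hv e j).2.map _)
    have hle : Algebra.adjoin F {f : MvPolynomial (Idx n m) F | SInv f ∧ ∃ d ≤ m * n ^ 4, f.IsHomogeneous d} ≤
        Algebra.adjoin F (Set.range fun a => map (Int.castRingHom F) (g a)) := by
      refine Algebra.adjoin_le ?_
      rintro f ⟨hf1, d, hd, hf2⟩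
      have h1 := hF d F (hz2 ⟨d, by omega⟩ (Finset.mem_univ _)) f hf1 hf2
      have h2 : Submodule.span F (Set.range fun i => map (Int.castRingHom F) (v d i)) ≤
          Subalgebra.toSubmodule (Algebra.adjoin F (Set.range fun a => map (Int.castRingHom F) (g a))) := by
        refine Submodule.span_le.2 ?_
        rintro _ ⟨i, rfl⟩
        exact Algebra.subset_adjoin ⟨⟨⟨d, by omega⟩, i⟩, rfl⟩
      exact h2 h1
    have h3 := adjoin_hc g hg e _ (hle hwF)
    rw [hc_hom ((hv e j).2.map _), if_pos rfl] at h3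
    let LF : MvPolynomial (Idx n m) F →ₗ[F] F := ∑ l : II n m e, (c l : F) • lcoeff F l.1
    have hLF : ∀ f : MvPolynomial (Idx n m) ℤ, LF (map (Int.castRingHom F) f) =
        ((∑ l : II n m e, c l * coeff l.1 f : ℤ) : F) := by
      intro f
      simp [LF, coeff_map]
    have h4 : Submodule.span F (map (Int.castRingHom F) '' P) ≤ LinearMap.ker LF := by
      refine Submodule.span_le.2 ?_
      rintro _ ⟨q, hq, rfl⟩
      show LF _ = 0
      rw [hLF, hP q hq, Int.cast_zero]
    have h5 := LinearMap.mem_ker.1 (h4 h3)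
    rw [hLF] at h5
    exact hz1 h5
  have hmm : ∀ f : MvPolynomial (Idx n m) ℤ, map (algebraMap ℚ K) (map (Int.castRingHom ℚ) f) =
      map (Int.castRingHom K) f := by
    intro f
    rw [MvPolynomial.map_map]
    exact congrArg (fun r => MvPolynomial.map r f) (RingHom.ext_int _ _)
  have h6 : ∀ x ∈ Submodule.span ℚ (map (Int.castRingHom ℚ) '' P), map (algebraMap ℚ K) x ∈
      Algebra.adjoin K {f : MvPolynomial (Idx n m) K | SInv f ∧ ∃ d ≤ m * n ^ 4, f.IsHomogeneous d} := by
    intro x hx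
    induction hx using Submodule.span_induction with
    | mem x hx =>
      obtain ⟨q, ⟨hq, -⟩, rfl⟩ := hx
      rw [hmm]
      induction hq using Submonoid.closure_induction with
      | mem x hx =>
        obtain ⟨a, rfl⟩ := hx
        exact Algebra.subset_adjoin ⟨(hv _ _).1.map _, a.1, by omega, (hv _ _).2.map _⟩
      | one => rw [map_one]; exact one_mem _
      | mul x y _ _ hx hy => rw [map_mul]; exact mul_mem hx hy
    | zero => rw [map_zero]; exact zero_mem _
    | add x y _ _ hx hy => rw [map_add]; exact add_mem hx hy
    | smul c x _ hx =>
      rw [smul_eq_C_mul, map_mul, map_C]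
      exact mul_mem (Subalgebra.algebraMap_mem _ _) hx
  have h7 := hF e K (Int.cast_ne_zero.2 (hΔ e)) h hS he
  have h8 : Submodule.span K (Set.range fun i => map (Int.castRingHom K) (v e i)) ≤
      Subalgebra.toSubmodule (Algebra.adjoin K {f : MvPolynomial (Idx n m) K | SInv f ∧ ∃ d ≤ m * n ^ 4, f.IsHomogeneous d}) := by
    refine Submodule.span_le.2 ?_
    rintro _ ⟨i, rfl⟩
    have := h6 _ (key i)
    rw [hmm] at this
    exact this
  exact h8 h7
end trans

theorem semi_iff (K : Type) [Field K] [Infinite K] (n m : ℕ) (f : MvPolynomial (Idx n m) K) :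
    f ∈ matrixSemiInvariants K n m ↔ SInv f := by
  have h0 : f ∈ matrixSemiInvariants K n m ↔ ∀ (A B : SpecialLinearGroup (Fin n) K)
      (X : Fin m → Matrix (Fin n) (Fin n) K),
      aeval (coo fun i => A.val * X i * (B⁻¹).val) f = aeval (coo X) f := by
    simp only [matrixSemiInvariants, Algebra.mem_iInf, AlgHom.mem_equalizer]
    rfl
  rw [h0]
  constructor
  · intro h
    refine SInv_of_points fun a b hab t x => ?_
    obtain ⟨Y, rfl⟩ : ∃ Y : Fin m → Matrix (Fin n) (Fin n) K, x = coo Y :=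
      ⟨fun i => Matrix.of fun r c => x (i, r, c), rfl⟩
    rw [← coo_row, ← coo_col]
    constructor
    · have := h ⟨transvection a b t, det_transvection_of_ne _ _ hab t⟩ 1 Y
      simpa using this
    · let S : SpecialLinearGroup (Fin n) K := ⟨transvection b a t, det_transvection_of_ne _ _ hab.symm t⟩
      have h1 : (fun i => (1 : SpecialLinearGroup (Fin n) K).val * Y i * ((S⁻¹)⁻¹).val) =
          fun i => Y i * transvection b a t := by
        funext i
        have e : ((S⁻¹)⁻¹).val = transvection b a t := congrArg Subtype.val (inv_inv S)
        rw [e, show (1 : SpecialLinearGroup (Fin n) K).val = 1 from rfl, one_mul]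
      rw [← h1]
      exact h 1 (S⁻¹) Y
  · intro hf A B X
    rw [hf.right _ (B⁻¹).2 (fun i => A.val * X i), hf.left _ A.2]

/-- Over an algebraically closed field of arbitrary characteristic, the ring of
matrix semi-invariants `R(n,m)` is generated by its homogeneous elements of degree `≤ m * n^4`. -/
theorem stmt_0 (K : Type) [Field K] [IsAlgClosed K] (n m : ℕ) (hn : 0 < n) (hm : 0 < m) :
    Algebra.adjoin K
        {f | f ∈ matrixSemiInvariants K n m ∧ ∃ d ≤ m * n ^ 4, f.IsHomogeneous d}
      = matrixSemiInvariants K n m := by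
  haveI : Infinite K := IsAlgClosed.instInfinite
  refine le_antisymm (Algebra.adjoin_le fun f hf => hf.1) ?_
  intro f hf
  have hset : {f | f ∈ matrixSemiInvariants K n m ∧ ∃ d ≤ m * n ^ 4, f.IsHomogeneous d} =
      {f : MvPolynomial (Idx n m) K | SInv f ∧ ∃ d ≤ m * n ^ 4, f.IsHomogeneous d} := by
    ext f
    exact and_congr_left fun _ => semi_iff K n m f
  rw [hset]
  have hS := (semi_iff K n m f).1 hf
  have main : ∀ e (h : MvPolynomial (Idx n m) K), SInv h → h.IsHomogeneous e → h ∈ Algebra.adjoin K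
      {f : MvPolynomial (Idx n m) K | SInv f ∧ ∃ d ≤ m * n ^ 4, f.IsHomogeneous d} := by
    obtain ⟨p, hp⟩ := CharP.exists K
    rcases CharP.char_is_prime_or_zero K p with h | h
    · haveI : Fact p.Prime := ⟨h⟩
      exact charp_main K p n m hn hm
    · subst h
      haveI : CharZero K := CharP.charP_to_charZero K
      exact char0_main K n m hn hm
  rw [← sum_homogeneousComponent f]
  exact Subalgebra.sum_mem _ fun e _ => main e _ (hS.hc e) (homogeneousComponent_isHomogeneous e f)
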